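/- Let d ≥ k ≥ 1 and let S₁, S₂ ⊂ I^d be closed cubes. Suppose that for every ν₁ ∈ S₁, ν₂ ∈ S₂, every t ∈ ℝ^k with |t| = 1 and ν ∈ {ν₁, ν₂}, det M(t,ν₁,ν₂,ν) ≠ 0, where M(t,ν₁,ν₂,ν) is the (d+k)×(d+k) block matrix with upper-left k×k block 0, upper-right block D(ν₁,ν₂), lower-left block D(ν₁,ν₂)^t, and lower-right block Σ_{i=1}^k t_i Hφ_i(ν). Then there is a constant C such that ‖E₁f · E₂g‖_{L²(ℝ^{d+k})} ≤ C ‖f‖_{L^{4(d+k)/(3d+k)}(ℝ^d)} ‖g‖_{L^{4(d+k)/(3d+k)}(ℝ^d)} for all f, g. -/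

import Mathlib

open MeasureTheory ENNReal Matrix

noncomputable section

/-- The extension (adjoint restriction) operator associated to the surface
`ξ ↦ (ξ, Φ ξ)`, acting on functions supported in `S ⊆ I^d`, evaluated at
`w = (x, t) ∈ ℝ^d × ℝ^k`. -/
def extOp (d k : ℕ) (S : Set (Fin d → ℝ)) (Φ : (Fin d → ℝ) → Fin k → ℝ)
    (f : (Fin d → ℝ) → ℂ) (w : (Fin d → ℝ) × (Fin k → ℝ)) : ℂ :=
  ∫ ξ in S, Complex.exp (2 * Real.pi * Complex.I *
    (((∑ i, w.1 i * ξ i) + ∑ j, w.2 j * Φ ξ j : ℝ) : ℂ)) * f ξ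

/-- `S` is a closed cube in `ℝ^d` (an axis-parallel cube `∏ [aᵢ - r, aᵢ + r]`). -/
def IsClosedCube (d : ℕ) (S : Set (Fin d → ℝ)) : Prop :=
  ∃ (a : Fin d → ℝ) (r : ℝ), 0 ≤ r ∧ S = {x | ∀ i, |x i - a i| ≤ r}

/-- The gradient `∇φ(ν)` of a scalar function on `ℝ^d`, as a vector. -/
def gradPhi (d : ℕ) (φ : (Fin d → ℝ) → ℝ) (ν : Fin d → ℝ) : Fin d → ℝ :=
  fun i => fderiv ℝ φ ν (Pi.single i 1)

/-- The Hessian matrix `Hφ(ν)` of a scalar function on `ℝ^d`. -/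
def hessPhi (d : ℕ) (φ : (Fin d → ℝ) → ℝ) (ν : Fin d → ℝ) : Matrix (Fin d) (Fin d) ℝ :=
  Matrix.of fun i j => fderiv ℝ (fun x => fderiv ℝ φ x (Pi.single j 1)) ν (Pi.single i 1)

/-- The `k × d` matrix `D(ν₁, ν₂)` whose `j`-th row is `∇φⱼ(ν₂) - ∇φⱼ(ν₁)`. -/
def Dmat (d k : ℕ) (Φ : (Fin d → ℝ) → Fin k → ℝ) (ν₁ ν₂ : Fin d → ℝ) :
    Matrix (Fin k) (Fin d) ℝ :=
  Matrix.of fun j i => gradPhi d (fun x => Φ x j) ν₂ i - gradPhi d (fun x => Φ x j) ν₁ i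

/-- The matrix `∑ᵢ tᵢ Hφᵢ(ν)`. -/
def tHess (d k : ℕ) (Φ : (Fin d → ℝ) → Fin k → ℝ) (t : Fin k → ℝ) (ν : Fin d → ℝ) :
    Matrix (Fin d) (Fin d) ℝ :=
  ∑ i, t i • hessPhi d (fun x => Φ x i) ν

/-- The `(k+d) × (k+d)` block matrix `M(t, ν₁, ν₂, ν)` with blocks
`0, D(ν₁,ν₂); D(ν₁,ν₂)ᵗ, ∑ᵢ tᵢ Hφᵢ(ν)`. -/
def Mmat (d k : ℕ) (Φ : (Fin d → ℝ) → Fin k → ℝ) (t : Fin k → ℝ) (ν₁ ν₂ ν : Fin d → ℝ) :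
    Matrix (Fin k ⊕ Fin d) (Fin k ⊕ Fin d) ℝ :=
  Matrix.fromBlocks 0 (Dmat d k Φ ν₁ ν₂) (Dmat d k Φ ν₁ ν₂)ᵀ (tHess d k Φ t ν)

open scoped ContDiff Topology

/-- The unimodular function `e(θ) = exp(2 π i θ)`. -/
def osc (θ : ℝ) : ℂ := Complex.exp (2 * Real.pi * Complex.I * (θ : ℂ))

lemma norm_osc (θ : ℝ) : ‖osc θ‖ = 1 := by
  have : (2 * Real.pi * Complex.I * (θ : ℂ)) = ((2 * Real.pi * θ : ℝ) : ℂ) * Complex.I := by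
    push_cast; ring
  rw [osc, this, Complex.norm_exp_ofReal_mul_I]

lemma osc_add (a b : ℝ) : osc (a + b) = osc a * osc b := by
  rw [osc, osc, osc, ← Complex.exp_add]; push_cast; ring_nf

lemma osc_zero : osc 0 = 1 := by simp [osc]

lemma conj_osc (a : ℝ) : (starRingEnd ℂ) (osc a) = osc (-a) := by
  rw [osc, osc, ← Complex.exp_conj]; simp [Complex.conj_ofNat]

lemma contDiff_osc : ContDiff ℝ ∞ osc := by
  unfold osc
  exact ((contDiff_const.mul Complex.ofRealCLM.contDiff).cexp)

@[fun_prop]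
lemma continuous_osc : Continuous osc := contDiff_osc.continuous

@[fun_prop]
lemma measurable_osc : Measurable osc := continuous_osc.measurable

lemma hasDerivAt_osc (θ : ℝ) : HasDerivAt osc (2 * Real.pi * Complex.I * osc θ) θ := by
  have h : HasDerivAt (fun x : ℝ => (2 * Real.pi * Complex.I * (x : ℂ)))
      (2 * Real.pi * Complex.I) θ := by
    simpa using (Complex.ofRealCLM.hasDerivAt (x := θ)).const_mul (2 * Real.pi * Complex.I)
  exact (h.cexp).congr_deriv (mul_comm _ _)

section NonstationaryPhase

variable {P V : Type*} [NormedAddCommGroup P] [NormedSpace ℝ P]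
  [NormedAddCommGroup V] [NormedSpace ℝ V]

/-- `A` is smooth at the points of `Q × K` and vanishes off `K` in the second variable. -/
def IsAmplitude (Q : Set P) (K : Set V) (A : P × V → ℂ) : Prop :=
  (∀ z ∈ Q ×ˢ K, ContDiffAt ℝ ∞ A z) ∧ ∀ z : P × V, z.2 ∉ K → A z = 0

lemma IsAmplitude.contDiffAt {Q : Set P} {K : Set V} {A : P × V → ℂ} (hA : IsAmplitude Q K A)
    (hK : IsClosed K) {q : P} (hq : q ∈ Q) (v : V) : ContDiffAt ℝ ∞ A (q, v) := by
  by_cases hv : v ∈ K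
  · exact hA.1 _ ⟨hq, hv⟩
  · have : A =ᶠ[𝓝 (q, v)] fun _ => 0 := by
      have ho : IsOpen {z : P × V | z.2 ∉ K} := hK.isOpen_compl.preimage continuous_snd
      filter_upwards [ho.mem_nhds hv] with z hz using hA.2 z hz
    exact contDiffAt_const.congr_of_eventuallyEq this

variable {ι : Type*} [Fintype ι]

/-- The squared length of the `V`-gradient of `p` with respect to the family `e`. -/
def gradSq (e : ι → V) (p : P × V → ℝ) (z : P × V) : ℝ :=
  ∑ i, (fderiv ℝ p z (0, e i)) ^ 2

/-- The component of the vector field `∇p / |∇p|²` along `e i`. -/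
def gradField (e : ι → V) (p : P × V → ℝ) (i : ι) (z : P × V) : ℂ :=
  ((fderiv ℝ p z (0, e i) / gradSq e p z : ℝ) : ℂ)

/-- The transposed differential operator `A ↦ div (A ∇p / |∇p|²)`. -/
def ampStep (e : ι → V) (p : P × V → ℝ) (A : P × V → ℂ) (z : P × V) : ℂ :=
  ∑ i, fderiv ℝ (fun z => A z * gradField e p i z) z (0, e i)

lemma contDiff_fderiv_apply {E F : Type*} [NormedAddCommGroup E] [NormedSpace ℝ E]
    [NormedAddCommGroup F] [NormedSpace ℝ F] {p : E → F} (hp : ContDiff ℝ ∞ p) (w : E) :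
    ContDiff ℝ ∞ fun z => fderiv ℝ p z w :=
  (hp.fderiv_right (m := ∞) (by simp)).clm_apply contDiff_const

lemma contDiff_gradSq (e : ι → V) {p : P × V → ℝ} (hp : ContDiff ℝ ∞ p) :
    ContDiff ℝ ∞ (gradSq e p) :=
  ContDiff.sum fun _ _ => (contDiff_fderiv_apply hp _).pow 2

lemma contDiffAt_gradField (e : ι → V) {p : P × V → ℝ} (hp : ContDiff ℝ ∞ p) (i : ι)
    {z : P × V} (hz : gradSq e p z ≠ 0) : ContDiffAt ℝ ∞ (gradField e p i) z :=
  (Complex.ofRealCLM.contDiff.contDiffAt).comp z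
    (((contDiff_fderiv_apply hp _).contDiffAt).div (contDiff_gradSq e hp).contDiffAt hz)

lemma IsAmplitude.mul_gradField {Q : Set P} {K : Set V} {A : P × V → ℂ}
    (hA : IsAmplitude Q K A) (e : ι → V) {p : P × V → ℝ}
    (hp : ContDiff ℝ ∞ p) (hne : ∀ z ∈ Q ×ˢ K, gradSq e p z ≠ 0) (i : ι) :
    IsAmplitude Q K fun z => A z * gradField e p i z :=
  ⟨fun z hz => (hA.1 z hz).mul (contDiffAt_gradField e hp i (hne z hz)),
    fun z hz => by simp [hA.2 z hz]⟩

lemma IsAmplitude.fderiv_apply {Q : Set P} {K : Set V} {A : P × V → ℂ}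
    (hA : IsAmplitude Q K A) (hK : IsClosed K) (w : P × V) :
    IsAmplitude Q K fun z => fderiv ℝ A z w := by
  refine ⟨fun z hz => ((hA.1 z hz).fderiv_right (m := ∞) (by simp)).clm_apply contDiffAt_const,
    fun z hz => ?_⟩
  have : A =ᶠ[𝓝 z] fun _ => 0 := by
    have ho : IsOpen {z : P × V | z.2 ∉ K} := hK.isOpen_compl.preimage continuous_snd
    filter_upwards [ho.mem_nhds hz] with z hz using hA.2 z hz
  simp [this.fderiv_eq]

lemma IsAmplitude.ampStep {Q : Set P} {K : Set V} {A : P × V → ℂ}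
    (hA : IsAmplitude Q K A) (hK : IsClosed K) (e : ι → V) {p : P × V → ℝ}
    (hp : ContDiff ℝ ∞ p) (hne : ∀ z ∈ Q ×ˢ K, gradSq e p z ≠ 0) :
    IsAmplitude Q K (ampStep e p A) := by
  refine ⟨fun z hz => ContDiffAt.sum fun i _ =>
    ((hA.mul_gradField e hp hne i).fderiv_apply hK _).1 z hz, fun z hz => ?_⟩
  exact Finset.sum_eq_zero fun i _ => ((hA.mul_gradField e hp hne i).fderiv_apply hK _).2 z hz

lemma IsAmplitude.contDiff_slice {Q : Set P} {K : Set V} {A : P × V → ℂ}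
    (hA : IsAmplitude Q K A) (hK : IsClosed K) {q : P} (hq : q ∈ Q) :
    ContDiff ℝ ∞ fun v => A (q, v) :=
  contDiff_iff_contDiffAt.2 fun v =>
    (hA.contDiffAt hK hq v).comp v (contDiff_prodMk_right q).contDiffAt

lemma IsAmplitude.hasCompactSupport_slice {Q : Set P} {K : Set V} {A : P × V → ℂ}
    (hA : IsAmplitude Q K A) (hK : IsCompact K) (q : P) :
    HasCompactSupport fun v => A (q, v) :=
  HasCompactSupport.intro hK fun v hv => hA.2 (q, v) hv

lemma fderiv_slice {F : Type*} [NormedAddCommGroup F] [NormedSpace ℝ F] {f : P × V → F}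
    {q : P} {v : V} (hf : DifferentiableAt ℝ f (q, v)) (w : V) :
    fderiv ℝ (fun v => f (q, v)) v w = fderiv ℝ f (q, v) (0, w) := by
  have h : HasFDerivAt (fun v => f (q, v)) _ v :=
    hf.hasFDerivAt.comp v (hasFDerivAt_prodMk_right q v)
  rw [h.fderiv]
  simp

lemma sum_mul_gradField_mul_fderiv {Q : Set P} {K : Set V} {A : P × V → ℂ}
    (hA : IsAmplitude Q K A) (e : ι → V) {p : P × V → ℝ}
    (hne : ∀ z ∈ Q ×ˢ K, gradSq e p z ≠ 0) {z : P × V} (hz : z.1 ∈ Q) :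
    ∑ i, A z * gradField e p i z * (fderiv ℝ p z (0, e i) : ℂ) = A z := by
  by_cases hv : z.2 ∈ K
  · have : ∑ i, fderiv ℝ p z (0, e i) / gradSq e p z * fderiv ℝ p z (0, e i) = 1 := by
      simp_rw [div_mul_eq_mul_div, ← sq, ← Finset.sum_div]
      exact div_self (hne z ⟨hz, hv⟩)
    have : ∑ i, gradField e p i z * (fderiv ℝ p z (0, e i) : ℂ) = 1 := by
      simp only [gradField]
      exact_mod_cast this
    simp_rw [mul_assoc, ← Finset.mul_sum, this, mul_one]
  · simp [hA.2 z hv]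

variable [FiniteDimensional ℝ V] [MeasurableSpace V] [BorelSpace V]
  {μ : Measure V} [μ.IsAddHaarMeasure]

lemma integral_fderiv_apply_eq_zero {u : V → ℂ} (hu : ContDiff ℝ 1 u)
    (hc : HasCompactSupport u) (w : V) : ∫ v, fderiv ℝ u v w ∂μ = 0 := by
  have hInt : Integrable (fun v => fderiv ℝ u v w) μ :=
    (((hu.continuous_fderiv one_ne_zero).clm_apply continuous_const)).integrable_of_hasCompactSupport
      (hc.fderiv_apply (𝕜 := ℝ) w)
  have := integral_smul_fderiv_eq_neg_fderiv_smul_of_integrable (𝕜 := ℝ) (μ := μ)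
    (f := fun _ => (1 : ℝ)) (g := u) (v := w) (by simp) (by simpa using hInt)
    (by simpa using hu.continuous.integrable_of_hasCompactSupport hc)
    (by fun_prop) fun x _ => hu.differentiable one_ne_zero x
  simpa using this

lemma integral_osc_mul_fderiv {φ : V → ℝ} (hφ : ContDiff ℝ ∞ φ) {B : V → ℂ}
    (hB : ContDiff ℝ ∞ B) (hc : HasCompactSupport B) (w : V) (m : ℝ) :
    2 * Real.pi * Complex.I * m * ∫ v, osc (m * φ v) * (B v * (fderiv ℝ φ v w : ℂ)) ∂μ =
      -∫ v, osc (m * φ v) * fderiv ℝ B v w ∂μ := by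
  have hosc : ContDiff ℝ ∞ fun v => osc (m * φ v) := contDiff_osc.comp (contDiff_const.mul hφ)
  have hderiv : ∀ v, fderiv ℝ (fun v => osc (m * φ v) * B v) v w =
      2 * Real.pi * Complex.I * m * (osc (m * φ v) * (B v * (fderiv ℝ φ v w : ℂ))) +
      osc (m * φ v) * fderiv ℝ B v w := by
    intro v
    have h1 : HasFDerivAt φ (fderiv ℝ φ v) v :=
      (hφ.differentiable (by simp)).differentiableAt.hasFDerivAt
    have h2 := (hasDerivAt_osc (m * φ v)).hasFDerivAt.comp v (h1.const_mul m)
    have h3 : HasFDerivAt B (fderiv ℝ B v) v :=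
      (hB.differentiable (by simp)).differentiableAt.hasFDerivAt
    have h4 := (h2.mul h3).fderiv
    have h5 : (osc ∘ fun v => m * φ v) * B = fun v => osc (m * φ v) * B v := rfl
    rw [h5] at h4
    rw [h4]
    simp
    ring
  have hz := integral_fderiv_apply_eq_zero (μ := μ) (u := fun v => osc (m * φ v) * B v)
    ((hosc.mul hB).of_le (mod_cast le_top)) hc.mul_left w
  simp_rw [hderiv] at hz
  have hi1 : Integrable (fun v => osc (m * φ v) * (B v * (fderiv ℝ φ v w : ℂ))) μ :=
    ((hosc.mul (hB.mul (Complex.ofRealCLM.contDiff.comp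
      (contDiff_fderiv_apply hφ w)))).continuous).integrable_of_hasCompactSupport
      hc.mul_right.mul_left
  have hi2 : Integrable (fun v => osc (m * φ v) * fderiv ℝ B v w) μ :=
    ((hosc.mul (contDiff_fderiv_apply hB w)).continuous).integrable_of_hasCompactSupport
      (hc.fderiv_apply (𝕜 := ℝ) w).mul_left
  rw [integral_add (hi1.const_mul _) hi2, integral_const_mul] at hz
  linear_combination hz

lemma integral_osc_mul_amplitude {Q : Set P} {K : Set V} {A : P × V → ℂ}
    (hA : IsAmplitude Q K A) (hK : IsCompact K) (e : ι → V) {p : P × V → ℝ}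
    (hp : ContDiff ℝ ∞ p) (hne : ∀ z ∈ Q ×ˢ K, gradSq e p z ≠ 0) {q : P} (hq : q ∈ Q)
    (m : ℝ) :
    2 * Real.pi * Complex.I * m * ∫ v, osc (m * p (q, v)) * A (q, v) ∂μ =
      -∫ v, osc (m * p (q, v)) * ampStep e p A (q, v) ∂μ := by
  have hKc := hK.isClosed
  have hφ : ContDiff ℝ ∞ fun v => p (q, v) := hp.comp (contDiff_prodMk_right q)
  have hosc : ContDiff ℝ ∞ fun v => osc (m * p (q, v)) :=
    contDiff_osc.comp (contDiff_const.mul hφ)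
  have hW := fun i => hA.mul_gradField e hp hne i
  have hWs := fun i => (hW i).contDiff_slice hKc hq
  have hWc := fun i => (hW i).hasCompactSupport_slice hK q
  have hfp : ∀ i v, fderiv ℝ (fun v => p (q, v)) v (e i) = fderiv ℝ p (q, v) (0, e i) :=
    fun i v => fderiv_slice (hp.differentiable (by simp)).differentiableAt _
  have hfW : ∀ i v, fderiv ℝ (fun v => A (q, v) * gradField e p i (q, v)) v (e i) =
      fderiv ℝ (fun z => A z * gradField e p i z) (q, v) (0, e i) :=
    fun i v => fderiv_slice (((hW i).contDiffAt hKc hq v).differentiableAt (by simp)) _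
  have h := fun i => integral_osc_mul_fderiv (μ := μ) hφ (hWs i) (hWc i) (e i) m
  have h' := Finset.sum_congr (rfl : (Finset.univ : Finset ι) = Finset.univ) fun i _ => h i
  rw [← Finset.mul_sum, Finset.sum_neg_distrib, ← integral_finsetSum, ← integral_finsetSum] at h'
  · have e1 : ∀ v, ∑ i, osc (m * p (q, v)) * (A (q, v) * gradField e p i (q, v) *
        (fderiv ℝ (fun v => p (q, v)) v (e i) : ℂ)) = osc (m * p (q, v)) * A (q, v) := by
      intro v
      simp_rw [hfp, ← Finset.mul_sum]
      rw [sum_mul_gradField_mul_fderiv hA e hne (z := (q, v)) hq]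
    have e2 : ∀ v, ∑ i, osc (m * p (q, v)) *
        fderiv ℝ (fun v => A (q, v) * gradField e p i (q, v)) v (e i) =
        osc (m * p (q, v)) * ampStep e p A (q, v) := by
      intro v
      simp_rw [hfW, ← Finset.mul_sum]
      rfl
    simp_rw [e1, e2] at h'
    exact h'
  · intro i _
    exact ((hosc.mul (contDiff_fderiv_apply (hWs i) _)).continuous).integrable_of_hasCompactSupport
      ((hWc i).fderiv_apply (𝕜 := ℝ) _).mul_left
  · intro i _
    exact ((hosc.mul ((hWs i).mul (Complex.ofRealCLM.contDiff.comp
      (contDiff_fderiv_apply hφ _)))).continuous).integrable_of_hasCompactSupport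
      (hWc i).mul_right.mul_left

/-- **Non-stationary phase**, uniformly in parameters ranging over a compact set. -/
theorem exists_norm_integral_osc_le {Q : Set P} {K : Set V} (hQ : IsCompact Q) (hK : IsCompact K)
    (e : ι → V) {p : P × V → ℝ} (hp : ContDiff ℝ ∞ p)
    (hne : ∀ z ∈ Q ×ˢ K, gradSq e p z ≠ 0) (N : ℕ) :
    ∀ A : P × V → ℂ, IsAmplitude Q K A → ∃ C : ℝ, 0 ≤ C ∧ ∀ q ∈ Q, ∀ m : ℝ, 0 < m →
      ‖∫ v, osc (m * p (q, v)) * A (q, v) ∂μ‖ * m ^ N ≤ C := by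
  induction N with
  | zero =>
    intro A hA
    obtain ⟨B, hB⟩ := (hQ.prod hK).exists_bound_of_continuousOn (f := A)
      fun z hz => (hA.1 z hz).continuousAt.continuousWithinAt
    refine ⟨max B 0 * μ.real K, by positivity, fun q hq m _ => ?_⟩
    rw [pow_zero, mul_one, ← setIntegral_eq_integral_of_forall_compl_eq_zero (s := K)
      fun v hv => by simp [hA.2 (q, v) hv]]
    refine norm_setIntegral_le_of_norm_le_const hK.measure_lt_top fun v hv => ?_
    rw [norm_mul, norm_osc, one_mul]
    exact (hB (q, v) ⟨hq, hv⟩).trans (le_max_left _ _)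
  | succ N ih =>
    intro A hA
    obtain ⟨C, hC0, hC⟩ := ih _ (hA.ampStep hK.isClosed e hp hne)
    refine ⟨C, hC0, fun q hq m hm => ?_⟩
    have h := congrArg norm (integral_osc_mul_amplitude (μ := μ) hA hK e hp hne hq m)
    rw [norm_neg, norm_mul] at h
    have h2 : ‖(2 * Real.pi * Complex.I * m : ℂ)‖ = 2 * Real.pi * m := by
      simp [abs_of_pos hm, abs_of_pos Real.pi_pos]
    rw [h2] at h
    have h3 := hC q hq m hm
    rw [← h] at h3
    refine le_trans ?_ h3
    rw [pow_succ]
    have hpi := Real.pi_gt_three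
    have : 0 ≤ ‖∫ v, osc (m * p (q, v)) * A (q, v) ∂μ‖ * (m ^ N * m) := by positivity
    nlinarith
end NonstationaryPhase

section MeanDeriv

variable {P X : Type*} [NormedAddCommGroup P] [NormedSpace ℝ P]
  [NormedAddCommGroup X] [NormedSpace ℝ X]

lemma contDiff_intervalIntegral {f : P × ℝ → ℝ} (hf : ContDiff ℝ ∞ f) :
    ContDiff ℝ ∞ fun x => ∫ s in (0 : ℝ)..1, f (x, s) := by
  let χ : ContDiffBump (0 : ℝ) := ⟨1, 2, one_pos, one_lt_two⟩
  have h := contDiffOn_convolution_right_with_param_comp (𝕜 := ℝ) (n := ⊤) (μ := volume)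
    (ContinuousLinearMap.mul ℝ ℝ) (s := (Set.univ : Set P)) (v := fun _ => (0 : ℝ))
    contDiffOn_const (f := (Set.Ioc (0 : ℝ) 1).indicator 1)
    (g := fun x u => χ u * f (x, -u)) (k := Metric.closedBall 0 2) isOpen_univ
    (isCompact_closedBall 0 2) ?_ ?_ ?_
  · rw [contDiffOn_univ] at h
    convert! h using 1
    funext x
    rw [convolution_def, intervalIntegral.integral_of_le zero_le_one,
      ← integral_indicator measurableSet_Ioc]
    congr 1
    ext t
    by_cases ht : t ∈ Set.Ioc (0 : ℝ) 1
    · have : χ (-t) = 1 := χ.one_of_mem_closedBall (by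
        simp only [χ, Metric.mem_closedBall, dist_zero_right, norm_neg, Real.norm_eq_abs]
        rw [abs_of_pos ht.1]; exact ht.2)
      simp [ht, this]
    · simp [ht]
  · intro p x _ hx
    have : χ x = 0 := χ.zero_of_le_dist (by
      simpa [χ] using (not_le.1 (Metric.mem_closedBall.not.1 hx)).le)
    simp [this]
  · exact ((integrable_indicator_iff measurableSet_Ioc).2
      (integrableOn_const (C := (1 : ℝ)) (by simp))).locallyIntegrable
  · refine ContDiff.contDiffOn ?_
    change ContDiff ℝ ∞ fun z : P × ℝ => χ z.2 * f (z.1, -z.2)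
    exact (χ.contDiff.comp contDiff_snd).mul (hf.comp (contDiff_fst.prodMk contDiff_snd.neg))

/-- The average of the derivative of `φ` in the direction `w` along the segment `[x, x + v]`,
as a function of `(x, v, w)`. -/
def meanDeriv (φ : X → ℝ) (z : X × X × X) : ℝ :=
  ∫ s in (0 : ℝ)..1, fderiv ℝ φ (z.1 + s • z.2.1) z.2.2

lemma contDiff_meanDeriv {φ : X → ℝ} (hφ : ContDiff ℝ ∞ φ) : ContDiff ℝ ∞ (meanDeriv φ) := by
  have h : ContDiff ℝ ∞ fun z : (X × X × X) × ℝ =>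
      fderiv ℝ φ (z.1.1 + z.2 • z.1.2.1) z.1.2.2 := by
    refine ContDiff.clm_apply ((hφ.fderiv_right (m := ∞) (by simp)).comp ?_) (by fun_prop)
    fun_prop
  exact contDiff_intervalIntegral h

lemma meanDeriv_zero (φ : X → ℝ) (x w : X) : meanDeriv φ (x, 0, w) = fderiv ℝ φ x w := by
  simp [meanDeriv]

lemma sub_eq_mul_meanDeriv {φ : X → ℝ} (hφ : ContDiff ℝ ∞ φ) (x w : X) (c : ℝ) :
    φ (x + c • w) - φ x = c * meanDeriv φ (x, c • w, w) := by
  have hd : ∀ s : ℝ, HasDerivAt (fun s : ℝ => φ (x + s • c • w))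
      (fderiv ℝ φ (x + s • c • w) (c • w)) s := fun s => by
    have h1 : HasDerivAt (fun s : ℝ => x + s • c • w) (c • w) s := by
      simpa using ((hasDerivAt_id s).smul_const (c • w)).const_add x
    exact ((hφ.differentiable (by simp)).differentiableAt.hasFDerivAt).comp_hasDerivAt s h1
  have hc : Continuous fun s : ℝ => fderiv ℝ φ (x + s • c • w) (c • w) :=
    ((hφ.continuous_fderiv (by simp)).comp (by fun_prop)).clm_apply continuous_const
  have := intervalIntegral.integral_eq_sub_of_hasDerivAt (fun s _ => hd s)
    (hc.intervalIntegrable 0 1)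
  simp only [one_smul, zero_smul, add_zero] at this
  rw [← this, meanDeriv, ← intervalIntegral.integral_const_mul]
  simp

end MeanDeriv

/-- Real vectors with `n` coordinates (with the sup norm). -/
abbrev Vec (n : ℕ) := Fin n → ℝ

section Phase

variable {d k : ℕ}

/-- The map `(x, y) ↦ Φ(x) - Φ(y) - Φ(b + x - y)`. -/
def theta (Φ : Vec d → Vec k) (b x y : Vec d) : Vec k := Φ x - Φ y - Φ (b + x - y)

/-- Injectivity form of the invertibility of `M(τ, b, x, b)` for `τ ≠ 0`. -/
def TransCond (Φ : Vec d → Vec k) (b x : Vec d) : Prop :=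
  ∀ τ : Vec k, τ ≠ 0 → ∀ (ς : Vec k) (v : Vec d),
    (∀ j, fderiv ℝ (fun u => Φ u j) x v = fderiv ℝ (fun u => Φ u j) b v) →
    (∀ i, ∑ j, ς j * (fderiv ℝ (fun u => Φ u j) x (Pi.single i 1) -
        fderiv ℝ (fun u => Φ u j) b (Pi.single i 1)) +
      ∑ j, τ j * fderiv ℝ (fun y => fderiv ℝ (fun u => Φ u j) y v) b (Pi.single i 1) = 0) →
    ς = 0 ∧ v = 0

/-- The normalized phase, with parameters `((b, x, v), ς, (ς', v'))` and variables `(τ, y)`. -/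
def phase (Φ : Vec d → Vec k)
    (z : ((Vec d × Vec d × Vec d) × Vec k × (Vec k × Vec d)) × (Vec k × Vec d)) : ℝ :=
  ∑ j, z.1.2.2.1 j * (Φ z.1.1.2.1 j - Φ z.2.2 j - Φ (z.1.1.1 + z.1.1.2.1 - z.2.2) j) -
  ∑ j, z.2.1 j * (meanDeriv (fun u => Φ u j) (z.1.1.2.1, z.1.1.2.2, z.1.2.2.2) -
    meanDeriv (fun u => Φ u j) (z.1.1.1 + z.1.1.2.1 - z.2.2, z.1.1.2.2, z.1.2.2.2))

lemma contDiff_phase {Φ : Vec d → Vec k} (hΦ : ContDiff ℝ ∞ Φ) : ContDiff ℝ ∞ (phase Φ) := by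
  have hφ : ∀ j, ContDiff ℝ ∞ fun u => Φ u j := fun j => contDiff_pi.1 hΦ j
  have hm := fun j => contDiff_meanDeriv (hφ j)
  refine ContDiff.sub (ContDiff.sum fun j _ => ?_) (ContDiff.sum fun j _ => ?_)
  · refine ContDiff.mul (by fun_prop) ((ContDiff.sub ?_ ?_).sub ?_)
    · exact (hφ j).comp (by fun_prop)
    · exact (hφ j).comp (by fun_prop)
    · exact (hφ j).comp (by fun_prop)
  · refine ContDiff.mul (by fun_prop) (ContDiff.sub ?_ ?_)
    · exact (hm j).comp (by fun_prop)
    · exact (hm j).comp (by fun_prop)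

lemma mul_phase {Φ : Vec d → Vec k} (hΦ : ContDiff ℝ ∞ Φ) (b x y v : Vec d) (ς ς' τ : Vec k)
    (m : ℝ) :
    m * phase Φ (((b, x, m • v), ς, (ς', v)), (τ, y)) =
      ∑ j, m * ς' j * theta Φ b x y j -
      ∑ j, τ j * (theta Φ b (x + m • v) y j - theta Φ b x y j) := by
  have hφ : ∀ j, ContDiff ℝ ∞ fun u => Φ u j := fun j => contDiff_pi.1 hΦ j
  have h1 := fun j => sub_eq_mul_meanDeriv (hφ j) x v m
  have h2 := fun j => sub_eq_mul_meanDeriv (hφ j) (b + x - y) v m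
  simp only [phase, theta, Pi.sub_apply, mul_sub, Finset.mul_sum]
  congr 1
  · refine Finset.sum_congr rfl fun j _ => by ring
  · refine Finset.sum_congr rfl fun j _ => ?_
    have e : b + (x + m • v) - y = b + x - y + m • v := by abel
    rw [e]
    linear_combination (-τ j) * h1 j + τ j * h2 j

/-- The coordinate frame of `ℝ^k × ℝ^d`. -/
def frame (k d : ℕ) : Fin k ⊕ Fin d → Vec k × Vec d :=
  Sum.elim (fun j => (Pi.single j 1, 0)) fun i => (0, Pi.single i 1)

lemma fderiv_phase {Φ : Vec d → Vec k} (hΦ : ContDiff ℝ ∞ Φ) (b x v w : Vec d)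
    (ς ς' τ σ : Vec k) :
    fderiv ℝ (phase Φ) (((b, x, 0), ς, (ς', v)), (τ, x)) (0, (σ, w)) =
      -∑ j, ς' j * (fderiv ℝ (fun u => Φ u j) x w - fderiv ℝ (fun u => Φ u j) b w) -
      ∑ j, (σ j * (fderiv ℝ (fun u => Φ u j) x v - fderiv ℝ (fun u => Φ u j) b v) +
        τ j * fderiv ℝ (fun y => fderiv ℝ (fun u => Φ u j) y v) b w) := by
  have hφ : ∀ j, ContDiff ℝ ∞ fun u => Φ u j := fun j => contDiff_pi.1 hΦ j
  have hline : ∀ {F : Vec d → ℝ}, ContDiff ℝ ∞ F → ∀ a c : Vec d,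
      HasDerivAt (fun s : ℝ => F (a + s • c)) (fderiv ℝ F a c) 0 := by
    intro F hF a c
    have h1 : HasDerivAt (fun s : ℝ => a + s • c) c 0 := by
      simpa using ((hasDerivAt_id (0 : ℝ)).smul_const c).const_add a
    have h2 := (hF.differentiable (by simp)).differentiableAt.hasFDerivAt (x := a + (0 : ℝ) • c)
    have := h2.comp_hasDerivAt (0 : ℝ) h1
    simpa [Function.comp_def] using this
  set q : (Vec d × Vec d × Vec d) × Vec k × (Vec k × Vec d) := ((b, x, 0), ς, (ς', v)) with hq
  have hd : HasDerivAt (fun s : ℝ => phase Φ (q, (τ + s • σ, x + s • w)))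
      (fderiv ℝ (phase Φ) (q, (τ, x)) (0, (σ, w))) 0 := by
    have h1 : HasDerivAt (fun s : ℝ => ((q, (τ, x)) : _ × (Vec k × Vec d)) + s • (0, (σ, w)))
        (0, (σ, w)) 0 := by
      simpa using ((hasDerivAt_id (0 : ℝ)).smul_const
        ((0, (σ, w)) : ((Vec d × Vec d × Vec d) × Vec k × (Vec k × Vec d)) ×
          (Vec k × Vec d))).const_add (q, (τ, x))
    have h2 := ((contDiff_phase hΦ).differentiable (by simp)).differentiableAt.hasFDerivAt
      (x := (q, (τ, x)) + (0 : ℝ) • ((0, (σ, w)) : _ × (Vec k × Vec d)))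
    have := h2.comp_hasDerivAt (0 : ℝ) h1
    simpa [Function.comp_def] using this
  refine hd.unique ?_
  have e : ∀ s : ℝ, phase Φ (q, (τ + s • σ, x + s • w)) =
      ∑ j, ς' j * (Φ x j - Φ (x + s • w) j - Φ (b + s • -w) j) -
      ∑ j, (τ j + s * σ j) * (fderiv ℝ (fun u => Φ u j) x v -
        fderiv ℝ (fun u => Φ u j) (b + s • -w) v) := by
    intro s
    have : b + x - (x + s • w) = b + s • -w := by rw [smul_neg]; abel
    simp [phase, hq, meanDeriv_zero, this]
  simp_rw [e]
  have key1 : ∀ j, HasDerivAt (fun s : ℝ => ς' j * (Φ x j - Φ (x + s • w) j - Φ (b + s • -w) j))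
      (ς' j * ((0 - fderiv ℝ (fun u => Φ u j) x w) - fderiv ℝ (fun u => Φ u j) b (-w))) 0 :=
    fun j => ((((hasDerivAt_const _ _).sub (hline (hφ j) x w)).sub
      (hline (hφ j) b (-w))).const_mul _)
  have key2 : ∀ j, HasDerivAt (fun s : ℝ => (τ j + s * σ j) * (fderiv ℝ (fun u => Φ u j) x v -
        fderiv ℝ (fun u => Φ u j) (b + s • -w) v))
      (σ j * (fderiv ℝ (fun u => Φ u j) x v - fderiv ℝ (fun u => Φ u j) (b + (0 : ℝ) • -w) v) +
        (τ j + 0 * σ j) *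
          (0 - fderiv ℝ (fun y => fderiv ℝ (fun u => Φ u j) y v) b (-w))) 0 := by
    intro j
    have h1 : HasDerivAt (fun s : ℝ => τ j + s * σ j) (σ j) 0 := by
      simpa using ((hasDerivAt_id (0 : ℝ)).mul_const (σ j)).const_add (τ j)
    exact h1.mul ((hasDerivAt_const _ _).sub (hline (contDiff_fderiv_apply (hφ j) v) b (-w)))
  refine ((HasDerivAt.fun_sum fun j _ => key1 j).sub
    (HasDerivAt.fun_sum fun j _ => key2 j)).congr_deriv ?_
  rw [← Finset.sum_neg_distrib]
  congr 1
  · refine Finset.sum_congr rfl fun j _ => ?_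
    rw [map_neg]; ring
  · refine Finset.sum_congr rfl fun j _ => ?_
    rw [map_neg]; simp

lemma gradSq_phase_ne_zero {Φ : Vec d → Vec k} (hΦ : ContDiff ℝ ∞ Φ) {b x : Vec d}
    (hc : TransCond Φ b x) (ς ς' τ : Vec k) (v : Vec d) (hτ : τ ≠ 0) (hv : (ς', v) ≠ 0) :
    gradSq (frame k d) (phase Φ) (((b, x, 0), ς, (ς', v)), (τ, x)) ≠ 0 := by
  intro h0
  have h1 := (Finset.sum_eq_zero_iff_of_nonneg fun i _ => sq_nonneg _).1 h0
  have h2 : ∀ i, fderiv ℝ (phase Φ) (((b, x, 0), ς, (ς', v)), (τ, x)) (0, frame k d i) = 0 :=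
    fun i => by simpa using h1 i (Finset.mem_univ _)
  have := hc τ hτ ς' v (fun j => ?_) fun i => ?_
  · exact hv (Prod.ext this.1 this.2)
  · have h := h2 (Sum.inl j)
    rw [frame, Sum.elim_inl, fderiv_phase hΦ] at h
    simp [Pi.single_apply] at h
    linarith
  · have h := h2 (Sum.inr i)
    rw [frame, Sum.elim_inr, fderiv_phase hΦ] at h
    simp only [Pi.zero_apply, zero_mul, zero_add] at h
    linarith

end Phase

section LocalPhase

variable {d k : ℕ}

lemma exists_gradSq_phase_ne_zero {Φ : Vec d → Vec k} (hΦ : ContDiff ℝ ∞ Φ) {b₀ x₀ : Vec d}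
    (hc : TransCond Φ b₀ x₀) {K : Set (Vec k)} (hK : IsCompact K) (h0 : (0 : Vec k) ∉ K) (R : ℝ) :
    ∃ δ > 0, ∀ b ∈ Metric.closedBall b₀ δ, ∀ x ∈ Metric.closedBall x₀ δ,
      ∀ v ∈ Metric.closedBall (0 : Vec d) δ, ∀ y ∈ Metric.closedBall x₀ δ,
      ∀ ς ∈ Metric.closedBall (0 : Vec k) R, ∀ σ ∈ Metric.sphere (0 : Vec k × Vec d) 1,
      ∀ τ ∈ K, gradSq (frame k d) (phase Φ) (((b, x, v), ς, σ), (τ, y)) ≠ 0 := by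
  let n : Set (((Vec d × Vec d × Vec d) × Vec d) × (Vec k × (Vec k × Vec d) × Vec k)) :=
    {p | gradSq (frame k d) (phase Φ) ((p.1.1, p.2.1, p.2.2.1), (p.2.2.2, p.1.2)) ≠ 0}
  have hn : IsOpen n := by
    have h := (contDiff_gradSq (frame k d) (contDiff_phase hΦ)).continuous.comp
      (f := fun p : ((Vec d × Vec d × Vec d) × Vec d) × (Vec k × (Vec k × Vec d) × Vec k) =>
        ((p.1.1, p.2.1, p.2.2.1), (p.2.2.2, p.1.2))) (by fun_prop)
    exact isOpen_ne_fun h continuous_const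
  have hsub : {((b₀, x₀, (0 : Vec d)), x₀)} ×ˢ
      (Metric.closedBall (0 : Vec k) R ×ˢ Metric.sphere (0 : Vec k × Vec d) 1 ×ˢ K) ⊆ n := by
    rintro ⟨p, ς, σ, τ⟩ ⟨rfl, _, hσ, hτ⟩
    refine gradSq_phase_ne_zero hΦ hc ς σ.1 τ σ.2 (fun h => h0 (h ▸ hτ)) fun h => ?_
    have h' : σ = 0 := h
    simp [h'] at hσ
  obtain ⟨u, w, hu, -, hsu, htw, huw⟩ := generalized_tube_lemma isCompact_singleton
    ((isCompact_closedBall (0 : Vec k) R).prod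
      ((isCompact_sphere (0 : Vec k × Vec d) 1).prod hK)) hn hsub
  obtain ⟨δ, hδ, hδu⟩ := Metric.nhds_basis_closedBall.mem_iff.1
    (hu.mem_nhds (hsu (Set.mem_singleton _)))
  refine ⟨δ, hδ, fun b hb x hx v hv y hy ς hς σ hσ τ hτ => ?_⟩
  have : (((b, x, v), y), (ς, σ, τ)) ∈ n := by
    refine huw ⟨hδu ?_, htw ⟨hς, hσ, hτ⟩⟩
    simp only [Metric.mem_closedBall, Prod.dist_eq, max_le_iff] at *
    exact ⟨⟨hb, hx, hv⟩, hy⟩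
  exact this

/-- The unnormalized phase of the kernel obtained by squaring. -/
def kerPhase (Φ : Vec d → Vec k) (b x v : Vec d) (ς : Vec k) (z : Vec k × Vec d) : ℝ :=
  ∑ j, ς j * theta Φ b x z.2 j - ∑ j, z.1 j * (theta Φ b (x + v) z.2 j - theta Φ b x z.2 j)

theorem exists_kerPhase_bound {Φ : Vec d → Vec k} (hΦ : ContDiff ℝ ∞ Φ) {b₀ x₀ : Vec d}
    (hc : TransCond Φ b₀ x₀) {K : Set (Vec k)} (hK : IsCompact K) (h0 : (0 : Vec k) ∉ K)
    {β : Vec k → ℝ} (hβ : ContDiff ℝ ∞ β) (hβK : ∀ τ, τ ∉ K → β τ = 0) :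
    ∃ δ > 0, ∀ ψ : Vec d → ℝ, ContDiff ℝ ∞ ψ → (∀ y, y ∉ Metric.closedBall x₀ δ → ψ y = 0) →
      ∀ N : ℕ, ∃ C, 0 ≤ C ∧ ∀ b ∈ Metric.closedBall b₀ δ, ∀ x ∈ Metric.closedBall x₀ δ,
      ∀ v ∈ Metric.closedBall (0 : Vec d) δ, ∀ ς : Vec k, ∀ l : ℝ, 0 < l →
      ‖∫ z, osc (l * kerPhase Φ b x v ς z) * ((β (z.1 + ς) * β z.1 * ψ z.2 : ℝ) : ℂ)‖ *
        (1 + l * ‖(ς, v)‖) ^ N ≤ C := by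
  obtain ⟨R, hR⟩ := hK.isBounded.subset_closedBall 0
  obtain ⟨δ, hδ, hne⟩ := exists_gradSq_phase_ne_zero hΦ hc hK h0 (R + R)
  refine ⟨δ, hδ, fun ψ hψ hψ0 N => ?_⟩
  let Q : Set ((Vec d × Vec d × Vec d) × Vec k × (Vec k × Vec d)) :=
    (Metric.closedBall b₀ δ ×ˢ Metric.closedBall x₀ δ ×ˢ Metric.closedBall 0 δ) ×ˢ
      Metric.closedBall 0 (R + R) ×ˢ Metric.sphere 0 1
  have hQ : IsCompact Q := ((isCompact_closedBall _ _).prod ((isCompact_closedBall _ _).prod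
    (isCompact_closedBall _ _))).prod ((isCompact_closedBall _ _).prod (isCompact_sphere _ _))
  let A : ((Vec d × Vec d × Vec d) × Vec k × (Vec k × Vec d)) × (Vec k × Vec d) → ℂ :=
    fun z => ((β (z.2.1 + z.1.2.1) * β z.2.1 * ψ z.2.2 : ℝ) : ℂ)
  have hA : IsAmplitude Q (K ×ˢ Metric.closedBall x₀ δ) A := by
    constructor
    · intro z _
      refine ContDiff.contDiffAt (Complex.ofRealCLM.contDiff.comp ?_)
      exact ((hβ.comp (by fun_prop)).mul (hβ.comp (by fun_prop))).mul (hψ.comp (by fun_prop))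
    · intro z hz
      have : β z.2.1 * ψ z.2.2 = 0 := by
        by_cases h1 : z.2.1 ∈ K
        · rw [hψ0 _ fun h2 => hz ⟨h1, h2⟩, mul_zero]
        · rw [hβK _ h1, zero_mul]
      simp only [A, mul_assoc, this, mul_zero, Complex.ofReal_zero]
  have hne' : ∀ z ∈ Q ×ˢ (K ×ˢ Metric.closedBall x₀ δ),
      gradSq (frame k d) (phase Φ) z ≠ 0 := by
    rintro ⟨⟨⟨b, x, v⟩, ς, σ⟩, τ, y⟩ ⟨⟨⟨hb, hx, hv⟩, hς, hσ⟩, hτ, hy⟩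
    exact hne b hb x hx v hv y hy ς hς σ hσ τ hτ
  have : (volume : Measure (Vec k × Vec d)).IsAddHaarMeasure :=
    Measure.prod.instIsAddHaarMeasure _ _
  have main := exists_norm_integral_osc_le (μ := volume) hQ (hK.prod (isCompact_closedBall x₀ δ))
    (frame k d) (contDiff_phase hΦ) hne'
  obtain ⟨C₀, hC₀, h₀⟩ := main 0 A hA
  obtain ⟨C₁, hC₁, h₁⟩ := main N A hA
  set C₂ : ℝ := ‖∫ z : Vec k × Vec d, ((β z.1 * β z.1 * ψ z.2 : ℝ) : ℂ)‖
  refine ⟨2 ^ (N - 1) * (C₀ + C₁) + C₂, by positivity, fun b hb x hx v hv ς l hl => ?_⟩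
  by_cases hς : ς ∈ Metric.closedBall (0 : Vec k) (R + R)
  swap
  · have : ∀ z : Vec k × Vec d, β (z.1 + ς) * β z.1 * ψ z.2 = 0 := by
      intro z
      by_contra h
      simp only [mul_eq_zero, not_or] at h
      have h1 := hR (not_imp_comm.1 (hβK _) h.1.1)
      have h2 := hR (not_imp_comm.1 (hβK _) h.1.2)
      rw [mem_closedBall_zero_iff] at h1 h2 hς
      have := norm_sub_le (z.1 + ς) z.1
      rw [add_sub_cancel_left] at this
      linarith
    simp only [this, Complex.ofReal_zero, mul_zero, integral_zero, norm_zero, zero_mul]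
    positivity
  rcases eq_or_ne (ς, v) 0 with h0 | h0
  · obtain ⟨rfl, rfl⟩ := Prod.mk_eq_zero.1 h0
    simp only [kerPhase, Pi.zero_apply, zero_mul, Finset.sum_const_zero, add_zero, sub_self,
      mul_zero, osc_zero, one_mul, Prod.mk_zero_zero, norm_zero, one_pow, mul_one]
    exact le_add_of_nonneg_left (by positivity)
  · set m := ‖(ς, v)‖ with hm
    have hm0 : 0 < m := norm_pos_iff.2 h0
    have hq : ((b, x, v), ς, (m⁻¹ • ς, m⁻¹ • v)) ∈ Q := by
      refine ⟨⟨hb, hx, hv⟩, hς, ?_⟩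
      rw [mem_sphere_zero_iff_norm, ← Prod.smul_mk, norm_smul, ← hm, norm_inv, Real.norm_eq_abs,
        abs_of_pos hm0, inv_mul_cancel₀ hm0.ne']
    have e : ∀ z : Vec k × Vec d, l * kerPhase Φ b x v ς z =
        l * m * phase Φ (((b, x, v), ς, (m⁻¹ • ς, m⁻¹ • v)), z) := by
      intro z
      have := mul_phase hΦ b x z.2 (m⁻¹ • v) ς (m⁻¹ • ς) z.1 m
      rw [smul_smul, mul_inv_cancel₀ hm0.ne', one_smul] at this
      rw [mul_assoc, this, kerPhase]
      simp only [Pi.smul_apply, smul_eq_mul, mul_inv_cancel_left₀ hm0.ne']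
    have h₀' := h₀ _ hq (l * m) (by positivity)
    have h₁' := h₁ _ hq (l * m) (by positivity)
    simp only [← e] at h₀' h₁'
    rw [pow_zero, mul_one] at h₀'
    refine le_add_of_le_of_nonneg ?_ (norm_nonneg _)
    have h3 := add_pow_le (zero_le_one (α := ℝ)) (by positivity : 0 ≤ l * m) N
    rw [one_pow] at h3
    calc _ ≤ _ * (2 ^ (N - 1) * (1 + (l * m) ^ N)) := by gcongr
      _ = 2 ^ (N - 1) * (_ + _ * (l * m) ^ N) := by ring
      _ ≤ _ := by gcongr

end LocalPhase

section Decay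

variable {E F : Type*} [NormedAddCommGroup E] [NormedSpace ℝ E] [FiniteDimensional ℝ E]
  [MeasurableSpace E] [BorelSpace E]

lemma integrable_decay (μ : Measure E) [μ.IsAddHaarMeasure] {N : ℕ} (hN : Module.finrank ℝ E < N)
    {l : ℝ} (hl : 0 < l) : Integrable (fun z : E => ((1 + l * ‖z‖) ^ N)⁻¹) μ := by
  have h := (integrable_one_add_norm (μ := μ) (E := E) (r := N) (by exact_mod_cast hN)).comp_smul
    hl.ne'
  refine h.congr (Filter.Eventually.of_forall fun z => ?_)
  simp only [norm_smul, Real.norm_eq_abs, abs_of_pos hl]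
  rw [Real.rpow_neg (by positivity), Real.rpow_natCast]

lemma integral_decay (μ : Measure E) [μ.IsAddHaarMeasure] (N : ℕ) {l : ℝ} (hl : 0 < l) :
    ∫ z : E, ((1 + l * ‖z‖) ^ N)⁻¹ ∂μ =
      (l ^ Module.finrank ℝ E)⁻¹ * ∫ z : E, ((1 + ‖z‖) ^ N)⁻¹ ∂μ := by
  have h := Measure.integral_comp_smul μ (fun z : E => ((1 + ‖z‖) ^ N)⁻¹) l
  rw [abs_of_nonneg (by positivity), smul_eq_mul] at h
  rw [← h]
  simp only [norm_smul, Real.norm_eq_abs, abs_of_pos hl]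

end Decay

section Squaring

variable {d k : ℕ}

lemma continuous_theta {Φ : Vec d → Vec k} (hΦ : Continuous Φ) (b : Vec d) :
    Continuous fun p : Vec d × Vec d => theta Φ b p.1 p.2 := by
  unfold theta
  fun_prop

/-- The phase `l s · (r + Θ_b(x, y))`. -/
def linPhase (Φ : Vec d → Vec k) (r : Vec k) (b : Vec d) (l : ℝ) (s : Vec k) (x y : Vec d) : ℝ :=
  l * ∑ j, s j * (r j + theta Φ b x y j)

lemma continuous_linPhase {Φ : Vec d → Vec k} (hΦ : Continuous Φ) (r : Vec k) (b : Vec d) (l : ℝ) :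
    Continuous fun p : Vec k × Vec d × Vec d => linPhase Φ r b l p.1 p.2.1 p.2.2 := by
  have h : ∀ j, Continuous fun p : Vec k × Vec d × Vec d => theta Φ b p.2.1 p.2.2 j := fun j =>
    (continuous_apply j).comp ((continuous_theta hΦ b).comp continuous_snd)
  unfold linPhase
  fun_prop

lemma linPhase_sub (Φ : Vec d → Vec k) (r : Vec k) (b : Vec d) (l : ℝ) (τ ς : Vec k)
    (x x' y : Vec d) :
    linPhase Φ r b l (τ + ς) x y - linPhase Φ r b l τ x' y =
      l * kerPhase Φ b x (x' - x) ς (τ, y) + l * ∑ j, ς j * r j := by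
  simp only [linPhase, kerPhase, add_sub_cancel, Pi.add_apply, add_mul, mul_add, mul_sub,
    Finset.sum_add_distrib, Finset.sum_sub_distrib]
  ring

/-- The dyadic piece `∫ β(s) e(l s · (r + Θ_b(x, y))) ds`. -/
def dyadicKer (Φ : Vec d → Vec k) (β : Vec k → ℝ) (r : Vec k) (b : Vec d) (l : ℝ)
    (x y : Vec d) : ℂ :=
  ∫ s, (β s : ℂ) * osc (linPhase Φ r b l s x y)

lemma stronglyMeasurable_dyadicKer {Φ : Vec d → Vec k} (hΦ : Continuous Φ) {β : Vec k → ℝ}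
    (hβ : Continuous β) (r : Vec k) (b : Vec d) (l : ℝ) :
    StronglyMeasurable fun p : Vec d × Vec d => dyadicKer Φ β r b l p.1 p.2 := by
  have h : Continuous fun p : (Vec d × Vec d) × Vec k =>
      (β p.2 : ℂ) * osc (linPhase Φ r b l p.2 p.1.1 p.1.2) := by
    have := (continuous_linPhase hΦ r b l).comp
      (f := fun p : (Vec d × Vec d) × Vec k => (p.2, p.1.1, p.1.2)) (by fun_prop)
    have h2 : Continuous fun p : (Vec d × Vec d) × Vec k =>
      linPhase Φ r b l p.2 p.1.1 p.1.2 := this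
    fun_prop
  exact h.stronglyMeasurable.integral_prod_right

lemma norm_dyadicKer_le (Φ : Vec d → Vec k) (β : Vec k → ℝ) (r : Vec k) (b : Vec d) (l : ℝ)
    (x y : Vec d) : ‖dyadicKer Φ β r b l x y‖ ≤ ∫ s, |β s| := by
  refine (norm_integral_le_integral_norm _).trans (le_of_eq ?_)
  simp [norm_osc]

lemma dyadicKer_mul_conj {Φ : Vec d → Vec k} (β : Vec k → ℝ) (r : Vec k) (b : Vec d) (l : ℝ)
    (x x' y : Vec d) :
    dyadicKer Φ β r b l x y * (starRingEnd ℂ) (dyadicKer Φ β r b l x' y) =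
      ∫ τ, ∫ ς, osc (l * ∑ j, ς j * r j) * (osc (l * kerPhase Φ b x (x' - x) ς (τ, y)) *
        ((β (τ + ς) * β τ : ℝ) : ℂ)) := by
  rw [dyadicKer, dyadicKer, ← integral_conj, mul_comm, ← integral_mul_const]
  congr 1
  funext τ
  rw [← integral_const_mul, ← integral_add_left_eq_self _ τ]
  congr 1
  funext ς
  rw [map_mul, Complex.conj_ofReal, conj_osc]
  have : osc (-linPhase Φ r b l τ x' y) * osc (linPhase Φ r b l (τ + ς) x y) =
      osc (l * kerPhase Φ b x (x' - x) ς (τ, y)) * osc (l * ∑ j, ς j * r j) := by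
    rw [← osc_add, ← osc_add, ← linPhase_sub]
    ring_nf
  push_cast
  linear_combination (β τ * β (τ + ς) : ℂ) * this

lemma continuous_kerPhase {Φ : Vec d → Vec k} (hΦ : Continuous Φ) (b x v : Vec d) :
    Continuous fun p : (Vec k × Vec d) × Vec k => kerPhase Φ b x v p.2 p.1 := by
  have h : ∀ (x : Vec d) (j : Fin k),
      Continuous fun p : (Vec k × Vec d) × Vec k => theta Φ b x p.1.2 j := fun x j =>
    (continuous_apply j).comp ((continuous_theta hΦ b).comp
      (f := fun p : (Vec k × Vec d) × Vec k => (x, p.1.2)) (by fun_prop))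
  unfold kerPhase
  have h1 := h x
  have h2 := h (x + v)
  fun_prop

lemma norm_integral_dyadicKer_mul_conj_le {Φ : Vec d → Vec k} (hΦ : Continuous Φ)
    {β : Vec k → ℝ} (hβ : Continuous β) (hβc : HasCompactSupport β) {ψ : Vec d → ℝ}
    (hψ : Continuous ψ) (hψc : HasCompactSupport ψ) (r : Vec k) (b : Vec d) {l : ℝ}
    (hl : 0 < l) (x x' : Vec d) {C : ℝ}
    (hC : ∀ ς : Vec k, ‖∫ z, osc (l * kerPhase Φ b x (x' - x) ς z) *
      ((β (z.1 + ς) * β z.1 * ψ z.2 : ℝ) : ℂ)‖ * (1 + l * ‖(ς, x' - x)‖) ^ (k + d + 1) ≤ C) :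
    ‖∫ y, (ψ y : ℂ) * (dyadicKer Φ β r b l x y *
      (starRingEnd ℂ) (dyadicKer Φ β r b l x' y))‖ ≤
      ∫ ς : Vec k, C * ((1 + l * ‖(ς, x' - x)‖) ^ (k + d + 1))⁻¹ := by
  set H : (Vec k × Vec d) × Vec k → ℂ := fun p =>
    osc (l * ∑ j, p.2 j * r j) * (osc (l * kerPhase Φ b x (x' - x) p.2 p.1) *
      ((β (p.1.1 + p.2) * β p.1.1 * ψ p.1.2 : ℝ) : ℂ)) with hH
  have hHc : Continuous H := by
    have := continuous_kerPhase hΦ b x (x' - x)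
    fun_prop
  have hHs : HasCompactSupport H := by
    refine HasCompactSupport.intro (K := (tsupport β ×ˢ tsupport ψ) ×ˢ
      ((fun p : Vec k × Vec k => p.1 - p.2) '' (tsupport β ×ˢ tsupport β))) ?_ ?_
    · exact (hβc.isCompact.prod hψc.isCompact).prod
        ((hβc.isCompact.prod hβc.isCompact).image (by fun_prop))
    · rintro ⟨⟨τ, y⟩, ς⟩ hp
      have : β (τ + ς) * β τ * ψ y = 0 := by
        by_contra h
        simp only [mul_eq_zero, not_or] at h
        exact hp ⟨⟨subset_tsupport _ h.1.2, subset_tsupport _ h.2⟩,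
          ⟨(τ + ς, τ), ⟨subset_tsupport _ h.1.1, subset_tsupport _ h.1.2⟩, by simp⟩⟩
      simp only [hH, this, Complex.ofReal_zero, mul_zero]
  have hHi : Integrable H ((volume : Measure (Vec k × Vec d)).prod volume) :=
    hHc.integrable_of_hasCompactSupport hHs
  have e : ∫ y, (ψ y : ℂ) * (dyadicKer Φ β r b l x y *
      (starRingEnd ℂ) (dyadicKer Φ β r b l x' y)) = ∫ ς, ∫ z, H (z, ς) := by
    rw [← integral_prod_symm _ hHi, integral_prod _ hHi, Measure.volume_eq_prod,
      integral_prod_symm _ hHi.integral_prod_left]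
    congr 1
    funext y
    rw [dyadicKer_mul_conj, ← integral_const_mul]
    congr 1
    funext τ
    rw [← integral_const_mul]
    congr 1
    funext ς
    simp only [hH]
    push_cast
    ring
  rw [e]
  refine norm_integral_le_of_norm_le ?_ (Filter.Eventually.of_forall fun ς => ?_)
  · refine Integrable.const_mul ?_ _
    have hcont : Continuous fun ς : Vec k => ((1 + l * ‖(ς, x' - x)‖) ^ (k + d + 1))⁻¹ :=
      Continuous.inv₀ (by fun_prop) fun ς => by positivity
    have hfr : Module.finrank ℝ (Vec k) < k + d + 1 := by simp
    refine (integrable_decay (volume : Measure (Vec k)) hfr hl).mono'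
      hcont.aestronglyMeasurable (Filter.Eventually.of_forall fun ς => ?_)
    rw [Real.norm_of_nonneg (by positivity)]
    gcongr
    exact le_max_left _ _
  · rw [← div_eq_mul_inv, le_div_iff₀ (by positivity)]
    refine le_trans (le_of_eq ?_) (hC ς)
    simp only [hH]
    rw [integral_const_mul, norm_mul, norm_osc, one_mul]

end Squaring

section DyadicBound

variable {d k : ℕ}

lemma setIntegral_norm_le_of_sq {X : Type*} [MeasurableSpace X] {μ : Measure X} {G : Set X}
    {U : X → ℂ} (hU : IntegrableOn (fun x => ‖U x‖) G μ)
    (hU2 : IntegrableOn (fun x => ‖U x‖ ^ 2) G μ) (hG : μ G ≠ ⊤) {M : ℝ} (hM : 0 < M)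
    (h : ∫ x in G, ‖U x‖ ^ 2 ∂μ ≤ M * μ.real G) :
    ∫ x in G, ‖U x‖ ∂μ ≤ Real.sqrt M * μ.real G := by
  have hs : 0 < Real.sqrt M := Real.sqrt_pos.2 hM
  have hss : Real.sqrt M * Real.sqrt M = M := Real.mul_self_sqrt hM.le
  have hc : Integrable (fun _ : X => M) (μ.restrict G) := integrableOn_const hG
  have h1 : ∫ x in G, 2 * Real.sqrt M * ‖U x‖ ∂μ ≤ ∫ x in G, (M + ‖U x‖ ^ 2) ∂μ := by
    refine setIntegral_mono (hU.const_mul _)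
      (hc.add hU2) fun x => ?_
    nlinarith [sq_nonneg (Real.sqrt M - ‖U x‖)]
  rw [integral_const_mul, integral_add hc hU2, setIntegral_const,
    smul_eq_mul] at h1
  refine le_of_mul_le_mul_left (a := Real.sqrt M) ?_ hs
  rw [← mul_assoc, hss]
  linarith

theorem exists_dyadic_bound {Φ : Vec d → Vec k} (hΦ : ContDiff ℝ ∞ Φ) {b₀ x₀ : Vec d}
    (hc : TransCond Φ b₀ x₀) {K : Set (Vec k)} (hK : IsCompact K) (h0 : (0 : Vec k) ∉ K)
    {β : Vec k → ℝ} (hβ : ContDiff ℝ ∞ β) (hβK : ∀ τ, τ ∉ K → β τ = 0) :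
    ∃ δ > 0, ∃ C > 0, ∀ b ∈ Metric.closedBall b₀ δ, ∀ G ⊆ Metric.closedBall x₀ (δ / 2),
      MeasurableSet G → ∀ (r : Vec k) (l : ℝ), 0 < l →
      ‖∫ y in G, ∫ x in G, dyadicKer Φ β r b l x y‖ ≤
        C * Real.sqrt (l ^ (k + d))⁻¹ * volume.real G := by
  have hβc : HasCompactSupport β := HasCompactSupport.intro hK hβK
  obtain ⟨δ, hδ, hδ'⟩ := exists_kerPhase_bound hΦ hc hK h0 hβ hβK
  let ψ : ContDiffBump x₀ := ⟨δ / 2, δ, by positivity, by linarith⟩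
  obtain ⟨C, hC0, hC⟩ := hδ' ψ ψ.contDiff (fun y hy => ψ.zero_of_le_dist
    (not_le.1 (Metric.mem_closedBall.not.1 hy)).le) (k + d + 1)
  have : (volume : Measure (Vec k × Vec d)).IsAddHaarMeasure :=
    Measure.prod.instIsAddHaarMeasure _ _
  set c : ℝ := ∫ z : Vec k × Vec d, ((1 + ‖z‖) ^ (k + d + 1))⁻¹
  have hc0 : 0 ≤ c := integral_nonneg fun z => by positivity
  have hfr : Module.finrank ℝ (Vec k × Vec d) = k + d := by simp
  refine ⟨δ, hδ, Real.sqrt (C * c + 1), Real.sqrt_pos.2 (by positivity),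
    fun b hb G hGs hG r l hl => ?_⟩
  have hGfin : volume G ≠ ⊤ :=
    ((measure_mono hGs).trans_lt (isCompact_closedBall x₀ (δ / 2)).measure_lt_top).ne
  have : IsFiniteMeasure (volume.restrict G) := ⟨by simpa using hGfin.lt_top⟩
  set D := dyadicKer Φ β r b l with hD
  have hDm : StronglyMeasurable fun p : Vec d × Vec d => D p.1 p.2 :=
    stronglyMeasurable_dyadicKer hΦ.continuous hβ.continuous r b l
  set B : ℝ := ∫ s, |β s|
  have hDB : ∀ x y, ‖D x y‖ ≤ B := norm_dyadicKer_le Φ β r b l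
  have hB0 : 0 ≤ B := (norm_nonneg _).trans (hDB 0 0)
  set U : Vec d → ℂ := fun y => ∫ x in G, D x y with hU
  have hUm : StronglyMeasurable U :=
    (hDm.comp_measurable (measurable_swap)).integral_prod_right' (ν := volume.restrict G)
  have hUB : ∀ y, ‖U y‖ ≤ B * volume.real G := fun y =>
    norm_setIntegral_le_of_norm_le_const hGfin.lt_top fun x _ => hDB x y
  set S := Metric.closedBall x₀ δ
  have hS : volume S < ⊤ := (isCompact_closedBall x₀ δ).measure_lt_top
  have : IsFiniteMeasure (volume.restrict S) := ⟨by simpa using hS⟩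
  have hψ1 : ∀ y, ‖(ψ y : ℂ)‖ ≤ 1 := fun y => by
    rw [Complex.norm_real, Real.norm_of_nonneg ψ.nonneg]; exact ψ.le_one
  have hψm : Measurable ψ := ψ.continuous.measurable
  set W : Vec d → ℝ := fun v => ∫ ς : Vec k, C * ((1 + l * ‖(ς, v)‖) ^ (k + d + 1))⁻¹ with hW
  have hdec : Integrable (fun z : Vec k × Vec d => C * ((1 + l * ‖z‖) ^ (k + d + 1))⁻¹) :=
    (integrable_decay volume (by rw [hfr]; omega) hl).const_mul C
  have hWi : Integrable W := hdec.integral_prod_right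
  have hWint : ∫ v, W v = C * ((l ^ (k + d))⁻¹ * c) := by
    rw [hW, ← integral_prod_symm _ hdec, integral_const_mul, ← Measure.volume_eq_prod,
      integral_decay volume _ hl, hfr]
  have hW0 : ∀ v, 0 ≤ W v := fun v => integral_nonneg fun ς => by positivity
  have hker : ∀ x ∈ G, ∀ x' ∈ G, ‖∫ y in S, (ψ y : ℂ) * (D x y * (starRingEnd ℂ) (D x' y))‖ ≤
      W (x' - x) := by
    intro x hx x' hx'
    have hx1 : x ∈ S := Metric.closedBall_subset_closedBall (by linarith) (hGs hx)
    have hv : x' - x ∈ Metric.closedBall (0 : Vec d) δ := by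
      rw [mem_closedBall_zero_iff, ← dist_eq_norm]
      have h1 := Metric.mem_closedBall.1 (hGs hx)
      have h2 := Metric.mem_closedBall.1 (hGs hx')
      linarith [dist_triangle_right x' x x₀]
    rw [setIntegral_eq_integral_of_forall_compl_eq_zero]
    · exact norm_integral_dyadicKer_mul_conj_le hΦ.continuous hβ.continuous hβc ψ.continuous
        ψ.hasCompactSupport r b hl x x' fun ς => hC b hb x hx1 _ hv ς l hl
    · intro y hy
      rw [ψ.zero_of_le_dist (not_le.1 (Metric.mem_closedBall.not.1 hy)).le]
      simp
  have hsq : ‖∫ y in S, (ψ y : ℂ) * (U y * (starRingEnd ℂ) (U y))‖ ≤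
      C * ((l ^ (k + d))⁻¹ * c) * volume.real G := by
    have hmeas : StronglyMeasurable fun p : Vec d × Vec d × Vec d =>
        (ψ p.1 : ℂ) * (D p.2.1 p.1 * (starRingEnd ℂ) (D p.2.2 p.1)) := by
      refine StronglyMeasurable.mul ?_ (StronglyMeasurable.mul ?_ ?_)
      · exact (Complex.measurable_ofReal.comp (hψm.comp measurable_fst)).stronglyMeasurable
      · exact hDm.comp_measurable (g := fun p : Vec d × Vec d × Vec d => (p.2.1, p.1))
          (by fun_prop)
      · exact Complex.continuous_conj.comp_stronglyMeasurable
          (hDm.comp_measurable (g := fun p : Vec d × Vec d × Vec d => (p.2.2, p.1)) (by fun_prop))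
    have hInt : Integrable (fun p : Vec d × Vec d × Vec d =>
        (ψ p.1 : ℂ) * (D p.2.1 p.1 * (starRingEnd ℂ) (D p.2.2 p.1)))
        ((volume.restrict S).prod ((volume.restrict G).prod (volume.restrict G))) := by
      refine Integrable.of_bound hmeas.aestronglyMeasurable (1 * (B * B))
        (Filter.Eventually.of_forall fun p => ?_)
      rw [norm_mul, norm_mul, RCLike.norm_conj]
      gcongr
      exacts [hψ1 _, hDB _ _, hDB _ _]
    have e : ∫ y in S, (ψ y : ℂ) * (U y * (starRingEnd ℂ) (U y)) =
        ∫ x in G, ∫ x' in G, ∫ y in S, (ψ y : ℂ) * (D x y * (starRingEnd ℂ) (D x' y)) := by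
      rw [← integral_prod _ hInt.integral_prod_right, ← integral_prod_symm _ hInt,
        integral_prod _ hInt]
      congr 1
      funext y
      change _ = ∫ p : Vec d × Vec d, (ψ y : ℂ) * (D p.1 y * (starRingEnd ℂ) (D p.2 y)) ∂_
      rw [integral_const_mul, integral_prod_mul (fun x => D x y)
        (fun x => (starRingEnd ℂ) (D x y)), integral_conj]
    rw [e]
    refine norm_setIntegral_le_of_norm_le_const hGfin.lt_top fun x hx => ?_
    calc _ ≤ ∫ x' in G, W (x' - x) := by
          refine norm_integral_le_of_norm_le (hWi.comp_sub_right x).integrableOn ?_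
          filter_upwards [ae_restrict_mem hG] with x' hx' using hker x hx x' hx'
      _ ≤ ∫ x', W (x' - x) :=
          setIntegral_le_integral (hWi.comp_sub_right x) (Filter.Eventually.of_forall fun _ => hW0 _)
      _ = _ := by rw [integral_sub_right_eq_self W x, hWint]
  have hUn : ∀ y, U y * (starRingEnd ℂ) (U y) = ((‖U y‖ ^ 2 : ℝ) : ℂ) := fun y => by
    rw [Complex.mul_conj, Complex.normSq_eq_norm_sq]
  have hU2 : ∀ T : Set (Vec d), volume T ≠ ⊤ →
      IntegrableOn (fun y => ‖U y‖ ^ 2) T := fun T hT => by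
    have : IsFiniteMeasure (volume.restrict T) := ⟨by simpa using hT.lt_top⟩
    refine Integrable.of_bound (hUm.norm.pow 2).aestronglyMeasurable ((B * volume.real G) ^ 2)
      (Filter.Eventually.of_forall fun y => ?_)
    rw [Real.norm_of_nonneg (by positivity)]
    exact pow_le_pow_left₀ (norm_nonneg _) (hUB y) 2
  have hmain : ∫ y in G, ‖U y‖ ^ 2 ≤ (C * c + 1) * (l ^ (k + d))⁻¹ * volume.real G := by
    have h1 : ∫ y in G, ‖U y‖ ^ 2 ≤ ∫ y in S, ψ y * ‖U y‖ ^ 2 := by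
      have hi : IntegrableOn (fun y => ψ y * ‖U y‖ ^ 2) S := by
        refine (hU2 S hS.ne).mono' (hψm.stronglyMeasurable.mul (hUm.norm.pow 2)).aestronglyMeasurable
          (Filter.Eventually.of_forall fun y => ?_)
        rw [Real.norm_of_nonneg (mul_nonneg ψ.nonneg (by positivity))]
        exact mul_le_of_le_one_left (by positivity) ψ.le_one
      calc ∫ y in G, ‖U y‖ ^ 2 = ∫ y in G, ψ y * ‖U y‖ ^ 2 := by
            refine setIntegral_congr_fun hG fun y hy => ?_
            rw [ψ.one_of_mem_closedBall (hGs hy), one_mul]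
        _ ≤ _ := setIntegral_mono_set hi
            (Filter.Eventually.of_forall fun y => mul_nonneg ψ.nonneg (by positivity))
            (hGs.trans (Metric.closedBall_subset_closedBall (by linarith))).eventuallyLE
    have h2 : ∫ y in S, ψ y * ‖U y‖ ^ 2 ≤
        ‖∫ y in S, (ψ y : ℂ) * (U y * (starRingEnd ℂ) (U y))‖ := by
      simp_rw [hUn, ← Complex.ofReal_mul]
      rw [integral_complex_ofReal, Complex.norm_real]
      exact le_abs_self _
    refine h1.trans (h2.trans (hsq.trans (mul_le_mul_of_nonneg_right ?_ measureReal_nonneg)))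
    have : 0 ≤ (l ^ (k + d))⁻¹ := by positivity
    nlinarith
  have hU1 : IntegrableOn (fun y => ‖U y‖) G := by
    refine Integrable.of_bound hUm.norm.aestronglyMeasurable (B * volume.real G)
      (Filter.Eventually.of_forall fun y => ?_)
    rw [norm_norm]
    exact hUB y
  refine (norm_integral_le_integral_norm _).trans ?_
  rw [← Real.sqrt_mul (by positivity)]
  exact setIntegral_norm_le_of_sq hU1 (hU2 G hGfin) hGfin (by positivity) hmain

end DyadicBound

section Gaussian

variable {n : ℕ}

/-- The Gaussian `e^{-π b |t|²}`. -/
def gauss (b : ℝ) (t : Vec n) : ℝ := Real.exp (-(Real.pi * b) * ∑ i, t i ^ 2)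

/-- The Fourier transform `b^{-n/2} e^{-π |u|² / b}` of `gauss b`. -/
def gam (b : ℝ) (u : Vec n) : ℝ := b⁻¹ ^ ((n : ℝ) / 2) * gauss b⁻¹ u

@[fun_prop]
lemma continuous_gauss (b : ℝ) : Continuous (gauss b : Vec n → ℝ) := by
  unfold gauss
  fun_prop

@[fun_prop]
lemma continuous_gam (b : ℝ) : Continuous (gam b : Vec n → ℝ) := by
  unfold gam
  fun_prop

lemma gauss_pos (b : ℝ) (t : Vec n) : 0 < gauss b t := Real.exp_pos _

lemma gauss_le_one {b : ℝ} (hb : 0 ≤ b) (t : Vec n) : gauss b t ≤ 1 := by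
  refine Real.exp_le_one_iff.2 ?_
  rw [neg_mul, neg_nonpos]
  have := Real.pi_pos
  positivity

lemma gam_nonneg {b : ℝ} (hb : 0 ≤ b) (u : Vec n) : 0 ≤ gam b u :=
  mul_nonneg (by positivity) (gauss_pos _ _).le

lemma gam_le {b : ℝ} (hb : 0 ≤ b) (u : Vec n) : gam b u ≤ b⁻¹ ^ ((n : ℝ) / 2) :=
  mul_le_of_le_one_right (by positivity) (gauss_le_one (by positivity) _)

lemma integrable_gauss {b : ℝ} (hb : 0 < b) : Integrable (gauss b : Vec n → ℝ) := by
  have h := (GaussianFourier.integrable_cexp_neg_mul_sum_add (ι := Fin n)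
    (b := ((Real.pi * b : ℝ) : ℂ)) (by simpa using mul_pos Real.pi_pos hb) 0).re
  refine h.congr (Filter.Eventually.of_forall fun t => ?_)
  rw [gauss]
  simp only [Pi.zero_apply, zero_mul, Finset.sum_const_zero, add_zero]
  rw [show (-((Real.pi * b : ℝ) : ℂ) * ∑ i, (t i : ℂ) ^ 2) =
    ((-(Real.pi * b) * ∑ i, t i ^ 2 : ℝ) : ℂ) by push_cast; ring]
  exact Complex.exp_ofReal_re _

lemma integrable_gam {b : ℝ} (hb : 0 < b) : Integrable (gam b : Vec n → ℝ) :=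
  (integrable_gauss (inv_pos.2 hb)).const_mul _

lemma integral_gauss_mul_osc {b : ℝ} (hb : 0 < b) (u : Vec n) :
    ∫ t : Vec n, (gauss b t : ℂ) * osc (∑ i, t i * u i) = gam b u := by
  have h := GaussianFourier.integral_cexp_neg_mul_sum_add (ι := Fin n)
    (b := ((Real.pi * b : ℝ) : ℂ)) (by simpa using mul_pos Real.pi_pos hb)
    (fun i => 2 * Real.pi * Complex.I * u i)
  have e : ∀ t : Vec n, (gauss b t : ℂ) * osc (∑ i, t i * u i) =
      Complex.exp (-((Real.pi * b : ℝ) : ℂ) * ∑ i, (t i : ℂ) ^ 2 +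
        ∑ i, 2 * Real.pi * Complex.I * u i * t i) := by
    intro t
    rw [gauss, osc, Complex.ofReal_exp, ← Complex.exp_add]
    congr 1
    push_cast
    rw [Finset.mul_sum (s := Finset.univ) (f := fun i => (t i : ℂ) * u i)]
    congr 1
    exact Finset.sum_congr rfl fun i _ => by ring
  simp_rw [e]
  rw [h, gam, gauss]
  have hb' : (b : ℂ) ≠ 0 := by exact_mod_cast hb.ne'
  have hpi : (Real.pi : ℂ) ≠ 0 := by exact_mod_cast Real.pi_ne_zero
  push_cast
  congr 1
  · rw [show (Real.pi : ℂ) / (Real.pi * b) = ((b⁻¹ : ℝ) : ℂ) by push_cast; field_simp,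
      Complex.ofReal_cpow (by positivity)]
    simp
  · congr 1
    simp only [mul_pow, ← Finset.mul_sum, Complex.I_sq]
    field_simp
    ring

lemma integral_gam_mul_osc {b : ℝ} (hb : 0 < b) (t : Vec n) :
    ∫ r : Vec n, (gam b r : ℂ) * osc (∑ i, r i * t i) = gauss b t := by
  simp only [gam, Complex.ofReal_mul, mul_assoc]
  rw [integral_const_mul, integral_gauss_mul_osc (inv_pos.2 hb), gam, ← Complex.ofReal_mul,
    ← mul_assoc, ← Real.mul_rpow (by positivity) (by positivity), inv_inv, inv_mul_cancel₀ hb.ne',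
    Real.one_rpow, one_mul]

lemma integral_gam {b : ℝ} (hb : 0 < b) : ∫ r : Vec n, gam b r = 1 := by
  have h := integral_gam_mul_osc hb (0 : Vec n)
  simp only [Pi.zero_apply, mul_zero, Finset.sum_const_zero, osc_zero, mul_one, gauss] at h
  have h2 := integral_ofReal (𝕜 := ℂ) (μ := (volume : Measure (Vec n))) (f := gam b)
  refine Complex.ofReal_injective (h2.symm.trans ?_)
  simpa using h

/-- A uniform bound for all translates in frequency survives multiplication by a Gaussian. -/
lemma norm_integral_gauss_mul_le {b : ℝ} (hb : 0 < b) {H : Vec n → ℂ} (hH : Integrable H) {M : ℝ}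
    (hM : ∀ r : Vec n, ‖∫ t, osc (∑ i, r i * t i) * H t‖ ≤ M) :
    ‖∫ t, (gauss b t : ℂ) * H t‖ ≤ M := by
  have hInt : Integrable (fun p : Vec n × Vec n =>
      (gam b p.1 : ℂ) * H p.2 * osc (∑ i, p.1 i * p.2 i)) (volume.prod volume) := by
    refine (((integrable_gam hb).ofReal (𝕜 := ℂ)).mul_prod hH).mul_bdd (c := 1) ?_ ?_
    · exact (Continuous.aestronglyMeasurable (by fun_prop))
    · exact Filter.Eventually.of_forall fun p => (norm_osc _).le
  have e : ∫ t, (gauss b t : ℂ) * H t =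
      ∫ r, (gam b r : ℂ) * ∫ t, osc (∑ i, r i * t i) * H t := by
    have e1 : ∀ t, (gauss b t : ℂ) * H t = ∫ r, (gam b r : ℂ) * H t * osc (∑ i, r i * t i) := by
      intro t
      rw [← integral_gam_mul_osc hb, ← integral_mul_const]
      congr 1
      funext r
      ring
    simp_rw [e1]
    rw [integral_integral_swap (f := fun t r => (gam b r : ℂ) * H t * osc (∑ i, r i * t i)) hInt.swap]
    congr 1
    funext r
    rw [← integral_const_mul]
    congr 1
    funext t
    ring
  rw [e]
  have hM0 : 0 ≤ M := (norm_nonneg _).trans (hM 0)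
  refine (norm_integral_le_of_norm_le ((integrable_gam hb).mul_const M)
    (Filter.Eventually.of_forall fun r => ?_)).trans ?_
  · rw [norm_mul, Complex.norm_real, Real.norm_of_nonneg (gam_nonneg hb.le _)]
    exact mul_le_mul_of_nonneg_left (hM r) (gam_nonneg hb.le _)
  · rw [integral_mul_const, integral_gam hb, one_mul]

end Gaussian

section Cutoff

variable {d k : ℕ}

/-- The Fourier transform of the pushforward of the measure on `G × G` under `r + Θ_b`. -/
def pairFourier (Φ : Vec d → Vec k) (b : Vec d) (G : Set (Vec d)) (r t : Vec k) : ℂ :=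
  ∫ y in G, ∫ x in G, osc (linPhase Φ r b 1 t x y)

lemma continuous_linPhase_prod {Φ : Vec d → Vec k} (hΦ : Continuous Φ) (r : Vec k) (b : Vec d)
    (l : ℝ) : Continuous fun p : Vec k × Vec d × Vec d => linPhase Φ r b l p.1 p.2.2 p.2.1 :=
  (continuous_linPhase hΦ r b l).comp (f := fun p : Vec k × Vec d × Vec d => (p.1, p.2.2, p.2.1))
    (by fun_prop)

lemma pairFourier_eq {Φ : Vec d → Vec k} (hΦ : Continuous Φ) (b : Vec d) {G : Set (Vec d)}
    (hG : volume G ≠ ⊤) (r t : Vec k) :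
    pairFourier Φ b G r t = ∫ p, osc (linPhase Φ r b 1 t p.2 p.1)
      ∂((volume.restrict G).prod (volume.restrict G)) := by
  have : IsFiniteMeasure (volume.restrict G) := ⟨by simpa using hG.lt_top⟩
  rw [pairFourier, integral_prod (f := fun p : Vec d × Vec d => osc (linPhase Φ r b 1 t p.2 p.1))]
  refine Integrable.of_bound (C := 1) ?_ (Filter.Eventually.of_forall fun p => (norm_osc _).le)
  have := (continuous_linPhase_prod hΦ r b 1).comp (f := fun p : Vec d × Vec d => (t, p))
    (by fun_prop)
  exact (continuous_osc.comp this).aestronglyMeasurable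

lemma stronglyMeasurable_pairFourier {Φ : Vec d → Vec k} (hΦ : Continuous Φ) (b : Vec d)
    {G : Set (Vec d)} (hG : volume G ≠ ⊤) (r : Vec k) :
    StronglyMeasurable (pairFourier Φ b G r) := by
  have : IsFiniteMeasure (volume.restrict G) := ⟨by simpa using hG.lt_top⟩
  rw [show pairFourier Φ b G r = _ from funext (pairFourier_eq hΦ b hG r)]
  exact StronglyMeasurable.integral_prod_right'
    (f := fun p : Vec k × Vec d × Vec d => osc (linPhase Φ r b 1 p.1 p.2.2 p.2.1))
    (continuous_osc.comp (continuous_linPhase_prod hΦ r b 1)).stronglyMeasurable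

lemma norm_pairFourier_le (Φ : Vec d → Vec k) (b : Vec d) {G : Set (Vec d)}
    (hG : volume G ≠ ⊤) (r t : Vec k) :
    ‖pairFourier Φ b G r t‖ ≤ volume.real G ^ 2 := by
  have h : ∀ y : Vec d, ‖∫ x in G, osc (linPhase Φ r b 1 t x y)‖ ≤ 1 * volume.real G := fun y =>
    norm_setIntegral_le_of_norm_le_const hG.lt_top fun x _ => (norm_osc _).le
  refine (norm_setIntegral_le_of_norm_le_const hG.lt_top fun y _ => h y).trans_eq ?_
  ring

lemma osc_mul_pairFourier (Φ : Vec d → Vec k) (b : Vec d) (G : Set (Vec d)) (r r' t : Vec k) :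
    osc (∑ i, r' i * t i) * pairFourier Φ b G r t = pairFourier Φ b G (r + r') t := by
  have h : ∀ x y, ∑ i, r' i * t i + linPhase Φ r b 1 t x y = linPhase Φ (r + r') b 1 t x y := by
    intro x y
    simp only [linPhase, one_mul, ← Finset.sum_add_distrib, Pi.add_apply]
    exact Finset.sum_congr rfl fun i _ => by ring
  simp only [pairFourier, ← integral_const_mul, ← osc_add, h]

lemma integral_mul_pairFourier {Φ : Vec d → Vec k} (hΦ : Continuous Φ) (b : Vec d)
    {G : Set (Vec d)} (hG : volume G ≠ ⊤) (r : Vec k) {A : Vec k → ℂ} (hA : Integrable A) :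
    ∫ t, A t * pairFourier Φ b G r t =
      ∫ p, (∫ t, A t * osc (linPhase Φ r b 1 t p.2 p.1))
        ∂((volume.restrict G).prod (volume.restrict G)) := by
  have : IsFiniteMeasure (volume.restrict G) := ⟨by simpa using hG.lt_top⟩
  simp_rw [pairFourier_eq hΦ b hG, ← integral_const_mul]
  have h1 : Integrable (fun q : Vec k × Vec d × Vec d => A q.1)
    (volume.prod ((volume.restrict G).prod (volume.restrict G))) := hA.comp_fst _
  have h2 : Continuous fun q : Vec k × Vec d × Vec d => osc (linPhase Φ r b 1 q.1 q.2.2 q.2.1) :=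
    continuous_osc.comp (continuous_linPhase_prod hΦ r b 1)
  exact integral_integral_swap (f := fun t (p : Vec d × Vec d) =>
    A t * osc (linPhase Φ r b 1 t p.2 p.1)) (h1.mul_bdd (c := 1) h2.aestronglyMeasurable
    (Filter.Eventually.of_forall fun p => (norm_osc _).le))

lemma integral_gauss_mul_pairFourier {Φ : Vec d → Vec k} (hΦ : Continuous Φ) (b : Vec d)
    {G : Set (Vec d)} (hG : volume G ≠ ⊤) (r : Vec k) {ε : ℝ} (hε : 0 < ε) :
    ∫ t, (gauss ε t : ℂ) * pairFourier Φ b G r t =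
      ((∫ p, gam ε (r + theta Φ b p.2 p.1)
        ∂((volume.restrict G).prod (volume.restrict G)) : ℝ) : ℂ) := by
  have hi : Integrable fun t : Vec k => (gauss ε t : ℂ) := (integrable_gauss hε).ofReal
  rw [integral_mul_pairFourier hΦ b hG r hi]
  refine Eq.trans ?_ (integral_ofReal (𝕜 := ℂ))
  congr 1
  funext p
  refine Eq.trans ?_ (integral_gauss_mul_osc hε _)
  simp only [linPhase, one_mul, Pi.add_apply]

lemma integral_scaled_mul_pairFourier {Φ : Vec d → Vec k} (hΦ : Continuous Φ) (b : Vec d)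
    {G : Set (Vec d)} (hG : volume G ≠ ⊤) (r : Vec k) {β : Vec k → ℝ} (hβ : Continuous β)
    (hβi : Integrable β) {l : ℝ} (hl : 0 < l) :
    ∫ t, (β (l⁻¹ • t) : ℂ) * pairFourier Φ b G r t =
      (l ^ k : ℝ) * ∫ y in G, ∫ x in G, dyadicKer Φ β r b l x y := by
  have : IsFiniteMeasure (volume.restrict G) := ⟨by simpa using hG.lt_top⟩
  have hi : Integrable fun t => (β (l⁻¹ • t) : ℂ) :=
    (hβi.comp_smul (inv_pos.2 hl).ne').ofReal
  rw [integral_mul_pairFourier hΦ b hG r hi]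
  have e : ∀ p : Vec d × Vec d, ∫ t, (β (l⁻¹ • t) : ℂ) * osc (linPhase Φ r b 1 t p.2 p.1) =
      (l ^ k : ℝ) * dyadicKer Φ β r b l p.2 p.1 := by
    intro p
    have h := Measure.integral_comp_inv_smul_of_nonneg (volume : Measure (Vec k))
      (fun s : Vec k => (β s : ℂ) * osc (linPhase Φ r b l s p.2 p.1)) hl.le
    rw [Module.finrank_fin_fun, Complex.real_smul] at h
    rw [dyadicKer, ← h]
    congr 1
    funext t
    congr 2
    simp only [linPhase, one_mul, Pi.smul_apply, smul_eq_mul, Finset.mul_sum]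
    refine Finset.sum_congr rfl fun j _ => ?_
    field_simp
  simp_rw [e, integral_const_mul]
  congr 1
  refine integral_prod (fun p : Vec d × Vec d => dyadicKer Φ β r b l p.2 p.1) ?_
  refine Integrable.of_bound (C := ∫ s, |β s|) ?_
    (Filter.Eventually.of_forall fun p => norm_dyadicKer_le ..)
  exact ((stronglyMeasurable_dyadicKer hΦ hβ r b l).comp_measurable
    measurable_swap).aestronglyMeasurable

lemma pow_mul_sqrt_inv_le (hdk : k < d) {l : ℝ} (hl : 0 < l) (n : ℕ) :
    (l * 2 ^ n) ^ k * Real.sqrt ((l * 2 ^ n) ^ (k + d))⁻¹ ≤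
      Real.sqrt (l ^ (d - k))⁻¹ * (Real.sqrt 2)⁻¹ ^ n := by
  obtain ⟨m, rfl⟩ : ∃ m, d = k + (m + 1) := ⟨d - k - 1, by omega⟩
  rw [show k + (m + 1) - k = m + 1 by omega]
  have h2 : (1 : ℝ) ≤ 2 ^ n := one_le_pow₀ (by norm_num)
  have e : (l * 2 ^ n) ^ k = Real.sqrt ((l * 2 ^ n) ^ (2 * k)) := by
    rw [mul_comm 2 k, pow_mul, Real.sqrt_sq (by positivity)]
  have e2 : (Real.sqrt 2)⁻¹ ^ n = Real.sqrt ((2 ^ n)⁻¹) := by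
    rw [← Real.sqrt_inv, ← inv_pow]
    refine (Real.sqrt_eq_iff_mul_self_eq (by positivity) (by positivity)).2 ?_ |>.symm
    rw [← mul_pow, Real.mul_self_sqrt (by positivity)]
  rw [e, e2, ← Real.sqrt_mul (by positivity), ← Real.sqrt_mul (by positivity)]
  refine Real.sqrt_le_sqrt ?_
  rw [← mul_inv, ← div_eq_mul_inv, div_le_iff₀ (by positivity), ← div_eq_inv_mul,
    le_div_iff₀ (by positivity)]
  rw [show k + (k + (m + 1)) = 2 * k + (m + 1) by ring, pow_add (l * 2 ^ n) (2 * k)]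
  refine mul_le_mul_of_nonneg_left (?_ : l ^ (m + 1) * 2 ^ n ≤ _) (by positivity)
  rw [mul_pow]
  gcongr
  exact le_self_pow₀ h2 (by omega)

end Cutoff

section LemmaC

variable {d k : ℕ}

/-- A smooth radial cutoff, equal to `1` on the unit ball and supported in the ball of radius 2. -/
def cutoff (k : ℕ) : ContDiffBump (0 : Vec k) := ⟨1, 2, one_pos, one_lt_two⟩

/-- The difference of two consecutive dilates of `cutoff`. -/
def annulus (k : ℕ) (t : Vec k) : ℝ := cutoff k ((2 : ℝ)⁻¹ • t) - cutoff k t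

lemma contDiff_annulus : ContDiff ℝ ∞ (annulus k) := by
  have h : ContDiff ℝ ∞ (cutoff k) := (cutoff k).contDiff
  exact (h.comp (contDiff_const_smul _)).sub h

lemma annulus_eq_zero {t : Vec k} (ht : t ∉ Metric.closedBall 0 4 \ Metric.ball (0 : Vec k) 1) :
    annulus k t = 0 := by
  simp only [Set.mem_sdiff, Metric.mem_closedBall, dist_zero_right, Metric.mem_ball, not_and,
    not_not] at ht
  rw [annulus, sub_eq_zero]
  by_cases h : ‖t‖ ≤ 4
  · have h1 := ht h
    rw [(cutoff k).one_of_mem_closedBall, (cutoff k).one_of_mem_closedBall]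
    · simpa [cutoff] using h1.le
    · rw [mem_closedBall_zero_iff, norm_smul]
      norm_num [cutoff]
      linarith
  · rw [(cutoff k).zero_of_le_dist, (cutoff k).zero_of_le_dist]
    · simp only [cutoff, dist_zero_right]
      linarith
    · rw [dist_zero_right, norm_smul]
      norm_num [cutoff]
      linarith

theorem exists_integral_gam_le {Φ : Vec d → Vec k} (hΦ : ContDiff ℝ ∞ Φ) {b₀ x₀ : Vec d}
    (hc : TransCond Φ b₀ x₀) (hdk : k < d) :
    ∃ δ > 0, ∃ C > 0, ∀ b ∈ Metric.closedBall b₀ δ, ∀ G ⊆ Metric.closedBall x₀ (δ / 2),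
      MeasurableSet G → ∀ (r : Vec k) (ε : ℝ), 0 < ε →
      ∫ p, gam ε (r + theta Φ b p.2 p.1) ∂((volume.restrict G).prod (volume.restrict G)) ≤
        C * volume.real G ^ (2 * d / (d + k) : ℝ) := by
  have hK : IsCompact (Metric.closedBall 0 4 \ Metric.ball (0 : Vec k) 1) :=
    (isCompact_closedBall _ _).diff Metric.isOpen_ball
  obtain ⟨δ, hδ, C, hC, H⟩ := exists_dyadic_bound hΦ hc hK (by simp) contDiff_annulus
    fun t ht => annulus_eq_zero ht
  set I₀ := ∫ t, ‖(cutoff k t : ℂ)‖ with hI₀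
  have hI₀0 : 0 ≤ I₀ := by positivity
  set q := (Real.sqrt 2)⁻¹ with hq
  have hq1 : q < 1 := inv_lt_one_of_one_lt₀ (by
    rw [Real.lt_sqrt (by norm_num)]
    norm_num)
  have hq0 : 0 < q := by positivity
  refine ⟨δ, hδ, I₀ + C * (1 - q)⁻¹, by have := sub_pos.2 hq1; positivity, ?_⟩
  intro b hb G hG hGm r ε hε
  have hGf : volume G ≠ ⊤ := (measure_mono hG).trans_lt measure_closedBall_lt_top |>.ne
  set m := volume.real G with hm
  have hΦc := hΦ.continuous
  rcases (measureReal_nonneg (μ := volume) (s := G)).eq_or_lt with h0 | hm0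
  · have : volume.restrict G = 0 := by
      rw [Measure.restrict_eq_zero]
      exact (measureReal_eq_zero_iff hGf).1 h0.symm
    rw [this, Measure.zero_prod, integral_zero_measure]
    have := sub_pos.2 hq1
    positivity
  rw [← hm] at hm0
  have hdk0 : (0 : ℝ) < d + k := by
    have : 0 < d := by omega
    positivity
  set Λ := m ^ (-2 / (d + k) : ℝ) with hΛ
  have hΛ0 : 0 < Λ := Real.rpow_pos_of_pos hm0 _
  have hF := norm_pairFourier_le Φ b hGf r
  have hFm := (stronglyMeasurable_pairFourier hΦc b hGf r).aestronglyMeasurable (μ := volume)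
  set F := pairFourier Φ b G r with hFd
  have hbd : ∀ {A : Vec k → ℂ}, Integrable A → Integrable fun t => A t * F t := fun hA =>
    hA.mul_bdd (c := m ^ 2) hFm (Filter.Eventually.of_forall hF)
  have hcut : ∀ {l : ℝ}, 0 < l → Integrable fun t => ((cutoff k (l⁻¹ • t) : ℝ) : ℂ) := fun hl =>
    ((cutoff k).integrable.comp_smul (inv_pos.2 hl).ne').ofReal
  have hcutc : Continuous (cutoff k) := (cutoff k).continuous
  set I : ℕ → ℂ := fun n =>
    ∫ t, (gauss ε t : ℂ) * (((cutoff k ((Λ * 2 ^ n)⁻¹ • t) : ℝ) : ℂ) * F t) with hI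
  have hgint : ∀ {A : Vec k → ℂ}, Integrable A → Integrable fun t => (gauss ε t : ℂ) * A t :=
    fun hA => hA.bdd_mul (c := 1) (Continuous.aestronglyMeasurable (by fun_prop))
      (Filter.Eventually.of_forall fun t => by
        rw [Complex.norm_real, Real.norm_of_nonneg (gauss_pos _ _).le]
        exact gauss_le_one hε.le t)
  have hl : ∀ n : ℕ, 0 < Λ * 2 ^ n := fun n => by positivity
  have h0 : ‖I 0‖ ≤ Λ ^ k * I₀ * m ^ 2 := by
    have e : ∫ t, ‖((cutoff k (Λ⁻¹ • t) : ℝ) : ℂ)‖ = Λ ^ k * I₀ := by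
      have h := Measure.integral_comp_inv_smul_of_nonneg (volume : Measure (Vec k))
        (fun s : Vec k => ‖((cutoff k s : ℝ) : ℂ)‖) hΛ0.le
      rw [hI₀]
      simpa using h
    rw [← e, ← integral_mul_const]
    refine norm_integral_le_of_norm_le ((hcut hΛ0).norm.mul_const _)
      (Filter.Eventually.of_forall fun t => ?_)
    rw [pow_zero, mul_one, norm_mul, norm_mul, Complex.norm_real (gauss ε t),
      Real.norm_of_nonneg (gauss_pos _ _).le, ← one_mul (‖_‖ * m ^ 2)]
    gcongr
    · exact gauss_le_one hε.le t
    · exact hF t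
  have hstep : ∀ n, ‖I (n + 1) - I n‖ ≤ C * m * Real.sqrt (Λ ^ (d - k))⁻¹ * q ^ n := by
    intro n
    have hai : Integrable fun t => ((annulus k ((Λ * 2 ^ n)⁻¹ • t) : ℝ) : ℂ) := by
      have h1 : Integrable (annulus k) :=
        contDiff_annulus.continuous.integrable_of_hasCompactSupport
          (HasCompactSupport.intro hK fun t ht => annulus_eq_zero ht)
      exact (h1.comp_smul (inv_pos.2 (hl n)).ne').ofReal
    have e : I (n + 1) - I n =
        ∫ t, (gauss ε t : ℂ) * (((annulus k ((Λ * 2 ^ n)⁻¹ • t) : ℝ) : ℂ) * F t) := by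
      rw [hI, ← integral_sub (hgint (hbd (hcut (hl _)))) (hgint (hbd (hcut (hl _))))]
      congr 1
      funext t
      rw [annulus, smul_smul, show (2 : ℝ)⁻¹ * (Λ * 2 ^ n)⁻¹ = (Λ * 2 ^ (n + 1))⁻¹ by
        rw [pow_succ, ← mul_inv]; ring_nf]
      push_cast
      ring
    rw [e]
    refine norm_integral_gauss_mul_le hε (hbd hai) fun r' => ?_
    have e2 : ∀ t, osc (∑ i, r' i * t i) * (((annulus k ((Λ * 2 ^ n)⁻¹ • t) : ℝ) : ℂ) * F t) =
        ((annulus k ((Λ * 2 ^ n)⁻¹ • t) : ℝ) : ℂ) * pairFourier Φ b G (r + r') t := by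
      intro t
      rw [← osc_mul_pairFourier]
      ring
    simp_rw [e2]
    rw [integral_scaled_mul_pairFourier hΦc b hGf _ contDiff_annulus.continuous
      (contDiff_annulus.continuous.integrable_of_hasCompactSupport
          (HasCompactSupport.intro hK fun t ht => annulus_eq_zero ht)) (hl n), norm_mul,
      Complex.norm_real, Real.norm_of_nonneg (by positivity)]
    calc _ ≤ (Λ * 2 ^ n) ^ k * (C * Real.sqrt ((Λ * 2 ^ n) ^ (k + d))⁻¹ * m) := by
          gcongr
          exact H b hb G hG hGm _ _ (hl n)
      _ = C * m * ((Λ * 2 ^ n) ^ k * Real.sqrt ((Λ * 2 ^ n) ^ (k + d))⁻¹) := by ring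
      _ ≤ C * m * (Real.sqrt (Λ ^ (d - k))⁻¹ * q ^ n) := by
          exact mul_le_mul_of_nonneg_left (pow_mul_sqrt_inv_le hdk hΛ0 n) (by positivity)
      _ = _ := by ring
  have hsum : ∀ n, ‖I n‖ ≤ ‖I 0‖ + C * m * Real.sqrt (Λ ^ (d - k))⁻¹ * (1 - q)⁻¹ := by
    intro n
    have h1 : ‖I n - I 0‖ ≤ ∑ i ∈ Finset.range n, ‖I (i + 1) - I i‖ := by
      rw [← Finset.sum_range_sub]
      exact norm_sum_le _ _
    have h2 : ∑ i ∈ Finset.range n, ‖I (i + 1) - I i‖ ≤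
        C * m * Real.sqrt (Λ ^ (d - k))⁻¹ * (1 - q)⁻¹ := by
      refine (Finset.sum_le_sum fun i _ => hstep i).trans ?_
      rw [← Finset.mul_sum]
      gcongr
      have := (summable_geometric_of_lt_one hq0.le hq1).sum_le_tsum (Finset.range n)
        fun i _ => by positivity
      rwa [tsum_geometric_of_lt_one hq0.le hq1] at this
    have h3 := norm_le_norm_add_norm_sub' (I n) (I 0)
    linarith
  have hlim : Filter.Tendsto I Filter.atTop (𝓝 (∫ t, (gauss ε t : ℂ) * F t)) := by
    have hgi : Integrable fun t : Vec k => (gauss ε t : ℂ) := (integrable_gauss hε).ofReal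
    refine tendsto_integral_of_dominated_convergence (fun t => ‖(gauss ε t : ℂ) * F t‖)
      (fun n => (hgint (hbd (hcut (hl n)))).aestronglyMeasurable) (hbd hgi).norm
      (fun n => Filter.Eventually.of_forall fun t => ?_) (Filter.Eventually.of_forall fun t => ?_)
    · rw [norm_mul, norm_mul, norm_mul]
      refine mul_le_mul_of_nonneg_left ?_ (norm_nonneg _)
      refine mul_le_of_le_one_left (norm_nonneg _) ?_
      rw [Complex.norm_real, Real.norm_of_nonneg (cutoff k).nonneg]
      exact (cutoff k).le_one
    · refine Filter.Tendsto.const_mul _ ?_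
      have ht : Filter.Tendsto (fun n : ℕ => (Λ * 2 ^ n)⁻¹ • t) Filter.atTop (𝓝 0) := by
        rw [← zero_smul ℝ t]
        refine Filter.Tendsto.smul_const (Filter.Tendsto.inv_tendsto_atTop ?_) t
        exact (tendsto_pow_atTop_atTop_of_one_lt _root_.one_lt_two).const_mul_atTop hΛ0
      have h1 : cutoff k (0 : Vec k) = 1 :=
        (cutoff k).one_of_mem_closedBall (by simp [cutoff])
      have h2 := (hcutc.tendsto 0).comp ht
      rw [h1] at h2
      have h3 := ((Complex.continuous_ofReal.tendsto 1).comp h2).mul_const (F t)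
      simpa using h3
  have hfin := le_of_tendsto hlim.norm (Filter.Eventually.of_forall hsum)
  rw [integral_gauss_mul_pairFourier hΦc b hGf r hε, Complex.norm_real] at hfin
  refine (Real.le_norm_self _).trans (hfin.trans ?_)
  have e1 : Λ ^ k * m ^ 2 = m ^ (2 * d / (d + k) : ℝ) := by
    rw [hΛ, ← Real.rpow_natCast, ← Real.rpow_natCast, ← Real.rpow_mul hm0.le, ← Real.rpow_add hm0]
    congr 1
    push_cast
    field_simp
    ring
  have e2 : m * Real.sqrt (Λ ^ (d - k))⁻¹ = m ^ (2 * d / (d + k) : ℝ) := by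
    rw [hΛ, Real.sqrt_eq_rpow, ← Real.rpow_natCast, ← Real.rpow_mul hm0.le, ← Real.rpow_neg hm0.le,
      ← Real.rpow_mul hm0.le]
    nth_rewrite 1 [← Real.rpow_one m]
    rw [← Real.rpow_add hm0, Nat.cast_sub hdk.le]
    congr 1
    field_simp
    ring
  calc _ ≤ Λ ^ k * I₀ * m ^ 2 + C * m * Real.sqrt (Λ ^ (d - k))⁻¹ * (1 - q)⁻¹ := by gcongr
    _ = I₀ * (Λ ^ k * m ^ 2) + C * (1 - q)⁻¹ * (m * Real.sqrt (Λ ^ (d - k))⁻¹) := by ring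
    _ = _ := by rw [e1, e2]; ring

end LemmaC

section Transversality

variable {d k : ℕ}

lemma fderiv_apply_eq_sum {φ : Vec d → ℝ} (x v : Vec d) :
    fderiv ℝ φ x v = ∑ i, v i * fderiv ℝ φ x (Pi.single i 1) := by
  conv_lhs => rw [← Finset.univ_sum_single v]
  rw [map_sum]
  refine Finset.sum_congr rfl fun i _ => ?_
  rw [show Pi.single i (v i) = v i • (Pi.single i 1 : Vec d) by
    rw [← Pi.single_smul', smul_eq_mul, mul_one], map_smul, smul_eq_mul]

lemma Dmat_mulVec (Φ : Vec d → Vec k) (b x v : Vec d) (j : Fin k) :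
    (Dmat d k Φ b x *ᵥ v) j =
      fderiv ℝ (fun u => Φ u j) x v - fderiv ℝ (fun u => Φ u j) b v := by
  rw [fderiv_apply_eq_sum x v, fderiv_apply_eq_sum b v, ← Finset.sum_sub_distrib]
  simp only [Matrix.mulVec, dotProduct, Dmat, gradPhi, Matrix.of_apply]
  exact Finset.sum_congr rfl fun i _ => by ring

lemma hessPhi_mulVec {φ : Vec d → ℝ} (hφ : ContDiff ℝ ∞ φ) (b v : Vec d) (i : Fin d) :
    (hessPhi d φ b *ᵥ v) i = fderiv ℝ (fun y => fderiv ℝ φ y v) b (Pi.single i 1) := by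
  have e : (fun y => fderiv ℝ φ y v) =
      fun y => ∑ j, v j * fderiv ℝ φ y (Pi.single j 1) := by
    funext y
    exact fderiv_apply_eq_sum y v
  have hd : ∀ j : Fin d, DifferentiableAt ℝ (fun y => fderiv ℝ φ y (Pi.single j 1)) b := fun j =>
    (contDiff_fderiv_apply hφ _).differentiable (by simp) b
  rw [e, fderiv_fun_sum fun j _ => (hd j).const_mul _]
  simp only [Matrix.mulVec, dotProduct, hessPhi, Matrix.of_apply, _root_.sum_apply]
  refine Finset.sum_congr rfl fun j _ => ?_
  rw [fderiv_const_mul (hd j), _root_.smul_apply, smul_eq_mul, mul_comm]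

lemma tHess_mulVec {Φ : Vec d → Vec k} (hΦ : ContDiff ℝ ∞ Φ) (t : Vec k) (b v : Vec d)
    (i : Fin d) : (tHess d k Φ t b *ᵥ v) i =
      ∑ j, t j * fderiv ℝ (fun y => fderiv ℝ (fun u => Φ u j) y v) b (Pi.single i 1) := by
  have hφ : ∀ j, ContDiff ℝ ∞ fun u => Φ u j := fun j => contDiff_pi.1 hΦ j
  rw [tHess, Matrix.sum_mulVec, Finset.sum_apply]
  refine Finset.sum_congr rfl fun j _ => ?_
  rw [Matrix.smul_mulVec, Pi.smul_apply, smul_eq_mul, hessPhi_mulVec (hφ j)]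

lemma eq_zero_of_det_Mmat_ne_zero {Φ : Vec d → Vec k} {t : Vec k} {b x ν v : Vec d} {ς : Vec k}
    (h : (Mmat d k Φ t b x ν).det ≠ 0) (h1 : Dmat d k Φ b x *ᵥ v = 0)
    (h2 : (Dmat d k Φ b x)ᵀ *ᵥ ς + tHess d k Φ t ν *ᵥ v = 0) : ς = 0 ∧ v = 0 := by
  have h3 := Matrix.eq_zero_of_mulVec_eq_zero h (v := Sum.elim ς v) (by
    rw [Mmat, Matrix.fromBlocks_mulVec]
    simp [h1, h2])
  exact ⟨funext fun i => congrFun h3 (Sum.inl i), funext fun i => congrFun h3 (Sum.inr i)⟩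

lemma transCond_of_unit {Φ : Vec d → Vec k} (hΦ : ContDiff ℝ ∞ Φ) {b x : Vec d}
    (h : ∀ t : Vec k, ∑ i, t i ^ 2 = 1 → ∀ (ς : Vec k) (v : Vec d), Dmat d k Φ b x *ᵥ v = 0 →
      (Dmat d k Φ b x)ᵀ *ᵥ ς + tHess d k Φ t b *ᵥ v = 0 → ς = 0 ∧ v = 0) : TransCond Φ b x := by
  intro τ hτ ς v h1 h2
  set c := Real.sqrt (∑ i, τ i ^ 2) with hc
  have hs : 0 < ∑ i, τ i ^ 2 := by
    obtain ⟨i, hi⟩ := Function.ne_iff.1 hτ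
    exact Finset.sum_pos' (fun i _ => sq_nonneg _) ⟨i, Finset.mem_univ _, by have : τ i ≠ 0 := hi; positivity⟩
  have hc0 : 0 < c := Real.sqrt_pos.2 hs
  have hc2 : c ^ 2 = ∑ i, τ i ^ 2 := Real.sq_sqrt hs.le
  have key := h (c⁻¹ • τ) (by
    simp only [Pi.smul_apply, smul_eq_mul, mul_pow, ← Finset.mul_sum, ← hc2]
    field_simp) (c⁻¹ • ς) v (by
      funext j
      rw [Dmat_mulVec, h1 j, sub_self, Pi.zero_apply]) (by
      funext i
      rw [Pi.add_apply, tHess_mulVec hΦ, Pi.zero_apply, ← mul_zero c⁻¹, ← h2 i, mul_add,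
        Finset.mul_sum, Finset.mul_sum]
      congr 1
      · simp only [Matrix.mulVec, dotProduct, Matrix.transpose_apply, Dmat, gradPhi,
          Matrix.of_apply, Pi.smul_apply, smul_eq_mul]
        exact Finset.sum_congr rfl fun j _ => by ring
      · simp only [Pi.smul_apply, smul_eq_mul]
        exact Finset.sum_congr rfl fun j _ => by ring)
  exact ⟨(smul_eq_zero.1 key.1).resolve_left (inv_pos.2 hc0).ne', key.2⟩

lemma Dmat_swap (Φ : Vec d → Vec k) (b x : Vec d) : Dmat d k Φ x b = -Dmat d k Φ b x := by
  ext j i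
  simp [Dmat]

lemma transCond_left {Φ : Vec d → Vec k} (hΦ : ContDiff ℝ ∞ Φ) {b x : Vec d}
    (h : ∀ t : Vec k, ∑ i, t i ^ 2 = 1 → (Mmat d k Φ t b x b).det ≠ 0) : TransCond Φ b x :=
  transCond_of_unit hΦ fun t ht _ _ => eq_zero_of_det_Mmat_ne_zero (h t ht)

lemma transCond_right {Φ : Vec d → Vec k} (hΦ : ContDiff ℝ ∞ Φ) {b x : Vec d}
    (h : ∀ t : Vec k, ∑ i, t i ^ 2 = 1 → (Mmat d k Φ t b x x).det ≠ 0) : TransCond Φ x b :=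
  transCond_of_unit hΦ fun t ht ς v h1 h2 => by
    rw [Dmat_swap] at h1 h2
    have := eq_zero_of_det_Mmat_ne_zero (ς := -ς) (v := v) (h t ht)
      (by simpa [Matrix.neg_mulVec] using h1)
      (by simpa [Matrix.neg_mulVec, Matrix.mulVec_neg] using h2)
    simpa using this

/-- For `d = k` the transversality condition makes `D(b, x)` injective. -/
lemma TransCond.injective {Φ : Vec d → Vec d} {b x : Vec d} (h : TransCond Φ b x) (hd : 0 < d)
    {v : Vec d} (hv : ∀ j, fderiv ℝ (fun u => Φ u j) x v = fderiv ℝ (fun u => Φ u j) b v) :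
    v = 0 := by
  by_contra hv0
  have h1 : (Dmat d d Φ b x).det = 0 := Matrix.exists_mulVec_eq_zero_iff.1 ⟨v, hv0, by
    funext j
    rw [Dmat_mulVec, hv j, sub_self, Pi.zero_apply]⟩
  obtain ⟨ς, hς, hς0⟩ := Matrix.exists_vecMul_eq_zero_iff.2 h1
  have : Nonempty (Fin d) := ⟨⟨0, hd⟩⟩
  refine hς (h (fun _ => 1) (fun h => one_ne_zero (congrFun h ⟨0, hd⟩)) ς 0 (by simp)
    fun i => ?_).1
  have h2 := congrFun hς0 i
  simp only [Matrix.vecMul, dotProduct, Dmat, gradPhi, Matrix.of_apply, Pi.zero_apply] at h2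
  rw [h2]
  simp

end Transversality

section Energy

lemma lintegral_weight_mul_sq_le {Ω P : Type*} [MeasurableSpace Ω] [MeasurableSpace P]
    {ν : Measure Ω} {μ : Measure P} [SFinite ν] [SFinite μ] {W : Ω → ℝ} (hW : Integrable W ν)
    (hW0 : ∀ w, 0 ≤ W w) {H : P → ℂ} (hH : Integrable H μ) {θ : Ω → P → ℝ}
    (hθ : Measurable fun p : Ω × P => θ p.1 p.2) {Γ : P → P → ℝ} (hΓ0 : ∀ p q, 0 ≤ Γ p q)
    (hΓm : Measurable fun p : P × P => Γ p.1 p.2)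
    (hΓ : ∀ p q, ∫ w, (W w : ℂ) * osc (θ w p - θ w q) ∂ν = Γ p q) :
    ∫⁻ w, ENNReal.ofReal (W w) * ‖∫ p, osc (θ w p) * H p ∂μ‖ₑ ^ 2 ∂ν ≤
      ∫⁻ p, ∫⁻ q, ‖H p‖ₑ * ‖H q‖ₑ * ENNReal.ofReal (Γ p q) ∂μ ∂μ := by
  set U : Ω → ℂ := fun w => ∫ p, osc (θ w p) * H p ∂μ with hU
  have hHm := hH.aestronglyMeasurable
  have hUm : AEStronglyMeasurable U ν := by
    refine AEStronglyMeasurable.integral_prod_right'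
      (f := fun p : Ω × P => osc (θ p.1 p.2) * H p.2) ?_
    exact (measurable_osc.comp hθ).aestronglyMeasurable.mul hHm.comp_snd
  have hUb : ∀ w, ‖U w‖ ≤ ∫ p, ‖H p‖ ∂μ := fun w => by
    refine (norm_integral_le_integral_norm _).trans_eq ?_
    simp [norm_osc]
  have hi : Integrable (fun w => W w * ‖U w‖ ^ 2) ν :=
    hW.mul_bdd (c := (∫ p, ‖H p‖ ∂μ) ^ 2) (hUm.norm.pow 2) (Filter.Eventually.of_forall fun w => by
      rw [norm_pow, norm_norm]
      exact pow_le_pow_left₀ (norm_nonneg _) (hUb w) 2)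
  have hsq : ∀ w, ((W w * ‖U w‖ ^ 2 : ℝ) : ℂ) =
      ∫ z, (W w : ℂ) * osc (θ w z.1 - θ w z.2) * (H z.1 * (starRingEnd ℂ) (H z.2)) ∂(μ.prod μ) := by
    intro w
    have e : (‖U w‖ ^ 2 : ℂ) = U w * (starRingEnd ℂ) (U w) := by
      rw [Complex.mul_conj, Complex.normSq_eq_norm_sq]
      norm_cast
    rw [Complex.ofReal_mul, Complex.ofReal_pow, e, hU, ← integral_conj, ← integral_prod_mul,
      ← integral_const_mul]
    congr 1
    funext z
    rw [map_mul, conj_osc, sub_eq_add_neg, osc_add]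
    ring
  have hHH : Integrable (fun z : P × P => H z.1 * (starRingEnd ℂ) (H z.2)) (μ.prod μ) :=
    hH.mul_prod ((Complex.conjLIE.toContinuousLinearEquiv : ℂ →L[ℝ] ℂ).integrable_comp hH)
  have hF : Integrable (fun q : Ω × P × P => (W q.1 : ℂ) * osc (θ q.1 q.2.1 - θ q.1 q.2.2) *
      (H q.2.1 * (starRingEnd ℂ) (H q.2.2))) (ν.prod (μ.prod μ)) := by
    have h1 := (hW.ofReal (𝕜 := ℂ)).mul_prod hHH
    have h2 : Measurable fun q : Ω × P × P => osc (θ q.1 q.2.1 - θ q.1 q.2.2) := by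
      refine measurable_osc.comp (Measurable.sub ?_ ?_)
      · exact hθ.comp (f := fun q : Ω × P × P => (q.1, q.2.1)) (by fun_prop)
      · exact hθ.comp (f := fun q : Ω × P × P => (q.1, q.2.2)) (by fun_prop)
    refine (h1.mul_bdd (c := 1) h2.aestronglyMeasurable
      (Filter.Eventually.of_forall fun q => (norm_osc _).le)).congr
      (Filter.Eventually.of_forall fun q => ?_)
    simp only [Complex.coe_algebraMap]
    ring
  have hmain : ((∫ w, W w * ‖U w‖ ^ 2 ∂ν : ℝ) : ℂ) =
      ∫ z, (Γ z.1 z.2 : ℂ) * (H z.1 * (starRingEnd ℂ) (H z.2)) ∂(μ.prod μ) := by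
    refine (integral_ofReal (𝕜 := ℂ)).symm.trans ?_
    refine (integral_congr_ae (Filter.Eventually.of_forall hsq)).trans ?_
    refine (integral_integral_swap hF).trans ?_
    congr 1
    funext z
    rw [← hΓ, ← integral_mul_const]
  have h0 : 0 ≤ ∫ w, W w * ‖U w‖ ^ 2 ∂ν :=
    integral_nonneg fun w => mul_nonneg (hW0 w) (by positivity)
  calc ∫⁻ w, ENNReal.ofReal (W w) * ‖U w‖ₑ ^ 2 ∂ν
      = ∫⁻ w, ENNReal.ofReal (W w * ‖U w‖ ^ 2) ∂ν := by
        congr 1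
        funext w
        rw [ENNReal.ofReal_mul (hW0 w), ENNReal.ofReal_pow (norm_nonneg _), ofReal_norm]
    _ = ENNReal.ofReal (∫ w, W w * ‖U w‖ ^ 2 ∂ν) :=
        (ofReal_integral_eq_lintegral_ofReal hi (Filter.Eventually.of_forall fun w =>
          mul_nonneg (hW0 w) (by positivity))).symm
    _ = ‖((∫ w, W w * ‖U w‖ ^ 2 ∂ν : ℝ) : ℂ)‖ₑ := by
        rw [← ofReal_norm, Complex.norm_real, Real.norm_of_nonneg h0]
    _ ≤ ∫⁻ z, ‖(Γ z.1 z.2 : ℂ) * (H z.1 * (starRingEnd ℂ) (H z.2))‖ₑ ∂(μ.prod μ) := by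
        rw [hmain]
        exact enorm_integral_le_lintegral_enorm _
    _ = ∫⁻ z, ‖H z.1‖ₑ * ‖H z.2‖ₑ * ENNReal.ofReal (Γ z.1 z.2) ∂(μ.prod μ) := by
        congr 1
        funext z
        rw [enorm_mul, enorm_mul, RCLike.enorm_conj, ← ofReal_norm (Γ z.1 z.2 : ℂ),
          Complex.norm_real, Real.norm_of_nonneg (hΓ0 _ _), mul_comm]
    _ = _ := by
        refine lintegral_prod _ ?_
        have h1 : AEMeasurable (fun z : P × P => ‖H z.1‖ₑ) (μ.prod μ) := hHm.comp_fst.enorm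
        have h2 : AEMeasurable (fun z : P × P => ‖H z.2‖ₑ) (μ.prod μ) := hHm.comp_snd.enorm
        exact (h1.mul h2).mul hΓm.ennreal_ofReal.aemeasurable

variable {d k : ℕ}

/-- The extension operator over the whole space. -/
def fullExt (Φ : Vec d → Vec k) (f : Vec d → ℂ) (w : Vec d × Vec k) : ℂ :=
  ∫ ξ, osc (∑ i, w.1 i * ξ i + ∑ j, w.2 j * Φ ξ j) * f ξ

/-- The regularized energy `∫∫ |f(a) g(x) f(z) g(y)| γ_ε(a + x - z - y)
γ_ε(Φ(a) + Φ(x) - Φ(z) - Φ(y))`, with `p = (a, x)` and `q = (z, y)`. -/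
def energy (Φ : Vec d → Vec k) (f g : Vec d → ℝ≥0∞) (ε : ℝ) : ℝ≥0∞ :=
  ∫⁻ p : Vec d × Vec d, ∫⁻ q : Vec d × Vec d, (f p.1 * g p.2) * (f q.1 * g q.2) *
    ENNReal.ofReal (gam ε (p.1 + p.2 - (q.1 + q.2)) *
      gam ε (Φ p.1 + Φ p.2 - (Φ q.1 + Φ q.2)))

theorem lintegral_fullExt_mul_sq_le {Φ : Vec d → Vec k} (hΦ : Continuous Φ) {f g : Vec d → ℂ}
    (hf : Integrable f) (hg : Integrable g) {M : ℝ≥0∞}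
    (hM : ∀ ε : ℝ, 0 < ε → energy Φ (fun x => ‖f x‖ₑ) (fun x => ‖g x‖ₑ) ε ≤ M) :
    ∫⁻ w, ‖fullExt Φ f w * fullExt Φ g w‖ₑ ^ 2 ≤ M := by
  set θ : Vec d × Vec k → Vec d × Vec d → ℝ := fun w p =>
    ∑ i, w.1 i * (p.1 + p.2) i + ∑ j, w.2 j * (Φ p.1 + Φ p.2) j with hθ
  set H : Vec d × Vec d → ℂ := fun p => f p.1 * g p.2 with hH
  have hHi : Integrable H := hf.mul_prod hg
  have hθc : Continuous fun z : (Vec d × Vec k) × Vec d × Vec d => θ z.1 z.2 := by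
    simp only [hθ, Pi.add_apply]
    fun_prop
  have hprod : ∀ w, fullExt Φ f w * fullExt Φ g w = ∫ p, osc (θ w p) * H p := by
    intro w
    rw [fullExt, fullExt, ← integral_prod_mul, ← Measure.volume_eq_prod]
    congr 1
    funext p
    have : osc (θ w p) = osc (∑ i, w.1 i * p.1 i + ∑ j, w.2 j * Φ p.1 j) *
        osc (∑ i, w.1 i * p.2 i + ∑ j, w.2 j * Φ p.2 j) := by
      rw [← osc_add]
      simp only [hθ, Pi.add_apply, mul_add, Finset.sum_add_distrib]
      ring_nf
    rw [this]
    ring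
  have hε : ∀ ε : ℝ, 0 < ε → ∫⁻ w : Vec d × Vec k, ENNReal.ofReal (gauss ε w.1 * gauss ε w.2) *
      ‖fullExt Φ f w * fullExt Φ g w‖ₑ ^ 2 ≤ M := by
    intro ε hε
    refine le_trans ?_ (hM ε hε)
    simp only [hprod]
    refine (lintegral_weight_mul_sq_le (Γ := fun p q => gam ε (p.1 + p.2 - (q.1 + q.2)) *
      gam ε (Φ p.1 + Φ p.2 - (Φ q.1 + Φ q.2)))
      ((integrable_gauss hε).mul_prod (integrable_gauss hε))
      (fun w => mul_nonneg (gauss_pos _ _).le (gauss_pos _ _).le) hHi hθc.measurable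
      (fun p q => mul_nonneg (gam_nonneg hε.le _) (gam_nonneg hε.le _)) ?_ ?_).trans_eq ?_
    · exact Continuous.measurable (by fun_prop)
    · intro p q
      rw [Complex.ofReal_mul, ← integral_gauss_mul_osc hε, ← integral_gauss_mul_osc hε,
        ← integral_prod_mul, ← Measure.volume_eq_prod]
      congr 1
      funext w
      have : osc (θ w p - θ w q) = osc (∑ i, w.1 i * (p.1 + p.2 - (q.1 + q.2)) i) *
          osc (∑ j, w.2 j * (Φ p.1 + Φ p.2 - (Φ q.1 + Φ q.2)) j) := by
        rw [← osc_add]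
        simp only [hθ, Pi.add_apply, Pi.sub_apply, mul_add, mul_sub, Finset.sum_add_distrib,
          Finset.sum_sub_distrib]
        ring_nf
      rw [this]
      push_cast
      ring
    · simp only [energy, hH, enorm_mul]
  have hUm : AEStronglyMeasurable (fun w => fullExt Φ f w * fullExt Φ g w) := by
    simp only [hprod]
    refine AEStronglyMeasurable.integral_prod_right'
      (f := fun z : (Vec d × Vec k) × Vec d × Vec d => osc (θ z.1 z.2) * H z.2) ?_
    exact (continuous_osc.comp hθc).aestronglyMeasurable.mul hHi.aestronglyMeasurable.comp_snd
  set e : ℕ → ℝ := fun n => 1 / ((n : ℝ) + 1) with he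
  have he0 : ∀ n, 0 < e n := fun n => Nat.one_div_pos_of_nat
  have hlim : ∀ w : Vec d × Vec k, Filter.Tendsto (fun n => ENNReal.ofReal
      (gauss (e n) w.1 * gauss (e n) w.2) * ‖fullExt Φ f w * fullExt Φ g w‖ₑ ^ 2) Filter.atTop
      (𝓝 (‖fullExt Φ f w * fullExt Φ g w‖ₑ ^ 2)) := by
    intro w
    have h1 : Continuous fun s : ℝ => gauss s w.1 * gauss s w.2 := by
      unfold gauss
      fun_prop
    have h2 := ENNReal.tendsto_ofReal ((h1.tendsto 0).comp tendsto_one_div_add_atTop_nhds_zero_nat)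
    have h3 : gauss 0 w.1 * gauss 0 w.2 = 1 := by simp [gauss]
    rw [h3, ENNReal.ofReal_one] at h2
    have h4 := ENNReal.Tendsto.mul_const (b := ‖fullExt Φ f w * fullExt Φ g w‖ₑ ^ 2) h2
      (Or.inl one_ne_zero)
    rwa [one_mul] at h4
  calc ∫⁻ w, ‖fullExt Φ f w * fullExt Φ g w‖ₑ ^ 2
      = ∫⁻ w, Filter.liminf (fun n => ENNReal.ofReal (gauss (e n) w.1 * gauss (e n) w.2) *
        ‖fullExt Φ f w * fullExt Φ g w‖ₑ ^ 2) Filter.atTop := by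
        congr 1
        funext w
        exact (hlim w).liminf_eq.symm
    _ ≤ Filter.liminf (fun n => ∫⁻ w : Vec d × Vec k, ENNReal.ofReal
        (gauss (e n) w.1 * gauss (e n) w.2) *
        ‖fullExt Φ f w * fullExt Φ g w‖ₑ ^ 2) Filter.atTop := by
        refine lintegral_liminf_le' fun n => ?_
        refine AEMeasurable.mul (Continuous.measurable ?_).aemeasurable (hUm.enorm.pow_const 2)
        exact ENNReal.continuous_ofReal.comp (by fun_prop)
    _ ≤ M := Filter.liminf_le_of_le (by isBoundedDefault) fun b hb => by
        obtain ⟨n, hn⟩ := hb.exists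
        exact hn.trans (hε _ (he0 n))

end Energy

section Restricted

lemma lintegral_lintegral_lintegral_reverse {X : Type*} [MeasurableSpace X] {μ : Measure X}
    [SFinite μ] {J : X → X → X → ℝ≥0∞}
    (hJ : Measurable fun q : (X × X) × X => J q.1.1 q.1.2 q.2) :
    ∫⁻ x, ∫⁻ y, ∫⁻ z, J x y z ∂μ ∂μ ∂μ = ∫⁻ z, ∫⁻ y, ∫⁻ x, J x y z ∂μ ∂μ ∂μ := by
  have h1 : Measurable fun p : X × X => ∫⁻ z, J p.1 p.2 z ∂μ := hJ.lintegral_prod_right'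
  rw [lintegral_lintegral_swap (f := fun x y => ∫⁻ z, J x y z ∂μ) h1.aemeasurable]
  have h2 : ∀ y, ∫⁻ x, ∫⁻ z, J x y z ∂μ ∂μ = ∫⁻ z, ∫⁻ x, J x y z ∂μ ∂μ := fun y =>
    lintegral_lintegral_swap (f := fun x z => J x y z)
      (hJ.comp (f := fun p : X × X => ((p.1, y), p.2)) (by fun_prop)).aemeasurable
  simp_rw [h2]
  have h3 : Measurable fun q : (X × X) × X => J q.2 q.1.1 q.1.2 :=
    hJ.comp (f := fun q : (X × X) × X => ((q.2, q.1.1), q.1.2)) (by fun_prop)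
  exact lintegral_lintegral_swap (f := fun y z => ∫⁻ x, J x y z ∂μ)
    h3.lintegral_prod_right'.aemeasurable

variable {d k : ℕ}

lemma lintegral_gam {n : ℕ} {ε : ℝ} (hε : 0 < ε) :
    ∫⁻ u : Vec n, ENNReal.ofReal (gam ε u) = 1 := by
  rw [← ofReal_integral_eq_lintegral_ofReal (integrable_gam hε)
    (Filter.Eventually.of_forall fun u => gam_nonneg hε.le u), integral_gam hε, ENNReal.ofReal_one]

lemma lintegral_gam_theta_le {Φ : Vec d → Vec k} (hΦ : Continuous Φ) {b : Vec d} {G : Set (Vec d)}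
    (hG : volume G ≠ ⊤) {r : Vec k} {ε : ℝ} (hε : 0 < ε) {B : ℝ}
    (h : ∫ p, gam ε (r + theta Φ b p.2 p.1)
      ∂((volume.restrict G).prod (volume.restrict G)) ≤ B) :
    ∫⁻ y in G, ∫⁻ x in G, ENNReal.ofReal (gam ε (r + theta Φ b x y)) ≤ ENNReal.ofReal B := by
  have : IsFiniteMeasure (volume.restrict G) := ⟨by simpa using hG.lt_top⟩
  have hc : Continuous fun p : Vec d × Vec d => gam ε (r + theta Φ b p.2 p.1) := by
    have h1 := (continuous_theta hΦ b).comp continuous_swap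
    exact (continuous_gam ε).comp (continuous_const.add h1)
  have hi : Integrable (fun p : Vec d × Vec d => gam ε (r + theta Φ b p.2 p.1))
      ((volume.restrict G).prod (volume.restrict G)) :=
    Integrable.of_bound hc.aestronglyMeasurable (ε⁻¹ ^ ((k : ℝ) / 2))
      (Filter.Eventually.of_forall fun p => by
        rw [Real.norm_of_nonneg (gam_nonneg hε.le _)]
        exact gam_le hε.le _)
  rw [← lintegral_prod (fun p : Vec d × Vec d => ENNReal.ofReal (gam ε (r + theta Φ b p.2 p.1)))
    hc.measurable.ennreal_ofReal.aemeasurable, ← ofReal_integral_eq_lintegral_ofReal hi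
    (Filter.Eventually.of_forall fun p => gam_nonneg hε.le _)]
  exact ENNReal.ofReal_le_ofReal h

/-- The energy after the change of variables `z = a - η + x - y`. -/
lemma energy_eq {Φ : Vec d → Vec k} (hΦ : Continuous Φ) {f g : Vec d → ℝ≥0∞} (hf : Measurable f)
    (hg : Measurable g) (ε : ℝ) :
    energy Φ f g ε = ∫⁻ a, ∫⁻ η, ∫⁻ y, ∫⁻ x, (f a * g x) * (f (a - η + x - y) * g y) *
      ENNReal.ofReal (gam ε η * gam ε (Φ a + theta Φ (a - η) x y)) := by
  have hm : Measurable fun z : (Vec d × Vec d) × Vec d × Vec d =>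
      (f z.1.1 * g z.1.2) * (f z.2.1 * g z.2.2) *
      ENNReal.ofReal (gam ε (z.1.1 + z.1.2 - (z.2.1 + z.2.2)) *
      gam ε (Φ z.1.1 + Φ z.1.2 - (Φ z.2.1 + Φ z.2.2))) := by
    refine Measurable.mul (by fun_prop) (Measurable.ennreal_ofReal (Continuous.measurable ?_))
    fun_prop
  rw [energy, Measure.volume_eq_prod, lintegral_prod _ hm.lintegral_prod_right'.aemeasurable]
  congr 1
  funext a
  have h1 : ∀ x, ∫⁻ q : Vec d × Vec d, (f a * g x) * (f q.1 * g q.2) *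
      ENNReal.ofReal (gam ε (a + x - (q.1 + q.2)) * gam ε (Φ a + Φ x - (Φ q.1 + Φ q.2)))
      ∂(volume.prod volume) = ∫⁻ y, ∫⁻ η, (f a * g x) * (f (a - η + x - y) * g y) *
      ENNReal.ofReal (gam ε η * gam ε (Φ a + theta Φ (a - η) x y)) := by
    intro x
    refine (lintegral_prod_symm _ (hm.comp (f := fun q : Vec d × Vec d => ((a, x), q))
      (by fun_prop)).aemeasurable).trans ?_
    congr 1
    funext y
    rw [← lintegral_sub_left_eq_self _ (a + x - y)]
    congr 1
    funext η
    simp only [Function.comp_apply]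
    rw [theta, show a + x - y - η = a - η + x - y by abel,
      show a + x - (a - η + x - y + y) = η by abel,
      show Φ a + Φ x - (Φ (a - η + x - y) + Φ y) = Φ a + (Φ x - Φ y - Φ (a - η + x - y)) by abel]
  simp only [h1]
  refine lintegral_lintegral_lintegral_reverse (J := fun x y η =>
    (f a * g x) * (f (a - η + x - y) * g y) *
      ENNReal.ofReal (gam ε η * gam ε (Φ a + theta Φ (a - η) x y))) ?_
  refine Measurable.mul (by fun_prop) (Measurable.ennreal_ofReal (Continuous.measurable ?_))
  unfold theta
  fun_prop

theorem exists_lintegral_fullExt_mul_sq_le {Φ : Vec d → Vec k} (hΦ : ContDiff ℝ ∞ Φ)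
    {b₀ x₀ : Vec d} (hc : TransCond Φ b₀ x₀) (hdk : k < d) :
    ∃ δ > 0, ∃ C : ℝ, ∀ E ⊆ Metric.closedBall b₀ δ, ∀ G ⊆ Metric.closedBall x₀ δ,
      MeasurableSet E → MeasurableSet G → ∀ f g : Vec d → ℂ, Integrable f → Integrable g →
      ∀ α γ : ℝ≥0∞, α ≠ ⊤ → γ ≠ ⊤ → (∀ x, ‖f x‖ₑ ≤ E.indicator (fun _ => α) x) →
      (∀ x, ‖g x‖ₑ ≤ G.indicator (fun _ => γ) x) →
      ∫⁻ w, ‖fullExt Φ f w * fullExt Φ g w‖ₑ ^ 2 ≤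
        ENNReal.ofReal C * (α ^ 2 * γ ^ 2) * (volume E * volume G ^ (2 * d / (d + k) : ℝ)) := by
  obtain ⟨δ, hδ, C, hC, H⟩ := exists_integral_gam_le hΦ hc hdk
  refine ⟨δ / 3, by positivity, C, ?_⟩
  intro E hE G hG hEm hGm f g hf hg α γ hα hγ hfα hgγ
  have hΦc := hΦ.continuous
  have hGf : volume G ≠ ⊤ := (measure_mono hG).trans_lt measure_closedBall_lt_top |>.ne
  refine lintegral_fullExt_mul_sq_le hΦc hf hg fun ε hε => ?_
  set ρ : ℝ := 2 * d / (d + k) with hρ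
  have hρ0 : 0 ≤ ρ := by positivity
  have hmono : energy Φ (fun x => ‖f x‖ₑ) (fun x => ‖g x‖ₑ) ε ≤
      energy Φ (E.indicator fun _ => α) (G.indicator fun _ => γ) ε := by
    refine lintegral_mono fun p => lintegral_mono fun q => ?_
    gcongr <;> first | exact hfα _ | exact hgγ _
  refine hmono.trans ?_
  rw [energy_eq hΦc (measurable_const.indicator hEm) (measurable_const.indicator hGm)]
  have hEi : ∀ z, E.indicator (1 : Vec d → ℝ≥0∞) z ≠ ⊤ := fun z => by
    by_cases h : z ∈ E <;> simp [h]
  have hGi : ∀ z, G.indicator (1 : Vec d → ℝ≥0∞) z ≠ ⊤ := fun z => by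
    by_cases h : z ∈ G <;> simp [h]
  have hαγ : α ^ 2 * γ ^ 2 ≠ ⊤ := by finiteness
  have hin : ∀ a η, ∫⁻ y, ∫⁻ x, (E.indicator (fun _ => α) a * G.indicator (fun _ => γ) x) *
      (E.indicator (fun _ => α) (a - η + x - y) * G.indicator (fun _ => γ) y) *
      ENNReal.ofReal (gam ε η * gam ε (Φ a + theta Φ (a - η) x y)) ≤
      E.indicator 1 a * (α ^ 2 * γ ^ 2 * (ENNReal.ofReal (gam ε η) *
        (ENNReal.ofReal C * volume G ^ ρ))) := by
    intro a η
    set b := a - η with hb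
    have hpt : ∀ x y, (E.indicator (fun _ => α) a * G.indicator (fun _ => γ) x) *
        (E.indicator (fun _ => α) (b + x - y) * G.indicator (fun _ => γ) y) *
        ENNReal.ofReal (gam ε η * gam ε (Φ a + theta Φ b x y)) =
        E.indicator 1 a * (α ^ 2 * γ ^ 2 * (ENNReal.ofReal (gam ε η) * (G.indicator 1 y *
          (G.indicator 1 x * (E.indicator 1 (b + x - y) *
            ENNReal.ofReal (gam ε (Φ a + theta Φ b x y))))))) := by
      intro x y
      rw [ENNReal.ofReal_mul (gam_nonneg hε.le _)]
      by_cases h1 : a ∈ E <;> by_cases h2 : x ∈ G <;> by_cases h3 : b + x - y ∈ E <;>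
        by_cases h4 : y ∈ G <;> simp [h1, h2, h3, h4]
      ring
    have hset : ∀ h : Vec d → ℝ≥0∞, ∫⁻ y, G.indicator 1 y * h y = ∫⁻ y in G, h y := fun h => by
      rw [← lintegral_indicator hGm]
      congr 1
      funext y
      by_cases hy : y ∈ G <;> simp [hy]
    simp_rw [hpt, lintegral_const_mul' _ _ (hEi _), lintegral_const_mul' _ _ hαγ,
      lintegral_const_mul' _ _ ENNReal.ofReal_ne_top, lintegral_const_mul' _ _ (hGi _), hset]
    gcongr
    by_cases hne : ∃ y ∈ G, ∃ x ∈ G, b + x - y ∈ E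
    · obtain ⟨y, hy, x, hx, hz⟩ := hne
      have hbδ : b ∈ Metric.closedBall b₀ δ := by
        have h1 := hE hz
        have h2 := hG hx
        have h3 := hG hy
        rw [mem_closedBall_iff_norm] at h1 h2 h3 ⊢
        calc ‖b - b₀‖ = ‖(b + x - y - b₀) - (x - x₀) + (y - x₀)‖ := by congr 1; abel
          _ ≤ ‖b + x - y - b₀‖ + ‖x - x₀‖ + ‖y - x₀‖ :=
            (norm_add_le _ _).trans (by gcongr; exact norm_sub_le _ _)
          _ ≤ δ := by linarith
      have h1 := lintegral_gam_theta_le hΦc hGf hε (H b hbδ G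
        (hG.trans (Metric.closedBall_subset_closedBall (by linarith))) hGm (Φ a) ε hε)
      rw [ENNReal.ofReal_mul hC.le, ← ENNReal.ofReal_rpow_of_nonneg measureReal_nonneg hρ0,
        ofReal_measureReal hGf] at h1
      refine le_trans (lintegral_mono fun y => lintegral_mono fun x => ?_) h1
      refine mul_le_of_le_one_left' ?_
      by_cases h : b + x - y ∈ E <;> simp [h]
    · push Not at hne
      refine (setLIntegral_eq_zero hGm fun y hy => setLIntegral_eq_zero hGm fun x hx => ?_).trans_le
        zero_le
      simp [hne y hy x hx]
  calc _ ≤ ∫⁻ a, ∫⁻ η, E.indicator 1 a * (α ^ 2 * γ ^ 2 * (ENNReal.ofReal (gam ε η) *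
        (ENNReal.ofReal C * volume G ^ ρ))) :=
        lintegral_mono fun a => lintegral_mono fun η => hin a η
    _ = _ := by
        have hK : ENNReal.ofReal C * volume G ^ ρ ≠ ⊤ := by finiteness
        simp_rw [lintegral_const_mul' _ _ (hEi _), lintegral_const_mul' _ _ hαγ,
          lintegral_mul_const' _ _ hK, lintegral_gam hε, one_mul]
        rw [lintegral_mul_const' _ _
          (ENNReal.mul_ne_top hαγ hK), lintegral_indicator_one hEm]
        ring

end Restricted

section Square

variable {d : ℕ}

lemma gam_le_of_sum_sq_le {n : ℕ} {ε s A : ℝ} (hε : 0 < ε) (hs : 0 < s) {u v : Vec n}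
    (h : ∑ i, v i ^ 2 ≤ s * ∑ i, u i ^ 2 + s * A * ε) :
    gam ε u ≤ Real.exp (Real.pi * A) * s ^ ((n : ℝ) / 2) * gam (s * ε) v := by
  have e : s ^ ((n : ℝ) / 2) * (s * ε)⁻¹ ^ ((n : ℝ) / 2) = ε⁻¹ ^ ((n : ℝ) / 2) := by
    rw [← Real.mul_rpow (by positivity) (by positivity)]
    congr 1
    field_simp
  have h2 : gauss ε⁻¹ u ≤ Real.exp (Real.pi * A) * gauss (s * ε)⁻¹ v := by
    rw [gauss, gauss, ← Real.exp_add, Real.exp_le_exp]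
    have h3 : (Real.pi * (s * ε)⁻¹) * ∑ i, v i ^ 2 ≤
        (Real.pi * (s * ε)⁻¹) * (s * ∑ i, u i ^ 2 + s * A * ε) :=
      mul_le_mul_of_nonneg_left h (by have := Real.pi_pos; positivity)
    have h4 : (Real.pi * (s * ε)⁻¹) * (s * ∑ i, u i ^ 2 + s * A * ε) =
        Real.pi * ε⁻¹ * ∑ i, u i ^ 2 + Real.pi * A := by
      field_simp
    linarith
  calc gam ε u ≤ ε⁻¹ ^ ((n : ℝ) / 2) * (Real.exp (Real.pi * A) * gauss (s * ε)⁻¹ v) := by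
        rw [gam]
        gcongr
    _ = _ := by
        rw [gam, ← e]
        ring

lemma exists_sub_le_of_transCond {Φ : Vec d → Vec d} (hΦ : ContDiff ℝ ∞ Φ) {b₀ x₀ : Vec d}
    (hc : TransCond Φ b₀ x₀) (hd : 0 < d) :
    ∃ δ > 0, ∃ κ > 0, ∀ y ∈ Metric.closedBall x₀ δ, ∀ y' ∈ Metric.closedBall x₀ δ,
      ∀ z ∈ Metric.closedBall b₀ δ, ∀ z' ∈ Metric.closedBall b₀ δ, z' - z = y - y' →
      κ * ‖y - y'‖ ≤ ‖Φ y - Φ y' - (Φ z' - Φ z)‖ := by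
  set L := fderiv ℝ Φ x₀ - fderiv ℝ Φ b₀ with hL
  have hdiff : ∀ x, DifferentiableAt ℝ Φ x := fun x => hΦ.differentiable (by simp) x
  have hcomp : ∀ x v j, fderiv ℝ Φ x v j = fderiv ℝ (fun u => Φ u j) x v := fun x v j => by
    have := (hasFDerivAt_pi'.1 (hdiff x).hasFDerivAt j).fderiv
    rw [this]
    rfl
  have hinj : LinearMap.ker (L : Vec d →ₗ[ℝ] Vec d) = ⊥ := by
    refine LinearMap.ker_eq_bot'.2 fun v hv => hc.injective hd fun j => ?_
    have h1 := congrFun hv j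
    simp only [hL, ContinuousLinearMap.coe_coe, _root_.sub_apply, Pi.zero_apply, Pi.sub_apply,
      hcomp] at h1
    exact sub_eq_zero.1 h1
  obtain ⟨K, hK, hLK⟩ := LinearMap.exists_antilipschitzWith _ hinj
  have hLb : ∀ v, ‖v‖ ≤ K * ‖L v‖ := fun v => by
    simpa using hLK.le_mul_dist v 0
  set κ : ℝ := (4 * K)⁻¹ with hκ
  have hK0 : (0 : ℝ) < K := by exact_mod_cast hK
  have hκ0 : 0 < κ := by positivity
  have hs : ∀ x, ∃ s ∈ 𝓝 x, ∀ y ∈ s, ∀ y' ∈ s,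
      ‖Φ y - Φ y' - fderiv ℝ Φ x (y - y')‖ ≤ κ * ‖y - y'‖ := fun x => by
    obtain ⟨s, hs, h⟩ := (hΦ.contDiffAt.hasStrictFDerivAt (x := x)
      (by simp)).approximates_deriv_on_nhds (c := ⟨κ, hκ0.le⟩) (Or.inr hκ0)
    exact ⟨s, hs, fun y hy y' hy' => h y hy y' hy'⟩
  obtain ⟨s₁, hs₁, h₁⟩ := hs x₀
  obtain ⟨s₂, hs₂, h₂⟩ := hs b₀
  obtain ⟨δ₁, hδ₁, H₁⟩ := Metric.nhds_basis_closedBall.mem_iff.1 hs₁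
  obtain ⟨δ₂, hδ₂, H₂⟩ := Metric.nhds_basis_closedBall.mem_iff.1 hs₂
  refine ⟨min δ₁ δ₂, lt_min hδ₁ hδ₂, κ, hκ0, fun y hy y' hy' z hz z' hz' hzy => ?_⟩
  have m₁ := (Metric.closedBall_subset_closedBall (x := x₀) (min_le_left δ₁ δ₂)).trans H₁
  have m₂ := (Metric.closedBall_subset_closedBall (x := b₀) (min_le_right δ₁ δ₂)).trans H₂
  have e₁ := h₁ y (m₁ hy) y' (m₁ hy')
  have e₂ := h₂ z' (m₂ hz') z (m₂ hz)
  rw [hzy] at e₂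
  have e₃ := hLb (y - y')
  have e₄ : ‖L (y - y')‖ ≤ ‖Φ y - Φ y' - (Φ z' - Φ z)‖ +
      ‖Φ y - Φ y' - fderiv ℝ Φ x₀ (y - y')‖ + ‖Φ z' - Φ z - fderiv ℝ Φ b₀ (y - y')‖ := by
    calc ‖L (y - y')‖ = ‖Φ y - Φ y' - (Φ z' - Φ z) - (Φ y - Φ y' - fderiv ℝ Φ x₀ (y - y')) +
          (Φ z' - Φ z - fderiv ℝ Φ b₀ (y - y'))‖ := by
          congr 1
          rw [hL, _root_.sub_apply]
          abel
      _ ≤ _ := (norm_add_le _ _).trans (by gcongr; exact norm_sub_le _ _)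
  have e₅ : 4 * κ * ‖y - y'‖ ≤ ‖L (y - y')‖ := by
    rw [hκ, mul_inv, ← mul_assoc, mul_inv_cancel₀ (by norm_num), one_mul, inv_mul_le_iff₀ hK0]
    exact e₃
  have := mul_nonneg hκ0.le (norm_nonneg (y - y'))
  linarith

lemma sum_sq_le_card_mul_norm_sq (v : Vec d) : ∑ i, v i ^ 2 ≤ d * ‖v‖ ^ 2 := by
  calc ∑ i, v i ^ 2 ≤ ∑ _i : Fin d, ‖v‖ ^ 2 := Finset.sum_le_sum fun i _ => by
        rw [← sq_abs]
        exact pow_le_pow_left₀ (abs_nonneg _) (norm_le_pi_norm v i) 2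
    _ = _ := by simp

lemma norm_sq_le_sum_sq (v : Vec d) : ‖v‖ ^ 2 ≤ ∑ i, v i ^ 2 := by
  have h0 : 0 ≤ ∑ i, v i ^ 2 := Finset.sum_nonneg fun i _ => sq_nonneg _
  refine (Real.le_sqrt (norm_nonneg _) h0).1 ?_
  refine (pi_norm_le_iff_of_nonneg (Real.sqrt_nonneg _)).2 fun i => Real.abs_le_sqrt ?_
  exact Finset.single_le_sum (f := fun i => v i ^ 2) (fun j _ => sq_nonneg _) (Finset.mem_univ i)

lemma exists_lintegral_indicator_gam_le {Φ : Vec d → Vec d} (hΦ : ContDiff ℝ ∞ Φ) {b₀ x₀ : Vec d}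
    (hc : TransCond Φ b₀ x₀) (hd : 0 < d) :
    ∃ δ > 0, ∃ C : ℝ, ∀ b c : Vec d, ∀ ε : ℝ, 0 < ε →
      ∫⁻ y, (Metric.closedBall b₀ δ).indicator 1 (b - y) * (Metric.closedBall x₀ δ).indicator 1 y *
        ENNReal.ofReal (gam ε (c - (Φ (b - y) + Φ y))) ≤ ENNReal.ofReal C := by
  obtain ⟨δ, hδ, κ, hκ, H⟩ := exists_sub_le_of_transCond hΦ hc hd
  have hd' : (0 : ℝ) < d := by exact_mod_cast hd
  set s : ℝ := 8 * d / κ ^ 2 with hs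
  have hs0 : 0 < s := by positivity
  refine ⟨δ, hδ, Real.exp (Real.pi * (1 / 4)) * s ^ ((d : ℝ) / 2), fun b c ε hε => ?_⟩
  set Y := {y | y ∈ Metric.closedBall x₀ δ ∧ b - y ∈ Metric.closedBall b₀ δ} with hY
  have hz : ∀ y ∉ Y, (Metric.closedBall b₀ δ).indicator (1 : Vec d → ℝ≥0∞) (b - y) *
      (Metric.closedBall x₀ δ).indicator 1 y = 0 := by
    intro y hy
    by_cases h1 : y ∈ Metric.closedBall x₀ δ
    · rw [Set.indicator_of_notMem fun h2 => hy ⟨h1, h2⟩, zero_mul]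
    · rw [Set.indicator_of_notMem h1, mul_zero]
  have hle : ∀ y, (Metric.closedBall b₀ δ).indicator (1 : Vec d → ℝ≥0∞) (b - y) *
      (Metric.closedBall x₀ δ).indicator 1 y ≤ 1 := fun y =>
    mul_le_one' (Set.indicator_le_self' (by simp) _) (Set.indicator_le_self' (by simp) _)
  rcases Y.eq_empty_or_nonempty with h0 | hne
  · simp [hz, h0]
  set D : Vec d → ℝ := fun y => ‖c - (Φ (b - y) + Φ y)‖ with hD
  have hbdd : BddBelow (D '' Y) := ⟨0, by rintro _ ⟨y, -, rfl⟩; exact norm_nonneg _⟩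
  obtain ⟨_, ⟨y₀, hy₀, rfl⟩, hlt⟩ := exists_lt_of_csInf_lt (hne.image D)
    (lt_add_of_pos_right (sInf (D '' Y)) (Real.sqrt_pos.2 hε))
  have hmin : ∀ y ∈ Y, D y₀ ≤ D y + Real.sqrt ε := fun y hy =>
    hlt.le.trans (by gcongr; exact csInf_le hbdd ⟨y, hy, rfl⟩)
  have hkey : ∀ y ∈ Y, gam ε (c - (Φ (b - y) + Φ y)) ≤
      Real.exp (Real.pi * (1 / 4)) * s ^ ((d : ℝ) / 2) * gam (s * ε) (y - y₀) := by
    intro y hy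
    refine gam_le_of_sum_sq_le hε hs0 ?_
    have h1 := H y hy.1 y₀ hy₀.1 (b - y) hy.2 (b - y₀) hy₀.2 (by abel)
    have h2 : ‖Φ y - Φ y₀ - (Φ (b - y₀) - Φ (b - y))‖ ≤ D y₀ + D y := by
      calc _ = ‖(c - (Φ (b - y₀) + Φ y₀)) - (c - (Φ (b - y) + Φ y))‖ := by congr 1; abel
        _ ≤ _ := norm_sub_le _ _
    have h3 := hmin y hy
    have h4 : κ * ‖y - y₀‖ ≤ 2 * D y + Real.sqrt ε := by linarith
    have h5 : κ ^ 2 * ‖y - y₀‖ ^ 2 ≤ 8 * D y ^ 2 + 2 * ε := by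
      have h6 := pow_le_pow_left₀ (by positivity) h4 2
      have h7 := Real.sq_sqrt hε.le
      nlinarith [sq_nonneg (2 * D y - Real.sqrt ε)]
    have h8 : s * ∑ i, (c - (Φ (b - y) + Φ y)) i ^ 2 + s * (1 / 4) * ε =
        d * ((8 * ∑ i, (c - (Φ (b - y) + Φ y)) i ^ 2 + 2 * ε) / κ ^ 2) := by
      rw [hs]
      ring
    rw [h8]
    refine (sum_sq_le_card_mul_norm_sq _).trans ?_
    refine mul_le_mul_of_nonneg_left ?_ hd'.le
    rw [le_div_iff₀ (by positivity), mul_comm]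
    refine h5.trans ?_
    gcongr
    exact norm_sq_le_sum_sq _
  calc _ ≤ ∫⁻ y, ENNReal.ofReal (Real.exp (Real.pi * (1 / 4)) * s ^ ((d : ℝ) / 2)) *
        ENNReal.ofReal (gam (s * ε) (y - y₀)) := by
        refine lintegral_mono fun y => ?_
        by_cases hy : y ∈ Y
        · refine (mul_le_of_le_one_left' (hle y)).trans ?_
          rw [← ENNReal.ofReal_mul (by positivity)]
          exact ENNReal.ofReal_le_ofReal (hkey y hy)
        · simp [hz y hy]
    _ = _ := by
        rw [lintegral_const_mul' _ _ ENNReal.ofReal_ne_top,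
          lintegral_sub_right_eq_self (fun y => ENNReal.ofReal (gam (s * ε) y)) y₀,
          lintegral_gam (by positivity), mul_one]

lemma gam_neg {n : ℕ} (ε : ℝ) (u : Vec n) : gam ε (-u) = gam ε u := by
  simp [gam, gauss]

lemma exists_energy_le {Φ : Vec d → Vec d} (hΦ : ContDiff ℝ ∞ Φ) {b₀ x₀ : Vec d}
    (hc : TransCond Φ b₀ x₀) (hd : 0 < d) :
    ∃ δ > 0, ∃ C : ℝ, ∀ f g : Vec d → ℝ≥0∞, Measurable f → Measurable g →
      (∀ x ∉ Metric.closedBall b₀ δ, f x = 0) → (∀ x ∉ Metric.closedBall x₀ δ, g x = 0) →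
      ∀ ε : ℝ, 0 < ε →
        energy Φ f g ε ≤ ENNReal.ofReal C * ((∫⁻ x, f x ^ 2) * ∫⁻ x, g x ^ 2) := by
  obtain ⟨δ, hδ, C, H⟩ := exists_lintegral_indicator_gam_le hΦ hc hd
  have hΦc := hΦ.continuous
  refine ⟨δ, hδ, 2 * C, fun f g hf hg hf0 hg0 ε hε => ?_⟩
  set χ : Vec d × Vec d → ℝ≥0∞ := fun q => (Metric.closedBall b₀ δ).indicator 1 q.1 *
    (Metric.closedBall x₀ δ).indicator 1 q.2 with hχ
  have hχm : Measurable χ := by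
    refine Measurable.mul ?_ ?_
    · exact (measurable_one.indicator Metric.isClosed_closedBall.measurableSet).comp measurable_fst
    · exact (measurable_one.indicator Metric.isClosed_closedBall.measurableSet).comp measurable_snd
  set A : Vec d × Vec d → ℝ≥0∞ := fun p => f p.1 * g p.2 with hA
  have hAm : Measurable A := by fun_prop
  have hAχ : ∀ p, A p = A p * χ p := by
    intro p
    by_cases h1 : p.1 ∈ Metric.closedBall b₀ δ
    · by_cases h2 : p.2 ∈ Metric.closedBall x₀ δ
      · simp [hχ, h1, h2]
      · simp [hA, hg0 _ h2]
    · simp [hA, hf0 _ h1]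
  set Γ : Vec d × Vec d → Vec d × Vec d → ℝ≥0∞ := fun p q =>
    ENNReal.ofReal (gam ε (p.1 + p.2 - (q.1 + q.2)) *
      gam ε (Φ p.1 + Φ p.2 - (Φ q.1 + Φ q.2))) with hΓ
  have hΓm : Measurable fun z : (Vec d × Vec d) × Vec d × Vec d => Γ z.1 z.2 := by
    refine Measurable.ennreal_ofReal (Continuous.measurable ?_)
    fun_prop
  have hΓs : ∀ p q, Γ p q = Γ q p := fun p q => by
    simp only [hΓ]
    rw [← gam_neg ε (p.1 + p.2 - (q.1 + q.2)), neg_sub,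
      ← gam_neg ε (Φ p.1 + Φ p.2 - (Φ q.1 + Φ q.2)), neg_sub]
  have hΓp : ∀ p, Measurable (Γ p) := fun p => by
    refine Measurable.ennreal_ofReal (Continuous.measurable ?_)
    fun_prop
  have hin : ∀ p, ∫⁻ q, χ q * Γ p q ≤ ENNReal.ofReal C := by
    intro p
    have hm : Measurable fun q => χ q * Γ p q := hχm.mul (hΓp p)
    have hs : ∫⁻ q, χ q * Γ p q = ∫⁻ y, ∫⁻ z, χ (z, y) * Γ p (z, y) :=
      lintegral_prod_symm (fun q => χ q * Γ p q) hm.aemeasurable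
    rw [hs]
    have e : ∀ y, ∫⁻ z, χ (z, y) * Γ p (z, y) = ∫⁻ η, ENNReal.ofReal (gam ε η) *
        (χ (p.1 + p.2 - η - y, y) * ENNReal.ofReal (gam ε (Φ p.1 + Φ p.2 -
          (Φ (p.1 + p.2 - η - y) + Φ y)))) := by
      intro y
      rw [← lintegral_sub_left_eq_self _ (p.1 + p.2 - y)]
      congr 1
      funext η
      simp only [hΓ]
      rw [show p.1 + p.2 - y - η = p.1 + p.2 - η - y by abel,
        show p.1 + p.2 - (p.1 + p.2 - η - y + y) = η by abel,
        ENNReal.ofReal_mul (gam_nonneg hε.le _)]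
      ring
    simp_rw [e]
    rw [lintegral_lintegral_swap]
    · simp_rw [lintegral_const_mul' _ _ ENNReal.ofReal_ne_top]
      calc _ ≤ ∫⁻ η : Vec d, ENNReal.ofReal (gam ε η) * ENNReal.ofReal C := by
            refine lintegral_mono fun η => ?_
            gcongr
            exact H _ _ ε hε
        _ = _ := by rw [lintegral_mul_const' _ _ ENNReal.ofReal_ne_top, lintegral_gam hε, one_mul]
    · refine Measurable.aemeasurable (Measurable.mul ?_ (Measurable.mul ?_ ?_))
      · exact Measurable.ennreal_ofReal (Continuous.measurable (by fun_prop))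
      · exact hχm.comp (f := fun z : Vec d × Vec d => (p.1 + p.2 - z.2 - z.1, z.1)) (by fun_prop)
      · exact Measurable.ennreal_ofReal (Continuous.measurable (by fun_prop))
  have hone : ∫⁻ p, ∫⁻ q, A p ^ 2 * χ q * Γ p q ≤
      ENNReal.ofReal C * ((∫⁻ x, f x ^ 2) * ∫⁻ x, g x ^ 2) := by
    calc _ ≤ ∫⁻ p, A p ^ 2 * ENNReal.ofReal C := by
          refine lintegral_mono fun p => ?_
          simp_rw [mul_assoc]
          have hm : Measurable fun q => χ q * Γ p q := hχm.mul (hΓp p)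
          rw [lintegral_const_mul _ hm]
          gcongr
          exact hin p
      _ = _ := by
          rw [lintegral_mul_const' _ _ ENNReal.ofReal_ne_top, mul_comm, Measure.volume_eq_prod]
          congr 1
          simp_rw [hA, mul_pow]
          exact lintegral_prod_mul (hf.pow_const 2).aemeasurable (hg.pow_const 2).aemeasurable
  have hm2 : Measurable fun z : (Vec d × Vec d) × Vec d × Vec d => A z.1 ^ 2 * χ z.2 * Γ z.1 z.2 :=
    (((hAm.comp measurable_fst).pow_const 2).mul (hχm.comp measurable_snd)).mul hΓm
  have hpt : ∀ p q, A p * A q * Γ p q ≤ A p ^ 2 * χ q * Γ p q + A q ^ 2 * χ p * Γ q p := by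
    intro p q
    rw [hΓs q p, ← add_mul]
    gcongr
    rcases le_total (A p) (A q) with h | h
    · refine le_add_left ?_
      rw [hAχ p, sq, mul_assoc, mul_comm (χ p), ← mul_assoc]
      gcongr
    · refine le_add_right ?_
      rw [hAχ q, sq, ← mul_assoc]
      gcongr
  calc energy Φ f g ε ≤ ∫⁻ p, ∫⁻ q, (A p ^ 2 * χ q * Γ p q + A q ^ 2 * χ p * Γ q p) :=
        lintegral_mono fun p => lintegral_mono fun q => hpt p q
    _ = (∫⁻ p, ∫⁻ q, A p ^ 2 * χ q * Γ p q) + ∫⁻ p, ∫⁻ q, A q ^ 2 * χ p * Γ q p := by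
        rw [← lintegral_add_left hm2.lintegral_prod_right']
        congr 1
        funext p
        exact lintegral_add_left ((hχm.const_mul (A p ^ 2)).mul (hΓp p)) _
    _ = 2 * ∫⁻ p, ∫⁻ q, A p ^ 2 * χ q * Γ p q := by
        rw [two_mul]
        congr 1
        exact lintegral_lintegral_swap (f := fun p q => A q ^ 2 * χ p * Γ q p)
          (hm2.comp measurable_swap).aemeasurable
    _ ≤ _ := by
        rw [ENNReal.ofReal_mul (by norm_num), ENNReal.ofReal_ofNat, mul_assoc]
        gcongr

end Square

section Levels

lemma sum_two_zpow_lt (s : Finset ℤ) : ∀ M : ℤ, (∀ l ∈ s, l ≤ M) →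
    ∑ l ∈ s, (2 : ℝ) ^ l < 2 ^ (M + 1) := by
  induction s using Finset.induction_on_max with
  | empty =>
    intro M _
    simp only [Finset.sum_empty]
    positivity
  | insert a s hs ih =>
    intro M hM
    rw [Finset.sum_insert fun h => (hs a h).false]
    have h1 := ih (a - 1) fun l hl => Int.le_sub_one_of_lt (hs l hl)
    have h2 : (2 : ℝ) ^ (a + 1) ≤ 2 ^ (M + 1) :=
      zpow_le_zpow_right₀ one_le_two (by have := hM a (Finset.mem_insert_self _ _); omega)
    rw [sub_add_cancel] at h1
    rw [zpow_add_one₀ two_ne_zero] at h2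
    linarith

lemma sum_ofReal_two_zpow_le {s : Finset ℤ} {m : ℝ≥0∞}
    (h : ∀ l ∈ s, ENNReal.ofReal (2 ^ l) ≤ m) : ∑ l ∈ s, ENNReal.ofReal (2 ^ l) ≤ 2 * m := by
  rcases s.eq_empty_or_nonempty with rfl | hs
  · simp
  rw [← ENNReal.ofReal_sum_of_nonneg fun l _ => by positivity]
  calc _ ≤ ENNReal.ofReal (2 ^ (s.max' hs + 1)) :=
        ENNReal.ofReal_le_ofReal (sum_two_zpow_lt s _ fun l hl => s.le_max' l hl).le
    _ = 2 * ENNReal.ofReal (2 ^ s.max' hs) := by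
        rw [zpow_add_one₀ two_ne_zero, mul_comm, ENNReal.ofReal_mul zero_le_two,
          ENNReal.ofReal_ofNat]
    _ ≤ _ := by
        gcongr
        exact h _ (s.max'_mem hs)

variable {X : Type*} [MeasurableSpace X] {μ : Measure X}

lemma sum_ofReal_rpow_mul_two_zpow_le {F : X → ℝ} (hF : AEMeasurable F μ) (hF0 : ∀ x, 0 ≤ F x)
    {p : ℝ} (hp : 0 < p) {α : ℤ → ℝ} (hα : ∀ l, 0 ≤ α l)
    (h : ∀ l s, 0 ≤ s → s < α l → ENNReal.ofReal (2 ^ l) ≤ μ {x | s < F x}) (s : Finset ℤ) :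
    ∑ l ∈ s, ENNReal.ofReal (2 ^ l) * ENNReal.ofReal (α l ^ p) ≤
      2 * ∫⁻ x, ENNReal.ofReal (F x ^ p) ∂μ := by
  set ν : Measure ℤ := ∑ l ∈ s, ENNReal.ofReal (2 ^ l) • Measure.dirac l with hν
  have h1 : ∑ l ∈ s, ENNReal.ofReal (2 ^ l) * ENNReal.ofReal (α l ^ p) =
      ∫⁻ l, ENNReal.ofReal (α l ^ p) ∂ν := by
    simp [hν]
  have h2 : ∀ t : ℝ, 0 ≤ t → ν {l | t < α l} ≤ 2 * μ {x | t < F x} := by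
    intro t ht
    have : ν {l | t < α l} = ∑ l ∈ s with t < α l, ENNReal.ofReal (2 ^ l) := by
      rw [Finset.sum_filter]
      simp [hν, Measure.finsetSum_apply, Set.indicator_apply]
    rw [this]
    exact sum_ofReal_two_zpow_le fun l hl => h l t ht (Finset.mem_filter.1 hl).2
  rw [h1, lintegral_rpow_eq_lintegral_meas_lt_mul _ (Filter.Eventually.of_forall hα)
    (Measurable.of_discrete).aemeasurable hp,
    lintegral_rpow_eq_lintegral_meas_lt_mul _ (Filter.Eventually.of_forall hF0) hF hp,
    ← mul_assoc, mul_comm 2, mul_assoc, ← lintegral_const_mul' 2 _ (by simp)]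
  refine mul_le_mul' le_rfl ?_
  refine setLIntegral_mono' measurableSet_Ioi fun t ht => ?_
  rw [← mul_assoc]
  gcongr
  exact h2 t (le_of_lt ht)

lemma measure_lt_norm_le {f : X → ℂ} (hf : Integrable f μ) {s b : ℝ} (hs : 0 < s)
    (h : ∫ x, ‖f x‖ ∂μ ≤ s * b) : μ {x | s < ‖f x‖} ≤ ENNReal.ofReal b := by
  refine (ENNReal.mul_le_mul_iff_right (ENNReal.ofReal_pos.2 hs).ne' ENNReal.ofReal_ne_top).1 ?_
  rw [← ENNReal.ofReal_mul hs.le]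
  refine le_trans (le_trans ?_ (mul_meas_ge_le_lintegral₀ hf.aestronglyMeasurable.enorm
    (ENNReal.ofReal s))) ?_
  · gcongr with x
    rw [← ofReal_norm]
    intro h
    exact ENNReal.ofReal_le_ofReal h.le
  · rw [← ofReal_integral_norm_eq_lintegral_enorm hf]
    exact ENNReal.ofReal_le_ofReal h

theorem exists_level_decomposition {f : X → ℂ} (hfm : Measurable f) (hf : Integrable f μ) {p : ℝ}
    (hp : 0 < p) :
    ∃ α : ℤ → ℝ, ∃ A : ℤ → Set X, (∀ l, 0 ≤ α l) ∧ (∀ l, MeasurableSet (A l)) ∧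
      (∀ l, μ (A l) ≤ ENNReal.ofReal (2 ^ (l + 1))) ∧ Pairwise (Function.onFun Disjoint A) ∧
      (∀ l, ∀ x ∈ A l, ‖f x‖ ≤ α l) ∧ (∀ᵐ x ∂μ, f x ≠ 0 → ∃ l, x ∈ A l) ∧
      ∀ s : Finset ℤ, ∑ l ∈ s, ENNReal.ofReal (2 ^ l) * ENNReal.ofReal (α l ^ p) ≤
        2 * ∫⁻ x, ENNReal.ofReal (‖f x‖ ^ p) ∂μ := by
  set S : ℤ → Set ℝ := fun l => {s | 0 ≤ s ∧ μ {x | s < ‖f x‖} ≤ ENNReal.ofReal (2 ^ l)} with hS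
  set K := ∫ x, ‖f x‖ ∂μ with hK
  have hK0 : 0 ≤ K := integral_nonneg fun _ => norm_nonneg _
  have hne : ∀ l, (S l).Nonempty := fun l => by
    have h2 : (0 : ℝ) < 2 ^ l := by positivity
    refine ⟨(K + 1) / 2 ^ l, by positivity, measure_lt_norm_le hf (by positivity) ?_⟩
    rw [div_mul_cancel₀ _ h2.ne']
    linarith
  have hbdd : ∀ l, BddBelow (S l) := fun l => ⟨0, fun s hs => hs.1⟩
  set α : ℤ → ℝ := fun l => sInf (S l) with hα
  have hα0 : ∀ l, 0 ≤ α l := fun l => le_csInf (hne l) fun s hs => hs.1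
  have hanti : Antitone α := fun l m hlm => csInf_le_csInf (hbdd m) (hne l) fun s hs =>
    ⟨hs.1, hs.2.trans (ENNReal.ofReal_le_ofReal (zpow_le_zpow_right₀ one_le_two hlm))⟩
  have hαμ : ∀ l, μ {x | α l < ‖f x‖} ≤ ENNReal.ofReal (2 ^ l) := by
    intro l
    obtain ⟨u, hu, hlim, huS⟩ := exists_seq_tendsto_sInf (hne l) (hbdd l)
    have hU : {x | α l < ‖f x‖} ⊆ ⋃ n, {x | u n < ‖f x‖} := fun x hx => by
      obtain ⟨n, hn⟩ := (hlim.eventually (gt_mem_nhds hx)).exists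
      exact Set.mem_iUnion.2 ⟨n, hn⟩
    refine (measure_mono hU).trans ?_
    have hmono : Monotone fun n => {x | u n < ‖f x‖} := fun m n hmn x hx =>
      (hu hmn).trans_lt hx
    rw [hmono.measure_iUnion]
    exact iSup_le fun n => (huS n).2
  have hlt : ∀ l s, 0 ≤ s → s < α l → ENNReal.ofReal (2 ^ l) ≤ μ {x | s < ‖f x‖} := by
    intro l s hs hsl
    by_contra! h
    exact notMem_of_lt_csInf hsl (hbdd l) ⟨hs, h.le⟩
  refine ⟨α, fun l => {x | α (l + 1) < ‖f x‖ ∧ ‖f x‖ ≤ α l}, hα0, fun l => ?_, fun l => ?_, ?_,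
    fun l x hx => hx.2, ?_, sum_ofReal_rpow_mul_two_zpow_le hfm.norm.aemeasurable
      (fun x => norm_nonneg _) hp hα0 hlt⟩
  · exact (measurableSet_lt measurable_const hfm.norm).inter
      (measurableSet_le hfm.norm measurable_const)
  · exact (measure_mono fun x hx => hx.1).trans (hαμ (l + 1))
  · refine (pairwise_disjoint_on _).2 fun l m hlm => ?_
    refine Set.disjoint_left.2 fun x hx hx' => ?_
    exact (hx.1.trans_le hx'.2).not_ge (hanti hlm)
  · have h0 : μ (⋂ n : ℕ, {x | α (-n) < ‖f x‖}) = 0 := by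
      refine le_antisymm (ge_of_tendsto' (x := Filter.atTop)
        (f := fun n : ℕ => ENNReal.ofReal (2 ^ (-n : ℤ))) ?_ fun n =>
          (measure_mono (Set.iInter_subset _ n)).trans (hαμ _)) zero_le
      rw [← ENNReal.ofReal_zero]
      refine ENNReal.tendsto_ofReal ?_
      have := tendsto_pow_atTop_nhds_zero_of_lt_one (r := (2⁻¹ : ℝ)) (by norm_num) (by norm_num)
      refine this.congr fun n => ?_
      simp
    filter_upwards [measure_eq_zero_iff_ae_notMem.1 h0] with x hx hfx
    have hfx0 : 0 < ‖f x‖ := norm_pos_iff.2 hfx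
    obtain ⟨n, hn⟩ : ∃ n : ℕ, ‖f x‖ ≤ α (-n) := by
      by_contra! h
      exact hx (Set.mem_iInter.2 h)
    obtain ⟨m, hm⟩ := pow_unbounded_of_one_lt (K / (‖f x‖ / 2)) (one_lt_two (α := ℝ))
    have hm' : α m < ‖f x‖ := by
      refine (csInf_le (hbdd m) ⟨(half_pos hfx0).le, measure_lt_norm_le hf (half_pos hfx0) ?_⟩).trans_lt
        (half_lt_self hfx0)
      rw [div_lt_iff₀ (half_pos hfx0)] at hm
      rw [zpow_natCast]
      linarith
    obtain ⟨l, hl, hmax⟩ := Int.exists_greatest_of_bdd (P := fun l => ‖f x‖ ≤ α l)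
      ⟨m, fun z hz => by
        by_contra! h
        exact ((hz.trans (hanti h.le)).trans_lt hm').false⟩ ⟨-n, hn⟩
    refine ⟨l, ?_, hl⟩
    by_contra! h
    have := hmax _ h
    omega

end Levels

section Schur

lemma summable_pow_natAbs {r : ℝ} (hr0 : 0 ≤ r) (hr1 : r < 1) :
    Summable fun j : ℤ => r ^ j.natAbs := by
  refine Summable.of_nat_of_neg ?_ ?_ <;>
    simpa using summable_geometric_of_lt_one hr0 hr1

lemma sum_pow_natAbs_sub_le {r : ℝ} (hr0 : 0 ≤ r) (hr1 : r < 1) (m : ℤ) (t : Finset ℤ) :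
    ∑ n ∈ t, r ^ (m - n).natAbs ≤ ∑' j : ℤ, r ^ j.natAbs := by
  rw [← (Equiv.subLeft m).tsum_eq fun j : ℤ => r ^ j.natAbs]
  exact ((Equiv.subLeft m).summable_iff.2 (summable_pow_natAbs hr0 hr1)).sum_le_tsum t
    fun n _ => pow_nonneg hr0 _

/-- Schur's test for the kernel `r ^ |m - n|` on `ℓ²(ℤ)`. -/
lemma sum_sum_mul_pow_natAbs_sub_le {r : ℝ} (hr0 : 0 ≤ r) (hr1 : r < 1) (a b : ℤ → ℝ)
    (s t : Finset ℤ) :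
    ∑ m ∈ s, ∑ n ∈ t, a m * b n * r ^ (m - n).natAbs ≤
      (∑' j : ℤ, r ^ j.natAbs) * (√(∑ m ∈ s, a m ^ 2) * √(∑ n ∈ t, b n ^ 2)) := by
  set K := ∑' j : ℤ, r ^ j.natAbs with hK
  have hK0 : 0 ≤ K := tsum_nonneg fun j => pow_nonneg hr0 _
  have h1 := Real.sum_mul_le_sqrt_mul_sqrt (s ×ˢ t) (fun z => a z.1 * √(r ^ (z.1 - z.2).natAbs))
    fun z => b z.2 * √(r ^ (z.1 - z.2).natAbs)
  simp only [mul_pow, Real.sq_sqrt (pow_nonneg hr0 _)] at h1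
  have h2 : ∑ z ∈ s ×ˢ t, a z.1 ^ 2 * r ^ (z.1 - z.2).natAbs ≤ K * ∑ m ∈ s, a m ^ 2 := by
    rw [Finset.sum_product, Finset.mul_sum]
    refine Finset.sum_le_sum fun m _ => ?_
    dsimp only
    rw [← Finset.mul_sum, mul_comm]
    exact mul_le_mul_of_nonneg_right (sum_pow_natAbs_sub_le hr0 hr1 m t) (sq_nonneg _)
  have h3 : ∑ z ∈ s ×ˢ t, b z.2 ^ 2 * r ^ (z.1 - z.2).natAbs ≤ K * ∑ n ∈ t, b n ^ 2 := by
    rw [Finset.sum_product_right, Finset.mul_sum]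
    refine Finset.sum_le_sum fun n _ => ?_
    dsimp only
    rw [← Finset.mul_sum, mul_comm]
    refine mul_le_mul_of_nonneg_right ?_ (sq_nonneg _)
    refine le_trans (Finset.sum_le_sum fun m _ => ?_) (sum_pow_natAbs_sub_le hr0 hr1 n s)
    rw [← Int.natAbs_neg, neg_sub]
  calc _ = ∑ z ∈ s ×ˢ t, a z.1 * √(r ^ (z.1 - z.2).natAbs) *
        (b z.2 * √(r ^ (z.1 - z.2).natAbs)) := by
        rw [Finset.sum_product]
        refine Finset.sum_congr rfl fun m _ => Finset.sum_congr rfl fun n _ => ?_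
        nth_rewrite 1 [← Real.mul_self_sqrt (pow_nonneg hr0 (m - n).natAbs)]
        ring
    _ ≤ √(K * ∑ m ∈ s, a m ^ 2) * √(K * ∑ n ∈ t, b n ^ 2) :=
        h1.trans (mul_le_mul (Real.sqrt_le_sqrt h2) (Real.sqrt_le_sqrt h3) (Real.sqrt_nonneg _)
          (Real.sqrt_nonneg _))
    _ = _ := by
        rw [Real.sqrt_mul hK0, Real.sqrt_mul hK0]
        nth_rewrite 3 [← Real.mul_self_sqrt hK0]
        ring

lemma sqrt_sum_sq_le_rpow_sum {ι : Type*} (s : Finset ι) {a : ι → ℝ} (ha : ∀ i, 0 ≤ a i) {p : ℝ}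
    (hp0 : 0 < p) (hp : p ≤ 2) : √(∑ i ∈ s, a i ^ 2) ≤ (∑ i ∈ s, a i ^ p) ^ p⁻¹ := by
  set A := ∑ i ∈ s, a i ^ p with hA
  have hA0 : 0 ≤ A := Finset.sum_nonneg fun i _ => Real.rpow_nonneg (ha i) p
  set T := A ^ p⁻¹ with hT
  have hT0 : 0 ≤ T := Real.rpow_nonneg hA0 _
  have hTp : T ^ p = A := Real.rpow_inv_rpow hA0 hp0.ne'
  have hle : ∀ i ∈ s, a i ≤ T := fun i hi => by
    rw [← Real.rpow_le_rpow_iff (ha i) hT0 hp0, hTp]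
    exact Finset.single_le_sum (f := fun i => a i ^ p) (fun j _ => Real.rpow_nonneg (ha j) p) hi
  refine Real.sqrt_le_iff.2 ⟨hT0, ?_⟩
  have hsq : ∀ x : ℝ, 0 ≤ x → x ^ 2 = x ^ p * x ^ (2 - p) := fun x hx => by
    rw [← Real.rpow_add_of_nonneg hx hp0.le (by linarith), add_sub_cancel, Real.rpow_two]
  rw [hsq T hT0, hTp, hA, Finset.sum_mul]
  refine Finset.sum_le_sum fun i hi => ?_
  rw [hsq _ (ha i)]
  exact mul_le_mul_of_nonneg_left (Real.rpow_le_rpow (ha i) (hle i hi) (by linarith))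
    (Real.rpow_nonneg (ha i) p)

end Schur

section Extension

variable {d k : ℕ}

lemma continuous_phase {Φ : Vec d → Vec k} (hΦ : Continuous Φ) :
    Continuous fun z : (Vec d × Vec k) × Vec d =>
      ∑ i, z.1.1 i * z.2 i + ∑ j, z.1.2 j * Φ z.2 j := by
  fun_prop

lemma aestronglyMeasurable_fullExt {Φ : Vec d → Vec k} (hΦ : Continuous Φ) {f : Vec d → ℂ}
    (hf : AEStronglyMeasurable f volume) : AEStronglyMeasurable (fullExt Φ f) volume := by
  refine AEStronglyMeasurable.integral_prod_right' (f := fun z : (Vec d × Vec k) × Vec d =>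
    osc (∑ i, z.1.1 i * z.2 i + ∑ j, z.1.2 j * Φ z.2 j) * f z.2) ?_
  exact (continuous_osc.comp (continuous_phase hΦ)).aestronglyMeasurable.mul hf.comp_snd

lemma measurable_osc_phase {Φ : Vec d → Vec k} (hΦ : Continuous Φ) (w : Vec d × Vec k) :
    Measurable fun ξ => osc (∑ i, w.1 i * ξ i + ∑ j, w.2 j * Φ ξ j) :=
  (continuous_osc.comp ((continuous_phase hΦ).comp (Continuous.prodMk_right w))).measurable

lemma integrable_osc_mul {Φ : Vec d → Vec k} (hΦ : Continuous Φ) {f : Vec d → ℂ}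
    (hf : Integrable f) (w : Vec d × Vec k) :
    Integrable fun ξ => osc (∑ i, w.1 i * ξ i + ∑ j, w.2 j * Φ ξ j) * f ξ :=
  hf.bdd_mul (c := 1) (measurable_osc_phase hΦ w).aestronglyMeasurable
    (Filter.Eventually.of_forall fun _ => (norm_osc _).le)

lemma fullExt_sum {Φ : Vec d → Vec k} (hΦ : Continuous Φ) {ι : Type*} (s : Finset ι)
    {f : ι → Vec d → ℂ} (hf : ∀ i ∈ s, Integrable (f i)) (w : Vec d × Vec k) :
    fullExt Φ (fun x => ∑ i ∈ s, f i x) w = ∑ i ∈ s, fullExt Φ (f i) w := by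
  simp only [fullExt, Finset.mul_sum]
  exact integral_finsetSum s fun i hi => integrable_osc_mul hΦ (hf i hi) w

lemma tendsto_fullExt {Φ : Vec d → Vec k} (hΦ : Continuous Φ) {f : Vec d → ℂ} (hf : Integrable f)
    {F : ℕ → Vec d → ℂ} (hF : ∀ n, AEStronglyMeasurable (F n) volume)
    (hle : ∀ n x, ‖F n x‖ ≤ ‖f x‖)
    (hlim : ∀ᵐ x, Filter.Tendsto (fun n => F n x) Filter.atTop (𝓝 (f x))) (w : Vec d × Vec k) :
    Filter.Tendsto (fun n => fullExt Φ (F n) w) Filter.atTop (𝓝 (fullExt Φ f w)) := by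
  refine tendsto_integral_of_dominated_convergence (fun x => ‖f x‖)
    (fun n => (measurable_osc_phase hΦ w).aestronglyMeasurable.mul (hF n)) hf.norm
    (fun n => Filter.Eventually.of_forall fun x => ?_) ?_
  · rw [norm_mul, norm_osc, one_mul]
    exact hle n x
  · filter_upwards [hlim] with x hx
    exact hx.const_mul _

lemma eLpNorm_two_le_ofReal {X : Type*} [MeasurableSpace X] {μ : Measure X} {F : X → ℂ} {M : ℝ}
    (hM : 0 ≤ M) (h : ∫⁻ x, ‖F x‖ₑ ^ 2 ∂μ ≤ ENNReal.ofReal (M ^ 2)) :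
    eLpNorm F 2 μ ≤ ENNReal.ofReal M := by
  rw [← ENNReal.pow_le_pow_left_iff (n := 2) two_ne_zero, ← ENNReal.ofReal_pow hM]
  refine le_trans (le_of_eq ?_) h
  have := eLpNorm_nnreal_pow_eq_lintegral (f := F) (μ := μ) (p := 2) two_ne_zero
  simpa using this

lemma eLpNorm_sum_sum_le {X ι : Type*} [MeasurableSpace X] {μ : Measure X} (s t : Finset ι)
    {F : ι → ι → X → ℂ} (hF : ∀ i ∈ s, ∀ j ∈ t, AEStronglyMeasurable (F i j) μ) :
    eLpNorm (fun x => ∑ i ∈ s, ∑ j ∈ t, F i j x) 2 μ ≤ ∑ i ∈ s, ∑ j ∈ t, eLpNorm (F i j) 2 μ := by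
  have e : (fun x => ∑ i ∈ s, ∑ j ∈ t, F i j x) = ∑ z ∈ s ×ˢ t, F z.1 z.2 := by
    funext x
    rw [Finset.sum_apply, Finset.sum_product]
  rw [e, ← Finset.sum_product' (f := fun i j => eLpNorm (F i j) 2 μ)]
  refine eLpNorm_sum_le (fun z hz => ?_) _root_.one_le_two
  rw [Finset.mem_product] at hz
  exact hF _ hz.1 _ hz.2

end Extension

section Interpolation

lemma sq_interpolation (K α γ σ q c : ℝ) (hK : 0 ≤ K) (hq : q = (1 + σ) / 4) (hc : c = (σ - 1) / 4)
    {m n : ℤ} (hmn : n ≤ m) :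
    K * (α ^ 2 * γ ^ 2) * (2 ^ (m + 1) * (2 ^ (n + 1)) ^ σ) =
      (√(K * 2 ^ (1 + σ)) * ((α * 2 ^ (m * q)) * (γ * 2 ^ (n * q)) *
        ((2 : ℝ) ^ (-c)) ^ (m - n).natAbs)) ^ 2 := by
  have h2 : (0 : ℝ) < 2 := two_pos
  have e1 : ((2 : ℝ) ^ (-c)) ^ (m - n).natAbs = 2 ^ (-c * (m - n)) := by
    rw [← Real.rpow_natCast, ← Real.rpow_mul h2.le]
    congr 2
    rw [Nat.cast_natAbs, abs_of_nonneg (by omega), Int.cast_sub]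
  have e2 : ((2 : ℝ) ^ (m + 1) * (2 ^ (n + 1)) ^ σ : ℝ) =
      2 ^ (1 + σ) * (2 ^ (m * q) * 2 ^ (n * q) * 2 ^ (-c * (m - n))) ^ 2 := by
    rw [← Real.rpow_intCast, ← Real.rpow_intCast, ← Real.rpow_mul h2.le, ← Real.rpow_add h2,
      ← Real.rpow_add h2, ← Real.rpow_add h2, ← Real.rpow_natCast, ← Real.rpow_mul h2.le,
      ← Real.rpow_add h2]
    congr 1
    push_cast
    rw [hq, hc]
    ring
  rw [e1, mul_pow, Real.sq_sqrt (by positivity), e2]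
  ring

variable {d k : ℕ}

lemma exists_eLpNorm_fullExt_level_le {Φ : Vec d → Vec k} (hΦ : ContDiff ℝ ∞ Φ) {b₀ x₀ : Vec d}
    (hc : TransCond Φ b₀ x₀) (hc' : TransCond Φ x₀ b₀) (hdk : k < d) {q c : ℝ}
    (hq : q = (1 + 2 * d / (d + k)) / 4) (hcq : c = (2 * d / (d + k) - 1) / 4) :
    ∃ δ > 0, ∃ K ≥ 0, ∀ E ⊆ Metric.closedBall b₀ δ, ∀ G ⊆ Metric.closedBall x₀ δ,
      MeasurableSet E → MeasurableSet G → ∀ f g : Vec d → ℂ, Integrable f → Integrable g →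
      ∀ α γ : ℝ, 0 ≤ α → 0 ≤ γ → (∀ x ∈ E, ‖f x‖ ≤ α) → (∀ x ∈ G, ‖g x‖ ≤ γ) → ∀ m n : ℤ,
      volume E ≤ ENNReal.ofReal (2 ^ (m + 1)) → volume G ≤ ENNReal.ofReal (2 ^ (n + 1)) →
      eLpNorm (fun w => fullExt Φ (E.indicator f) w * fullExt Φ (G.indicator g) w) 2 volume ≤
        ENNReal.ofReal (K * ((α * 2 ^ (m * q)) * (γ * 2 ^ (n * q)) *
          ((2 : ℝ) ^ (-c)) ^ (m - n).natAbs)) := by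
  obtain ⟨δ₁, hδ₁, C₁, H₁⟩ := exists_lintegral_fullExt_mul_sq_le hΦ hc hdk
  obtain ⟨δ₂, hδ₂, C₂, H₂⟩ := exists_lintegral_fullExt_mul_sq_le hΦ hc' hdk
  set σ : ℝ := 2 * d / (d + k) with hσ
  have hσ0 : 0 ≤ σ := by positivity
  set C := max 0 (max C₁ C₂) with hC
  have hC0 : 0 ≤ C := le_max_left _ _
  refine ⟨min δ₁ δ₂, lt_min hδ₁ hδ₂, √(C * 2 ^ (1 + σ)), Real.sqrt_nonneg _, ?_⟩
  intro E hE G hG hEm hGm f g hf hg α γ hα hγ hfα hgγ m n hEv hGv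
  have hball : ∀ x : Vec d, Metric.closedBall x (min δ₁ δ₂) ⊆ Metric.closedBall x δ₁ ∧
      Metric.closedBall x (min δ₁ δ₂) ⊆ Metric.closedBall x δ₂ := fun x =>
    ⟨Metric.closedBall_subset_closedBall (min_le_left _ _),
      Metric.closedBall_subset_closedBall (min_le_right _ _)⟩
  have hind : ∀ (A : Set (Vec d)) (h : Vec d → ℂ) (β : ℝ), (∀ x ∈ A, ‖h x‖ ≤ β) →
      ∀ x, ‖A.indicator h x‖ₑ ≤ A.indicator (fun _ => ENNReal.ofReal β) x := by
    intro A h β hβ x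
    by_cases hx : x ∈ A
    · rw [Set.indicator_of_mem hx, Set.indicator_of_mem hx, ← ofReal_norm]
      exact ENNReal.ofReal_le_ofReal (hβ x hx)
    · simp [hx]
  have hreal : ∀ (D : ℝ) (a b : ℝ) (A B : Set (Vec d)) (i j : ℤ), D ≤ C → 0 ≤ a → 0 ≤ b →
      volume A ≤ ENNReal.ofReal (2 ^ (i + 1)) → volume B ≤ ENNReal.ofReal (2 ^ (j + 1)) →
      ENNReal.ofReal D * (ENNReal.ofReal a ^ 2 * ENNReal.ofReal b ^ 2) *
        (volume A * volume B ^ σ) ≤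
      ENNReal.ofReal (C * (a ^ 2 * b ^ 2) * (2 ^ (i + 1) * (2 ^ (j + 1)) ^ σ)) := by
    intro D a b A B i j hD ha hb hA hB
    rw [ENNReal.ofReal_mul (by positivity), ENNReal.ofReal_mul hC0,
      ENNReal.ofReal_mul (by positivity), ENNReal.ofReal_mul (by positivity),
      ENNReal.ofReal_pow ha, ENNReal.ofReal_pow hb,
      ← ENNReal.ofReal_rpow_of_nonneg (by positivity) hσ0]
    gcongr
  refine eLpNorm_two_le_ofReal (by positivity) ?_
  rcases le_total n m with h | h
  · rw [← sq_interpolation C α γ σ q c hC0 hq hcq h]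
    refine (H₁ E (hE.trans (hball _).1) G (hG.trans (hball _).1) hEm hGm _ _ (hf.indicator hEm)
      (hg.indicator hGm) _ _ ENNReal.ofReal_ne_top ENNReal.ofReal_ne_top (hind E f α hfα)
      (hind G g γ hgγ)).trans ?_
    exact hreal C₁ α γ E G m n ((le_max_left _ _).trans (le_max_right _ _)) hα hγ hEv hGv
  · have e : (α * 2 ^ (m * q)) * (γ * 2 ^ (n * q)) * ((2 : ℝ) ^ (-c)) ^ (m - n).natAbs =
        (γ * 2 ^ (n * q)) * (α * 2 ^ (m * q)) * ((2 : ℝ) ^ (-c)) ^ (n - m).natAbs := by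
      rw [← Int.natAbs_neg, neg_sub]
      ring
    rw [e, ← sq_interpolation C γ α σ q c hC0 hq hcq h]
    simp_rw [mul_comm (fullExt Φ (E.indicator f) _)]
    refine (H₂ G (hG.trans (hball _).2) E (hE.trans (hball _).2) hGm hEm _ _ (hg.indicator hGm)
      (hf.indicator hEm) _ _ ENNReal.ofReal_ne_top ENNReal.ofReal_ne_top (hind G g γ hgγ)
      (hind E f α hfα)).trans ?_
    exact hreal C₂ γ α G E n m ((le_max_right _ _).trans (le_max_right _ _)) hγ hα hGv hEv

lemma sum_indicator_of_mem {X ι : Type*} {A : ι → Set X} (hA : Pairwise (Function.onFun Disjoint A))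
    (f : X → ℂ) {x : X} {l : ι} (hl : x ∈ A l) {s : Finset ι} (hs : l ∈ s) :
    ∑ i ∈ s, (A i).indicator f x = f x := by
  rw [Finset.sum_eq_single_of_mem l hs fun i _ hi => Set.indicator_of_notMem
    (Set.disjoint_right.1 (hA hi) hl) f, Set.indicator_of_mem hl]

lemma norm_sum_indicator_le {X ι : Type*} {A : ι → Set X}
    (hA : Pairwise (Function.onFun Disjoint A)) (f : X → ℂ) (s : Finset ι) (x : X) :
    ‖∑ i ∈ s, (A i).indicator f x‖ ≤ ‖f x‖ := by
  by_cases h : ∃ l ∈ s, x ∈ A l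
  · obtain ⟨l, hl, hx⟩ := h
    rw [sum_indicator_of_mem hA f hx hl]
  · push Not at h
    rw [Finset.sum_eq_zero fun i hi => Set.indicator_of_notMem (h i hi) f, norm_zero]
    exact norm_nonneg _

lemma tendsto_sum_indicator {X : Type*} {A : ℤ → Set X}
    (hA : Pairwise (Function.onFun Disjoint A)) (f : X → ℂ) {x : X}
    (hx : f x ≠ 0 → ∃ l, x ∈ A l) :
    Filter.Tendsto (fun n : ℕ => ∑ i ∈ Finset.Icc (-n : ℤ) n, (A i).indicator f x) Filter.atTop
      (𝓝 (f x)) := by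
  by_cases h0 : f x = 0
  · refine tendsto_const_nhds.congr fun n => ?_
    rw [h0, Finset.sum_eq_zero fun i _ => by simp [h0]]
  · obtain ⟨l, hl⟩ := hx h0
    refine tendsto_const_nhds.congr' ?_
    filter_upwards [Filter.eventually_ge_atTop l.natAbs] with n hn
    exact (sum_indicator_of_mem hA f hl (Finset.mem_Icc.2 (by omega))).symm

lemma ofReal_sqrt_sum_sq_le {X : Type*} [MeasurableSpace X] {μ : Measure X} {f : X → ℂ} {p : ℝ}
    (hp0 : 0 < p) (hp : p ≤ 2) {α : ℤ → ℝ} (hα : ∀ l, 0 ≤ α l) {s : Finset ℤ}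
    (h : ∑ l ∈ s, ENNReal.ofReal (2 ^ l) * ENNReal.ofReal (α l ^ p) ≤
      2 * ∫⁻ x, ENNReal.ofReal (‖f x‖ ^ p) ∂μ) :
    ENNReal.ofReal (√(∑ l ∈ s, (α l * 2 ^ (l * p⁻¹)) ^ 2)) ≤
      2 ^ p⁻¹ * eLpNorm f (ENNReal.ofReal p) μ := by
  have h0 : ∀ l : ℤ, 0 ≤ α l * 2 ^ (l * p⁻¹) := fun l => mul_nonneg (hα l) (by positivity)
  calc _ ≤ ENNReal.ofReal ((∑ l ∈ s, (α l * 2 ^ (l * p⁻¹)) ^ p) ^ p⁻¹) :=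
        ENNReal.ofReal_le_ofReal (sqrt_sum_sq_le_rpow_sum s h0 hp0 hp)
    _ = (∑ l ∈ s, ENNReal.ofReal (2 ^ l) * ENNReal.ofReal (α l ^ p)) ^ p⁻¹ := by
        rw [← ENNReal.ofReal_rpow_of_nonneg (Finset.sum_nonneg fun l _ =>
          Real.rpow_nonneg (h0 l) p) (by positivity), ENNReal.ofReal_sum_of_nonneg fun l _ =>
          Real.rpow_nonneg (h0 l) p]
        congr 1
        refine Finset.sum_congr rfl fun l _ => ?_
        rw [← ENNReal.ofReal_mul (by positivity), Real.mul_rpow (hα l) (by positivity),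
          ← Real.rpow_mul two_pos.le, inv_mul_cancel_right₀ hp0.ne', Real.rpow_intCast, mul_comm]
    _ ≤ (2 * ∫⁻ x, ENNReal.ofReal (‖f x‖ ^ p) ∂μ) ^ p⁻¹ := by gcongr
    _ = _ := by
        rw [ENNReal.mul_rpow_of_nonneg _ _ (by positivity), eLpNorm_eq_lintegral_rpow_enorm_toReal
          (ENNReal.ofReal_pos.2 hp0).ne' ENNReal.ofReal_ne_top, ENNReal.toReal_ofReal hp0.le,
          one_div]
        simp_rw [← ofReal_norm, ENNReal.ofReal_rpow_of_nonneg (norm_nonneg _) hp0.le]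

theorem exists_eLpNorm_fullExt_mul_le_of_lt {Φ : Vec d → Vec k} (hΦ : ContDiff ℝ ∞ Φ)
    {b₀ x₀ : Vec d} (hc : TransCond Φ b₀ x₀) (hc' : TransCond Φ x₀ b₀) (hdk : k < d)
    (hk : 1 ≤ k) {p : ℝ} (hp : p = 4 * ((d : ℝ) + k) / (3 * d + k)) :
    ∃ δ > 0, ∃ C : ℝ, ∀ f g : Vec d → ℂ, Measurable f → Measurable g →
      Integrable f → Integrable g → (∀ x ∉ Metric.closedBall b₀ δ, f x = 0) →
      (∀ x ∉ Metric.closedBall x₀ δ, g x = 0) →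
      eLpNorm (fun w => fullExt Φ f w * fullExt Φ g w) 2 volume ≤
        ENNReal.ofReal C * eLpNorm f (ENNReal.ofReal p) volume *
          eLpNorm g (ENNReal.ofReal p) volume := by
  have hd0 : (0 : ℝ) < d := by exact_mod_cast (by omega : 0 < d)
  have hk0 : (0 : ℝ) < k := by exact_mod_cast hk
  have hdk' : (k : ℝ) < d := by exact_mod_cast hdk
  have hp0 : 0 < p := by rw [hp]; positivity
  have hp2 : p ≤ 2 := by
    rw [hp, div_le_iff₀ (by positivity)]
    linarith
  have hq : p⁻¹ = (1 + 2 * d / (d + k)) / 4 := by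
    rw [hp]
    field_simp
    ring
  set c : ℝ := (2 * d / (d + k) - 1) / 4 with hcd
  have hc0 : 0 < c := by
    have : (1 : ℝ) < 2 * d / (d + k) := by
      rw [lt_div_iff₀ (by positivity)]
      linarith
    rw [hcd]
    linarith
  set r : ℝ := 2 ^ (-c) with hr
  have hr0 : 0 ≤ r := by positivity
  have hr1 : r < 1 := Real.rpow_lt_one_of_one_lt_of_neg _root_.one_lt_two (neg_neg_of_pos hc0)
  obtain ⟨δ, hδ, K, hK, H⟩ := exists_eLpNorm_fullExt_level_le hΦ hc hc' hdk hq hcd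
  have hΦc := hΦ.continuous
  set L := ∑' j : ℤ, r ^ j.natAbs with hL
  have hL0 : 0 ≤ L := tsum_nonneg fun j => pow_nonneg hr0 _
  refine ⟨δ, hδ, K * L * (2 ^ p⁻¹ * 2 ^ p⁻¹), fun f g hfm hgm hf hg hf0 hg0 => ?_⟩
  obtain ⟨α, A, hα, hAm, hAv, hAd, hAα, hAf, hAs⟩ := exists_level_decomposition hfm hf hp0
  obtain ⟨γ, B, hγ, hBm, hBv, hBd, hBγ, hBg, hBs⟩ := exists_level_decomposition hgm hg hp0
  set A' : ℤ → Set (Vec d) := fun l => A l ∩ Metric.closedBall b₀ δ with hA'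
  set B' : ℤ → Set (Vec d) := fun l => B l ∩ Metric.closedBall x₀ δ with hB'
  have hA'm : ∀ l, MeasurableSet (A' l) := fun l =>
    (hAm l).inter Metric.isClosed_closedBall.measurableSet
  have hB'm : ∀ l, MeasurableSet (B' l) := fun l =>
    (hBm l).inter Metric.isClosed_closedBall.measurableSet
  have hA'd : Pairwise (Function.onFun Disjoint A') := fun i j hij =>
    (hAd hij).mono Set.inter_subset_left Set.inter_subset_left
  have hB'd : Pairwise (Function.onFun Disjoint B') := fun i j hij =>
    (hBd hij).mono Set.inter_subset_left Set.inter_subset_left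
  set F : ℕ → Vec d → ℂ := fun n x => ∑ i ∈ Finset.Icc (-n : ℤ) n, (A' i).indicator f x with hF
  set G : ℕ → Vec d → ℂ := fun n x => ∑ i ∈ Finset.Icc (-n : ℤ) n, (B' i).indicator g x with hG
  have hFm : ∀ n, AEStronglyMeasurable (F n) volume := fun n =>
    (Finset.measurable_fun_sum _ fun i _ => hfm.indicator (hA'm i)).aestronglyMeasurable
  have hGm : ∀ n, AEStronglyMeasurable (G n) volume := fun n =>
    (Finset.measurable_fun_sum _ fun i _ => hgm.indicator (hB'm i)).aestronglyMeasurable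
  have hFlim : ∀ᵐ x, Filter.Tendsto (fun n => F n x) Filter.atTop (𝓝 (f x)) := by
    filter_upwards [hAf] with x hx
    refine tendsto_sum_indicator hA'd f fun h => ?_
    obtain ⟨l, hl⟩ := hx h
    exact ⟨l, hl, by_contra fun hb => h (hf0 x hb)⟩
  have hGlim : ∀ᵐ x, Filter.Tendsto (fun n => G n x) Filter.atTop (𝓝 (g x)) := by
    filter_upwards [hBg] with x hx
    refine tendsto_sum_indicator hB'd g fun h => ?_
    obtain ⟨l, hl⟩ := hx h
    exact ⟨l, hl, by_contra fun hb => h (hg0 x hb)⟩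
  have hbound : ∀ n, eLpNorm (fun w => fullExt Φ (F n) w * fullExt Φ (G n) w) 2 volume ≤
      ENNReal.ofReal (K * L * (2 ^ p⁻¹ * 2 ^ p⁻¹)) * eLpNorm f (ENNReal.ofReal p) volume *
          eLpNorm g (ENNReal.ofReal p) volume := by
    intro n
    set s := Finset.Icc (-n : ℤ) n with hs
    have hfi : ∀ i ∈ s, Integrable ((A' i).indicator f) := fun i _ => hf.indicator (hA'm i)
    have hgi : ∀ i ∈ s, Integrable ((B' i).indicator g) := fun i _ => hg.indicator (hB'm i)
    have e : (fun w => fullExt Φ (F n) w * fullExt Φ (G n) w) = fun w => ∑ i ∈ s, ∑ j ∈ s,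
        fullExt Φ ((A' i).indicator f) w * fullExt Φ ((B' j).indicator g) w := by
      funext w
      rw [hF, hG, fullExt_sum hΦc s hfi, fullExt_sum hΦc s hgi, Finset.sum_mul_sum]
    rw [e]
    calc _ ≤ ∑ i ∈ s, ∑ j ∈ s, eLpNorm (fun w => fullExt Φ ((A' i).indicator f) w *
          fullExt Φ ((B' j).indicator g) w) 2 volume :=
          eLpNorm_sum_sum_le s s fun i hi j hj =>
            (aestronglyMeasurable_fullExt hΦc (hfi i hi).aestronglyMeasurable).mul
              (aestronglyMeasurable_fullExt hΦc (hgi j hj).aestronglyMeasurable)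
      _ ≤ ∑ i ∈ s, ∑ j ∈ s, ENNReal.ofReal (K * ((α i * 2 ^ (i * p⁻¹)) * (γ j * 2 ^ (j * p⁻¹)) *
          r ^ (i - j).natAbs)) :=
          Finset.sum_le_sum fun i _ => Finset.sum_le_sum fun j _ =>
            H (A' i) Set.inter_subset_right (B' j) Set.inter_subset_right (hA'm i) (hB'm j) f g
              hf hg (α i) (γ j) (hα i) (hγ j) (fun x hx => hAα i x hx.1)
              (fun x hx => hBγ j x hx.1) i j ((measure_mono Set.inter_subset_left).trans (hAv i))
              ((measure_mono Set.inter_subset_left).trans (hBv j))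
      _ = ENNReal.ofReal (K * ∑ i ∈ s, ∑ j ∈ s, (α i * 2 ^ (i * p⁻¹)) * (γ j * 2 ^ (j * p⁻¹)) *
          r ^ (i - j).natAbs) := by
          have h0 : ∀ i j : ℤ, 0 ≤ K * ((α i * 2 ^ (i * p⁻¹)) * (γ j * 2 ^ (j * p⁻¹)) *
              r ^ (i - j).natAbs) := fun i j => by
            have := hα i
            have := hγ j
            positivity
          simp_rw [Finset.mul_sum]
          rw [ENNReal.ofReal_sum_of_nonneg fun i _ => Finset.sum_nonneg fun j _ => h0 i j]
          refine Finset.sum_congr rfl fun i _ => ?_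
          rw [ENNReal.ofReal_sum_of_nonneg fun j _ => h0 i j]
      _ ≤ ENNReal.ofReal (K * (L * (√(∑ i ∈ s, (α i * 2 ^ (i * p⁻¹)) ^ 2) *
          √(∑ j ∈ s, (γ j * 2 ^ (j * p⁻¹)) ^ 2)))) := by
          gcongr
          exact sum_sum_mul_pow_natAbs_sub_le hr0 hr1 _ _ s s
      _ = ENNReal.ofReal (K * L) * (ENNReal.ofReal (√(∑ i ∈ s, (α i * 2 ^ (i * p⁻¹)) ^ 2)) *
          ENNReal.ofReal (√(∑ j ∈ s, (γ j * 2 ^ (j * p⁻¹)) ^ 2))) := by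
          rw [← mul_assoc, ENNReal.ofReal_mul (by positivity),
            ENNReal.ofReal_mul (Real.sqrt_nonneg _)]
      _ ≤ ENNReal.ofReal (K * L) * ((2 ^ p⁻¹ * eLpNorm f (ENNReal.ofReal p) volume) *
          (2 ^ p⁻¹ * eLpNorm g (ENNReal.ofReal p) volume)) := by
          gcongr
          · exact ofReal_sqrt_sum_sq_le hp0 hp2 hα (hAs s)
          · exact ofReal_sqrt_sum_sq_le hp0 hp2 hγ (hBs s)
      _ = _ := by
          have h2 : (2 : ℝ≥0∞) ^ p⁻¹ = ENNReal.ofReal (2 ^ p⁻¹) := by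
            rw [← ENNReal.ofReal_rpow_of_pos two_pos, ENNReal.ofReal_ofNat]
          rw [h2, ENNReal.ofReal_mul (by positivity : 0 ≤ K * L),
            ENNReal.ofReal_mul (by positivity : (0 : ℝ) ≤ 2 ^ p⁻¹)]
          ring
  have hlim : ∀ᵐ w, Filter.Tendsto (fun n => fullExt Φ (F n) w * fullExt Φ (G n) w) Filter.atTop
      (𝓝 (fullExt Φ f w * fullExt Φ g w)) := Filter.Eventually.of_forall fun w =>
    (tendsto_fullExt hΦc hf hFm (fun n => norm_sum_indicator_le hA'd f _) hFlim w).mul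
      (tendsto_fullExt hΦc hg hGm (fun n => norm_sum_indicator_le hB'd g _) hGlim w)
  refine (Lp.eLpNorm_lim_le_liminf_eLpNorm (fun n => (aestronglyMeasurable_fullExt hΦc
    (hFm n)).mul (aestronglyMeasurable_fullExt hΦc (hGm n))) _ hlim).trans ?_
  exact Filter.liminf_le_of_le (by isBoundedDefault) fun b hb => by
    obtain ⟨n, hn⟩ := hb.exists
    exact hn.trans (hbound n)

end Interpolation

section Localization

variable {d k : ℕ}

lemma exists_eLpNorm_fullExt_mul_le_of_eq {Φ : Vec d → Vec d} (hΦ : ContDiff ℝ ∞ Φ)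
    {b₀ x₀ : Vec d} (hc : TransCond Φ b₀ x₀) (hd : 0 < d) :
    ∃ δ > 0, ∃ C : ℝ, ∀ f g : Vec d → ℂ, Measurable f → Measurable g →
      Integrable f → Integrable g → (∀ x ∉ Metric.closedBall b₀ δ, f x = 0) →
      (∀ x ∉ Metric.closedBall x₀ δ, g x = 0) →
      eLpNorm (fun w => fullExt Φ f w * fullExt Φ g w) 2 volume ≤
        ENNReal.ofReal C * eLpNorm f 2 volume * eLpNorm g 2 volume := by
  obtain ⟨δ, hδ, C, H⟩ := exists_energy_le hΦ hc hd
  refine ⟨δ, hδ, √(max C 0), fun f g hfm hgm hf hg hf0 hg0 => ?_⟩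
  have h := lintegral_fullExt_mul_sq_le hΦ.continuous hf hg (H _ _ hfm.enorm hgm.enorm
    (fun x hx => by simp [hf0 x hx]) (fun x hx => by simp [hg0 x hx]))
  have key : ∀ {X : Type} [MeasurableSpace X] (μ : Measure X) (F : X → ℂ),
      eLpNorm F 2 μ ^ 2 = ∫⁻ x, ‖F x‖ₑ ^ 2 ∂μ := fun {X} _ μ F => by
    simpa using eLpNorm_nnreal_pow_eq_lintegral (f := F) (μ := μ) (p := 2) two_ne_zero
  rw [← ENNReal.pow_le_pow_left_iff two_ne_zero, mul_pow, mul_pow, key, key, key,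
    ← ENNReal.ofReal_pow (Real.sqrt_nonneg _), Real.sq_sqrt (le_max_right _ _), mul_assoc]
  refine h.trans ?_
  gcongr
  exact le_max_left _ _

theorem exists_eLpNorm_fullExt_mul_le {Φ : Vec d → Vec k} (hΦ : ContDiff ℝ ∞ Φ)
    {b₀ x₀ : Vec d} (hc : TransCond Φ b₀ x₀) (hc' : TransCond Φ x₀ b₀) (hdk : k ≤ d)
    (hk : 1 ≤ k) {p : ℝ} (hp : p = 4 * ((d : ℝ) + k) / (3 * d + k)) :
    ∃ δ > 0, ∃ C : ℝ, ∀ f g : Vec d → ℂ, Measurable f → Measurable g →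
      Integrable f → Integrable g → (∀ x ∉ Metric.closedBall b₀ δ, f x = 0) →
      (∀ x ∉ Metric.closedBall x₀ δ, g x = 0) →
      eLpNorm (fun w => fullExt Φ f w * fullExt Φ g w) 2 volume ≤
        ENNReal.ofReal C * eLpNorm f (ENNReal.ofReal p) volume *
          eLpNorm g (ENNReal.ofReal p) volume := by
  rcases hdk.lt_or_eq with hlt | rfl
  · exact exists_eLpNorm_fullExt_mul_le_of_lt hΦ hc hc' hlt hk hp
  · have hk0 : (0 : ℝ) < k := by exact_mod_cast hk
    have hp2 : p = 2 := by rw [hp]; field_simp; ring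
    rw [hp2, ENNReal.ofReal_ofNat]
    exact exists_eLpNorm_fullExt_mul_le_of_eq hΦ hc hk

/-- The bilinear estimate for functions supported in measurable enlargements of `A` and `B`. -/
def BilinearBound (Φ : Vec d → Vec k) (p : ℝ≥0∞) (A B : Set (Vec d)) : Prop :=
  ∃ A' B' : Set (Vec d), A ⊆ A' ∧ B ⊆ B' ∧ MeasurableSet A' ∧ MeasurableSet B' ∧ ∃ C : NNReal,
    ∀ f g : Vec d → ℂ, Measurable f → Measurable g → Integrable f → Integrable g →
      (∀ x ∉ A', f x = 0) → (∀ x ∉ B', g x = 0) →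
      eLpNorm (fun w => fullExt Φ f w * fullExt Φ g w) 2 volume ≤
        C * eLpNorm f p volume * eLpNorm g p volume

namespace BilinearBound

variable {Φ : Vec d → Vec k} {p : ℝ≥0∞} {A A₁ A₂ B B₁ B₂ : Set (Vec d)}

lemma symm (h : BilinearBound Φ p A B) : BilinearBound Φ p B A := by
  obtain ⟨A', B', hA, hB, hA', hB', C, H⟩ := h
  refine ⟨B', A', hB, hA, hB', hA', C, fun f g hfm hgm hf hg hf0 hg0 => ?_⟩
  simpa only [mul_comm, mul_left_comm, mul_assoc] using H g f hgm hfm hg hf hg0 hf0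

lemma mono (h : BilinearBound Φ p A B) (hA : A₁ ⊆ A) (hB : B₁ ⊆ B) :
    BilinearBound Φ p A₁ B₁ := by
  obtain ⟨A', B', hA', hB', H⟩ := h
  exact ⟨A', B', hA.trans hA', hB.trans hB', H⟩

lemma empty_left : BilinearBound Φ p ∅ B := by
  refine ⟨∅, Set.univ, subset_rfl, Set.subset_univ _, .empty, .univ, 0,
    fun f g _ _ _ _ hf0 _ => ?_⟩
  have h : f = 0 := funext fun x => hf0 x (Set.notMem_empty x)
  simp [h, fullExt]

lemma union_left (hΦ : Continuous Φ) (h₁ : BilinearBound Φ p A₁ B)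
    (h₂ : BilinearBound Φ p A₂ B) : BilinearBound Φ p (A₁ ∪ A₂) B := by
  obtain ⟨A₁', B₁', hA₁, hB₁, hA₁', hB₁', C₁, H₁⟩ := h₁
  obtain ⟨A₂', B₂', hA₂, hB₂, hA₂', hB₂', C₂, H₂⟩ := h₂
  refine ⟨A₁' ∪ A₂', B₁' ∩ B₂', Set.union_subset_union hA₁ hA₂, Set.subset_inter hB₁ hB₂,
    hA₁'.union hA₂', hB₁'.inter hB₂', C₁ + C₂, fun f g hfm hgm hf hg hf0 hg0 => ?_⟩
  have e : (fun w => fullExt Φ f w * fullExt Φ g w) =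
      (fun w => fullExt Φ (A₁'.indicator f) w * fullExt Φ g w) +
        fun w => fullExt Φ (A₁'ᶜ.indicator f) w * fullExt Φ g w := by
    funext w
    rw [Pi.add_apply, ← add_mul]
    congr 1
    have := integral_add (integrable_osc_mul hΦ (hf.indicator hA₁') w)
      (integrable_osc_mul hΦ (hf.indicator hA₁'.compl) w)
    simp only [fullExt]
    rw [← this]
    refine integral_congr_ae (.of_forall fun ξ => ?_)
    simp only
    rw [← mul_add, ← Pi.add_apply (A₁'.indicator f), Set.indicator_self_add_compl]
  have hm : ∀ {D : Set (Vec d)}, MeasurableSet D → AEStronglyMeasurable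
      (fun w => fullExt Φ (D.indicator f) w * fullExt Φ g w) volume := fun hD =>
    (aestronglyMeasurable_fullExt hΦ (hf.indicator hD).aestronglyMeasurable).mul
      (aestronglyMeasurable_fullExt hΦ hg.aestronglyMeasurable)
  rw [e]
  refine (eLpNorm_add_le (hm hA₁') (hm hA₁'.compl) _root_.one_le_two).trans ?_
  rw [ENNReal.coe_add, add_mul, add_mul]
  refine add_le_add ((H₁ _ g (hfm.indicator hA₁') hgm (hf.indicator hA₁') hg
    (fun x hx => Set.indicator_of_notMem hx f) fun x hx => hg0 x fun h => hx h.1).trans ?_)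
    ((H₂ _ g (hfm.indicator hA₁'.compl) hgm (hf.indicator hA₁'.compl) hg
    (fun x hx => ?_) fun x hx => hg0 x fun h => hx h.2).trans ?_)
  · gcongr
    exact eLpNorm_indicator_le f
  · by_cases hx₁ : x ∈ A₁'
    · exact Set.indicator_of_notMem (Set.notMem_compl_iff.2 hx₁) f
    · rw [Set.indicator_of_mem (Set.mem_compl hx₁), hf0 x fun h => h.elim hx₁ hx]
  · gcongr
    exact eLpNorm_indicator_le f

lemma of_isCompact (hΦ : Continuous Φ) (hA : IsCompact A) (hB : IsCompact B)
    (h : ∀ b ∈ A, ∀ x ∈ B, ∃ δ > 0,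
      BilinearBound Φ p (Metric.closedBall b δ) (Metric.closedBall x δ)) :
    BilinearBound Φ p A B := by
  refine hA.induction_on empty_left (fun s t hst ht => ht.mono hst subset_rfl)
    (fun s t => union_left hΦ) fun b hb => ?_
  suffices H : ∃ δ > 0, BilinearBound Φ p (Metric.closedBall b δ) B by
    obtain ⟨δ, hδ, H⟩ := H
    exact ⟨_, mem_nhdsWithin_of_mem_nhds (Metric.closedBall_mem_nhds b hδ), H⟩
  refine hB.induction_on (p := fun B => ∃ δ > 0, BilinearBound Φ p (Metric.closedBall b δ) B)
    ⟨1, one_pos, empty_left.symm⟩ ?_ ?_ fun x hx => ?_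
  · rintro s t hst ⟨δ, hδ, H⟩
    exact ⟨δ, hδ, H.mono subset_rfl hst⟩
  · rintro s t ⟨δ₁, hδ₁, H₁⟩ ⟨δ₂, hδ₂, H₂⟩
    exact ⟨min δ₁ δ₂, lt_min hδ₁ hδ₂, (union_left hΦ
      (H₁.mono (Metric.closedBall_subset_closedBall (min_le_left _ _)) subset_rfl).symm
      (H₂.mono (Metric.closedBall_subset_closedBall (min_le_right _ _)) subset_rfl).symm).symm⟩
  · obtain ⟨δ, hδ, H⟩ := h b hb x hx
    exact ⟨_, mem_nhdsWithin_of_mem_nhds (Metric.closedBall_mem_nhds x hδ), δ, hδ, H⟩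

end BilinearBound

end Localization

section ExtOp

variable {d k : ℕ} {Φ : Vec d → Vec k} {S : Set (Vec d)}

lemma extOp_eq_fullExt (hS : MeasurableSet S) (f : Vec d → ℂ) :
    extOp d k S Φ f = fullExt Φ (S.indicator f) := by
  funext w
  simp only [extOp, fullExt]
  rw [← integral_indicator hS]
  refine integral_congr_ae (.of_forall fun ξ => ?_)
  by_cases h : ξ ∈ S <;> simp [h, osc]

lemma fullExt_eq_zero_of_not_integrable (hΦ : Continuous Φ) {f : Vec d → ℂ}
    (hf : ¬ Integrable f) : fullExt Φ f = 0 := by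
  funext w
  refine integral_undef fun h => hf ?_
  refine (h.bdd_mul (c := 1) (f := fun ξ =>
    osc (-(∑ i, w.1 i * ξ i + ∑ j, w.2 j * Φ ξ j))) ?_ ?_).congr ?_
  · exact (continuous_osc.comp (by fun_prop)).aestronglyMeasurable
  · exact .of_forall fun ξ => (norm_osc _).le
  · refine .of_forall fun ξ => ?_
    simp only
    rw [← mul_assoc, ← osc_add, neg_add_cancel, osc_zero, one_mul]

/-- Either the extension vanishes for lack of integrability, or `f` may be replaced by a
measurable function vanishing off `S`. -/
lemma exists_measurable_extOp_eq (hΦ : Continuous Φ) (hS : MeasurableSet S) (p : ℝ≥0∞)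
    (f : Vec d → ℂ) : ∃ f' : Vec d → ℂ, Measurable f' ∧ Integrable f' ∧ (∀ x ∉ S, f' x = 0) ∧
      extOp d k S Φ f = fullExt Φ f' ∧ eLpNorm f' p volume ≤ eLpNorm f p volume := by
  rw [extOp_eq_fullExt hS]
  by_cases hf : Integrable (S.indicator f)
  · have hm := hf.aestronglyMeasurable
    have hae : S.indicator f =ᵐ[volume] S.indicator (hm.mk _) := by
      filter_upwards [hm.ae_eq_mk] with x hx
      by_cases h : x ∈ S
      · rw [Set.indicator_of_mem h (hm.mk _), ← hx]
      · simp [h]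
    refine ⟨S.indicator (hm.mk _), hm.stronglyMeasurable_mk.measurable.indicator hS,
      hf.congr hae, fun x hx => Set.indicator_of_notMem hx _, ?_, ?_⟩
    · funext w
      refine integral_congr_ae ?_
      filter_upwards [hae] with ξ hξ
      rw [hξ]
    · rw [← eLpNorm_congr_ae hae]
      exact eLpNorm_indicator_le f
  · refine ⟨0, measurable_zero, integrable_zero _ _ _, fun _ _ => rfl, ?_, by simp⟩
    rw [fullExt_eq_zero_of_not_integrable hΦ hf]
    funext w
    simp [fullExt]

lemma IsClosedCube.isCompact (hS : IsClosedCube d S) : IsCompact S := by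
  obtain ⟨a, r, hr, rfl⟩ := hS
  have : {x : Vec d | ∀ i, |x i - a i| ≤ r} = Metric.closedBall a r := by
    ext x
    simp [dist_pi_le_iff hr, Real.dist_eq]
  rw [this]
  exact isCompact_closedBall a r

end ExtOp

/-- **The `L^{4(d+k)/(3d+k)} × L^{4(d+k)/(3d+k)} → L²` estimate.**
If `det M(t,ν₁,ν₂,ν) ≠ 0` for all `ν₁ ∈ S₁`, `ν₂ ∈ S₂`, `|t| = 1` and
`ν ∈ {ν₁, ν₂}`, then `‖E₁f · E₂g‖_{L²(ℝ^{d+k})} ≤ C ‖f‖_{L^{4(d+k)/(3d+k)}} ‖g‖_{L^{4(d+k)/(3d+k)}}`. -/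
theorem bilinear_restriction_L2
    (d k : ℕ) (hdk : k ≤ d) (hk : 1 ≤ k)
    (Φ : (Fin d → ℝ) → Fin k → ℝ) (hΦ : ContDiff ℝ (⊤ : ℕ∞) Φ)
    (S₁ S₂ : Set (Fin d → ℝ))
    (hS₁ : IsClosedCube d S₁) (hS₂ : IsClosedCube d S₂)
    (hS₁I : S₁ ⊆ Set.Icc (-1) 1) (hS₂I : S₂ ⊆ Set.Icc (-1) 1)
    (hM : ∀ ν₁ ∈ S₁, ∀ ν₂ ∈ S₂, ∀ t : Fin k → ℝ, (∑ i, t i ^ 2) = 1 →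
      ∀ ν, (ν = ν₁ ∨ ν = ν₂) → (Mmat d k Φ t ν₁ ν₂ ν).det ≠ 0) :
    ∃ C : ℝ, ∀ f g : (Fin d → ℝ) → ℂ,
      eLpNorm (fun w => extOp d k S₁ Φ f w * extOp d k S₂ Φ g w) 2 volume ≤
        ENNReal.ofReal C *
          eLpNorm f (ENNReal.ofReal (4 * ((d : ℝ) + k) / (3 * (d : ℝ) + k))) volume *
          eLpNorm g (ENNReal.ofReal (4 * ((d : ℝ) + k) / (3 * (d : ℝ) + k))) volume := by
  set p : ℝ := 4 * ((d : ℝ) + k) / (3 * (d : ℝ) + k) with hp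
  have hb : BilinearBound Φ (ENNReal.ofReal p) S₁ S₂ := by
    refine .of_isCompact hΦ.continuous hS₁.isCompact hS₂.isCompact fun b hb x hx => ?_
    obtain ⟨δ, hδ, C, H⟩ := exists_eLpNorm_fullExt_mul_le hΦ
      (transCond_left hΦ fun t ht => hM b hb x hx t ht b (.inl rfl))
      (transCond_right hΦ fun t ht => hM b hb x hx t ht x (.inr rfl)) hdk hk hp
    exact ⟨δ, hδ, _, _, subset_rfl, subset_rfl, Metric.isClosed_closedBall.measurableSet,
      Metric.isClosed_closedBall.measurableSet, C.toNNReal, H⟩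
  obtain ⟨A, B, hA, hB, -, -, C, H⟩ := hb
  refine ⟨C, fun f g => ?_⟩
  obtain ⟨f', hfm, hf, hf0, hfe, hfn⟩ := exists_measurable_extOp_eq hΦ.continuous
    hS₁.isCompact.measurableSet (ENNReal.ofReal p) f
  obtain ⟨g', hgm, hg, hg0, hge, hgn⟩ := exists_measurable_extOp_eq hΦ.continuous
    hS₂.isCompact.measurableSet (ENNReal.ofReal p) g
  rw [hfe, hge, ENNReal.ofReal_coe_nnreal]
  refine (H f' g' hfm hgm hf hg (fun x hx => hf0 x fun h => hx (hA h))
    fun x hx => hg0 x fun h => hx (hB h)).trans ?_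
  gcongr

end
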